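/- Let A, B be integers with |A| ≤ B and B ≥ 2, let M be the 2×2 real matrix with rows (0, −B) and (1, −A), and let T^ℓ be the unique nonempty compact subset of ℝ² satisfying M·T^ℓ = ⋃_{i=0}^{B−1} (T^ℓ + (i,0)). Then T^ℓ is homeomorphic to the closed unit disk {x ∈ ℝ² : ‖x‖ ≤ 1} if and only if 2|A| < B + 3. -/

import Mathlib

open Set Pointwise

noncomputable section

/-- The plane. -/
abbrev Pt : Type := Fin 2 → ℝ

/-- A planar set is disk-like if it is homeomorphic to the closed unit (Euclidean) disk. -/
def DiskLike (S : Set Pt) : Prop :=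
  Nonempty (↥S ≃ₜ ↥(Metric.closedBall (0 : EuclideanSpace ℝ (Fin 2)) 1))

/-- The set equation `M T + ((B-1)/2, 0) = (⋃_{i=0}^{B-2} (T + (i,0))) ∪ (-T)`
for `M = !![0, -B; 1, -A]`. -/
def CrysEq (A B : ℤ) (T : Set Pt) : Prop :=
  (fun x => (!![0, -(B:ℝ); 1, -(A:ℝ)]).mulVec x + ![((B:ℝ)-1)/2, 0]) '' T
    = (⋃ i ∈ Finset.Icc (0:ℤ) (B-2), (fun x => x + ![(i:ℝ), 0]) '' T) ∪ (-T)

/-- The set equation `M L = ⋃_{i=0}^{B-1} (L + (i,0))` for `M = !![0, -B; 1, -A]`. -/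
def LatEq (A B : ℤ) (L : Set Pt) : Prop :=
  (fun x => (!![0, -(B:ℝ); 1, -(A:ℝ)]).mulVec x) '' L
    = ⋃ i ∈ Finset.Icc (0:ℤ) (B-1), (fun x => x + ![(i:ℝ), 0]) '' L

/-- Membership in the crystallographic group p2: maps `x ↦ ε x + (p,q)`,
`ε = ±1`, `p q` integers. -/
def IsP2 (γ : Pt → Pt) : Prop :=
  ∃ (ε : ℝ) (p q : ℤ), (ε = 1 ∨ ε = -1) ∧ γ = fun x => ε • x + ![(p:ℝ), (q:ℝ)]

theorem exists_seq_of_closed_rel {α : Type*} [TopologicalSpace α] {T : Set α}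
    (hT : IsCompact T) (hTcl : IsClosed T) (hne : T.Nonempty) (R : ℕ → α → α → Prop)
    (hR : ∀ n, IsClosed {p : α × α | R n p.1 p.2})
    (hex : ∀ n, ∀ t' ∈ T, ∃ t ∈ T, R n t t') :
    ∃ f : ℕ → α, (∀ n, f n ∈ T) ∧ ∀ n, R n (f n) (f (n + 1)) := by
  let K : ℕ → Set (ℕ → α) := fun m => (Set.pi univ fun _ => T) ∩
    ⋂ n, ⋂ (_ : n < m), {f | R n (f n) (f (n + 1))}
  have hcl : ∀ m, IsClosed (⋂ n, ⋂ (_ : n < m), {f : ℕ → α | R n (f n) (f (n + 1))}) := by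
    intro m
    refine isClosed_iInter fun n => isClosed_iInter fun _ => ?_
    exact (hR n).preimage (f := fun f : ℕ → α => (f n, f (n + 1))) (by fun_prop)
  have hpi : IsCompact (Set.pi univ fun _ : ℕ => T) := isCompact_univ_pi fun _ => hT
  have hpicl : IsClosed (Set.pi univ fun _ : ℕ => T) := isClosed_set_pi fun _ _ => hTcl
  have hKne : ∀ m, (K m).Nonempty := by
    have key : ∀ m k : ℕ, ∃ f : ℕ → α, (∀ n, f n ∈ T) ∧
        ∀ n < m, R (n + k) (f n) (f (n + 1)) := by
      intro m
      induction m with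
      | zero =>
        obtain ⟨t, ht⟩ := hne
        exact fun k => ⟨fun _ => t, fun _ => ht, by simp⟩
      | succ m ih =>
        intro k
        obtain ⟨f, hf, hfR⟩ := ih (k + 1)
        obtain ⟨t, ht, htR⟩ := hex k (f 0) (hf 0)
        refine ⟨fun n => Nat.casesOn n t f, ?_, ?_⟩
        · rintro (_ | n)
          · exact ht
          · exact hf n
        · rintro (_ | n) hn
          · simpa using htR
          · have := hfR n (by omega)
            rwa [show n + (k + 1) = n + 1 + k by ring] at this
    intro m
    obtain ⟨f, hf, hfR⟩ := key m 0
    refine ⟨f, by simpa using hf, ?_⟩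
    simp only [mem_iInter, mem_ofPred_eq]
    exact hfR
  obtain ⟨f, hf⟩ := IsCompact.nonempty_iInter_of_sequence_nonempty_isCompact_isClosed K
    (fun m => by
      rintro f ⟨h1, h2⟩
      refine ⟨h1, ?_⟩
      simp only [mem_iInter, mem_ofPred_eq] at h2 ⊢
      exact fun n hn => h2 n (by omega)) hKne
    (hpi.inter_right (hcl 0)) (fun m => hpicl.inter (hcl m))
  rw [mem_iInter] at hf
  refine ⟨f, fun n => (hf 0).1 n (mem_univ _), fun n => ?_⟩
  have := (hf (n + 1)).2
  simp only [mem_iInter, mem_ofPred_eq] at this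
  exact this n (by omega)

theorem homeo_of_ker_eq {X Y Z : Type*} [TopologicalSpace X] [TopologicalSpace Y]
    [TopologicalSpace Z] [CompactSpace X] [T2Space Y] [T2Space Z] {p : X → Y} {q : X → Z}
    (hp : Continuous p) (hq : Continuous q) (hps : Function.Surjective p)
    (hqs : Function.Surjective q) (h : ∀ x y, p x = p y ↔ q x = q y) : Nonempty (Y ≃ₜ Z) := by
  have hpq := hp.isClosedMap.isQuotientMap hp hps
  have : CompactSpace Y := hps.compactSpace hp
  choose s hs using hps
  have hsp : ∀ x, q (s (p x)) = q x := fun x => (h _ _).1 (hs _)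
  have hc : Continuous fun y => q (s y) := by
    rw [hpq.continuous_iff]
    convert hq using 1
    ext x
    exact hsp x
  have hbij : Function.Bijective fun y => q (s y) := by
    refine ⟨fun y y' hy => ?_, fun z => ?_⟩
    · rw [← hs y, ← hs y']
      exact (h _ _).2 hy
    · obtain ⟨x, rfl⟩ := hqs z
      exact ⟨p x, hsp x⟩
  exact ⟨hc.homeoOfEquivCompactToT2 (f := Equiv.ofBijective _ hbij)⟩

theorem Seminorm.continuous_pt (N : Seminorm ℝ Pt) : Continuous N := by
  have hb : ∀ v, N v ≤ (N ![1, 0] + N ![0, 1]) * ‖v‖ := by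
    intro v
    have hv : v = v 0 • ![1, 0] + v 1 • ![0, 1] := by
      ext i; fin_cases i <;> simp
    have h0 := norm_le_pi_norm v 0
    have h1 := norm_le_pi_norm v 1
    calc N v = N (v 0 • ![1, 0] + v 1 • ![0, 1]) := by rw [← hv]
      _ ≤ N (v 0 • ![1, 0]) + N (v 1 • ![0, 1]) := map_add_le_add _ _ _
      _ = ‖v 0‖ * N ![1, 0] + ‖v 1‖ * N ![0, 1] := by rw [map_smul_eq_mul, map_smul_eq_mul]
      _ ≤ ‖v‖ * N ![1, 0] + ‖v‖ * N ![0, 1] := by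
        gcongr
      _ = _ := by ring
  refine Seminorm.continuous_of_le (q := (Real.toNNReal (N ![1, 0] + N ![0, 1])) •
    normSeminorm ℝ Pt) ?_ ?_
  · exact (continuous_const.mul continuous_norm)
  · intro v
    have := hb v
    simp only [smul_apply, coe_normSeminorm, NNReal.smul_def, smul_eq_mul]
    rwa [Real.coe_toNNReal _ (add_nonneg (apply_nonneg _ _) (apply_nonneg _ _))]

abbrev Z2 : Type := ℤ × ℤ

theorem seminorm_bounded (N : Seminorm ℝ Pt) {H : Set Pt} (hH : IsCompact H) :
    ∃ C, ∀ h ∈ H, N h ≤ C := by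
  obtain ⟨C, hC⟩ := hH.bddAbove_image N.continuous_pt.continuousOn
  exact ⟨C, fun h hh => hC ⟨h, hh, rfl⟩⟩

/-- Two compact sets with the same expanding substitution structure are homeomorphic: `T` is
self-affine, and `H` carries an equivariant contracting injective relation from
`H + D` onto `H`. -/
theorem homeo_of_contracting_relation
    (E : Z2 →+ Z2) (D : Finset Z2) (ιH ιT : Z2 →+ Pt) (ET : Pt →ₗ[ℝ] Pt)
    (hET : ∀ v, ET (ιT v) = ιT (E v))
    (hexp : ∀ e : ℕ → Pt, (∃ C, ∀ n, ‖e n‖ ≤ C) → (∀ n, e (n + 1) = ET (e n)) → e 0 = 0)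
    (hfH : ∀ C : ℝ, {v : Z2 | ‖ιH v‖ ≤ C}.Finite)
    (hfT : ∀ C : ℝ, {v : Z2 | ‖ιT v‖ ≤ C}.Finite)
    {H T : Set Pt} (hH : IsCompact H) (hHne : H.Nonempty) (hT : IsCompact T) (hTne : T.Nonempty)
    (hT1 : ∀ t ∈ T, ∃ d ∈ D, ∃ t' ∈ T, ET t = t' + ιT d)
    (hT2 : ∀ d ∈ D, ∀ t' ∈ T, ∃ t ∈ T, ET t = t' + ιT d)
    (Γ : Pt → Pt → Prop) (N : Seminorm ℝ Pt) (hN : ∀ v, N v = 0 → v = 0)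
    (c : ℝ) (hc0 : 0 ≤ c) (hc1 : c < 1)
    (heq : ∀ z w v, Γ z w → Γ (z + ιH (E v)) (w + ιH v))
    (hcon : ∀ z w z' w', Γ z w → Γ z' w' → N (w - w') ≤ c * N (z - z'))
    (hinj : ∀ z z' w, Γ z w → Γ z' w → z = z')
    (hSH : ∀ h ∈ H, ∀ d ∈ D, ∃ w ∈ H, Γ (h + ιH d) w)
    (hHS : ∀ w ∈ H, ∃ h ∈ H, ∃ d ∈ D, Γ (h + ιH d) w) :
    Nonempty (H ≃ₜ T) := by
  classical
  let G : Pt → Pt → Prop := fun z w => ∀ z' w', Γ z' w' → N (w - w') ≤ c * N (z - z')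
  have hNc := N.continuous_pt
  have hG : IsClosed {p : Pt × Pt | G p.1 p.2} := by
    simp only [G, ofPred_forall]
    refine isClosed_iInter fun z' => isClosed_iInter fun w' => isClosed_iInter fun _ => ?_
    exact isClosed_le (hNc.comp (by fun_prop))
      (continuous_const.mul (hNc.comp (by fun_prop)))
  have hΓG : ∀ z w, Γ z w → G z w := fun z w h z' w' h' => hcon z w z' w' h h'
  have hGΓ : ∀ h ∈ H, ∀ d ∈ D, ∀ w, G (h + ιH d) w → Γ (h + ιH d) w := by
    intro h hh d hd w hw
    obtain ⟨w', -, hw'⟩ := hSH h hh d hd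
    have h1 := hw _ _ hw'
    rw [sub_self, map_zero, mul_zero] at h1
    have h2 := hN _ (le_antisymm h1 (apply_nonneg _ _))
    rwa [sub_eq_zero.mp h2]
  have hETc : Continuous ET := ET.continuous_of_finiteDimensional
  let X : Set (ℕ → Pt × Pt × Z2) := {f | (∀ n, f n ∈ H ×ˢ T ×ˢ (D : Set Z2)) ∧
    (∀ n, G ((f (n + 1)).1 + ιH (f n).2.2) (f n).1) ∧
    ∀ n, ET (f n).2.1 = (f (n + 1)).2.1 + ιT (f n).2.2}
  have hιc : ∀ ι : Z2 →+ Pt, Continuous ι := fun ι => continuous_of_discreteTopology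
  have hXc : IsCompact X := by
    have h1 : IsCompact (Set.pi univ fun _ : ℕ => H ×ˢ T ×ˢ (D : Set Z2)) :=
      isCompact_univ_pi fun _ => hH.prod (hT.prod D.finite_toSet.isCompact)
    have h2 : IsClosed {f : ℕ → Pt × Pt × Z2 |
        ∀ n, G ((f (n + 1)).1 + ιH (f n).2.2) (f n).1} := by
      rw [ofPred_forall]
      refine isClosed_iInter fun n => ?_
      have := hιc ιH
      exact hG.preimage (f := fun f : ℕ → Pt × Pt × Z2 =>
        ((f (n + 1)).1 + ιH (f n).2.2, (f n).1)) (by fun_prop)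
    have h3 : IsClosed {f : ℕ → Pt × Pt × Z2 |
        ∀ n, ET (f n).2.1 = (f (n + 1)).2.1 + ιT (f n).2.2} := by
      rw [ofPred_forall]
      refine isClosed_iInter fun n => ?_
      have := hιc ιT
      exact isClosed_eq (by fun_prop) (by fun_prop)
    convert h1.inter_right (h2.inter h3) using 1
    ext f
    simp only [X, mem_ofPred_eq, mem_inter_iff, mem_pi, mem_univ, true_implies]
  have hHs : ∀ d : ℕ → Z2, (∀ n, d n ∈ D) →
      ∃ f : ℕ → Pt, (∀ n, f n ∈ H) ∧ ∀ n, G (f (n + 1) + ιH (d n)) (f n) := by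
    intro d hd
    refine exists_seq_of_closed_rel hH hH.isClosed hHne
      (fun n h h' => G (h' + ιH (d n)) h) ?_ ?_
    · intro n
      exact hG.preimage (f := fun p : Pt × Pt => (p.2 + ιH (d n), p.1)) (by fun_prop)
    · intro n h' hh'
      obtain ⟨w, hw, hΓ⟩ := hSH h' hh' (d n) (hd n)
      exact ⟨w, hw, hΓG _ _ hΓ⟩
  have hTs : ∀ d : ℕ → Z2, (∀ n, d n ∈ D) →
      ∃ f : ℕ → Pt, (∀ n, f n ∈ T) ∧ ∀ n, ET (f n) = f (n + 1) + ιT (d n) := by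
    intro d hd
    refine exists_seq_of_closed_rel hT hT.isClosed hTne
      (fun n t t' => ET t = t' + ιT (d n)) ?_ ?_
    · intro n
      exact isClosed_eq (by fun_prop) (by fun_prop)
    · intro n t' ht'
      exact hT2 (d n) (hd n) t' ht'
  have : CompactSpace X := isCompact_iff_compactSpace.mp hXc
  let p : X → H := fun f => ⟨(f.1 0).1, (f.2.1 0).1⟩
  let q : X → T := fun f => ⟨(f.1 0).2.1, (f.2.1 0).2.1⟩
  have hpc : Continuous p := by
    refine Continuous.subtype_mk ?_ _
    exact continuous_fst.comp ((continuous_apply 0).comp continuous_subtype_val)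
  have hqc : Continuous q := by
    refine Continuous.subtype_mk ?_ _
    exact (continuous_fst.comp continuous_snd).comp
      ((continuous_apply 0).comp continuous_subtype_val)
  have hps : Function.Surjective p := by
    rintro ⟨h, hh⟩
    choose! nx hnx dg hdg hΓ using hHS
    let s : ℕ → Pt := fun n => nx^[n] h
    have hs : ∀ n, s n ∈ H := by
      intro n
      induction n with
      | zero => exact hh
      | succ n ih =>
        simp only [s, Function.iterate_succ_apply']
        exact hnx _ ih
    obtain ⟨f, hf, hfR⟩ := hTs (fun n => dg (s n)) (fun n => hdg _ (hs n))
    refine ⟨⟨fun n => (s n, f n, dg (s n)), fun n => ⟨hs n, hf n, hdg _ (hs n)⟩, fun n => ?_,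
      hfR⟩, rfl⟩
    have : s (n + 1) = nx (s n) := by simp only [s, Function.iterate_succ_apply']
    simp only [this]
    exact hΓG _ _ (hΓ _ (hs n))
  have hqs : Function.Surjective q := by
    rintro ⟨t, ht⟩
    choose! dg hdg nx hnx hΓ using hT1
    let s : ℕ → Pt := fun n => nx^[n] t
    have hs : ∀ n, s n ∈ T := by
      intro n
      induction n with
      | zero => exact ht
      | succ n ih =>
        simp only [s, Function.iterate_succ_apply']
        exact hnx _ ih
    obtain ⟨f, hf, hfR⟩ := hHs (fun n => dg (s n)) (fun n => hdg _ (hs n))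
    refine ⟨⟨fun n => (f n, s n, dg (s n)), fun n => ⟨hf n, hs n, hdg _ (hs n)⟩, hfR,
      fun n => ?_⟩, rfl⟩
    have : s (n + 1) = nx (s n) := by simp only [s, Function.iterate_succ_apply']
    simp only [this]
    exact hΓ _ (hs n)
  refine homeo_of_ker_eq hpc hqc hps hqs ?_
  rintro ⟨f, hf1, hf2, hf3⟩ ⟨g, hg1, hg2, hg3⟩
  have hfΓ : ∀ n, Γ ((f (n + 1)).1 + ιH (f n).2.2) (f n).1 := fun n =>
    hGΓ _ (hf1 (n + 1)).1 _ (hf1 n).2.2 _ (hf2 n)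
  have hgΓ : ∀ n, Γ ((g (n + 1)).1 + ιH (g n).2.2) (g n).1 := fun n =>
    hGΓ _ (hg1 (n + 1)).1 _ (hg1 n).2.2 _ (hg2 n)
  let v : ℕ → Z2 := fun n => Nat.rec 0 (fun n u => E u + (g n).2.2 - (f n).2.2) n
  have hv0 : v 0 = 0 := rfl
  have hv : ∀ n, v (n + 1) = E (v n) + (g n).2.2 - (f n).2.2 := fun n => rfl
  have hbdd : ∀ (ι ι' : Z2 →+ Pt), (∀ C : ℝ, {v : Z2 | ‖ι v‖ ≤ C}.Finite) →
      ∀ K : Set Pt, IsCompact K → ∀ a b : ℕ → Pt, (∀ n, a n ∈ K) → (∀ n, b n ∈ K) →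
      (∀ n, a n = b n + ι (v n)) → ∃ C, ∀ n, ‖ι' (v n)‖ ≤ C := by
    intro ι ι' hfin K hK a b ha hb hab
    obtain ⟨C, hC⟩ := hK.isBounded.exists_norm_le
    have hm : ∀ n, v n ∈ {v : Z2 | ‖ι v‖ ≤ C + C} := by
      intro n
      have : ι (v n) = a n - b n := by rw [hab n]; abel
      simp only [mem_ofPred_eq, this]
      exact (norm_sub_le _ _).trans (add_le_add (hC _ (ha n)) (hC _ (hb n)))
    obtain ⟨C', hC'⟩ := ((hfin (C + C)).image fun v => ‖ι' v‖).bddAbove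
    exact ⟨C', fun n => hC' ⟨_, hm n, rfl⟩⟩
  simp only [p, q, Subtype.mk.injEq]
  constructor
  · intro h0
    have hh : ∀ n, (f n).1 = (g n).1 + ιH (v n) := by
      intro n
      induction n with
      | zero => simp [hv0, h0]
      | succ n ih =>
        have h1 := heq _ _ (v n) (hgΓ n)
        rw [← ih] at h1
        have h2 := hinj _ _ _ (hfΓ n) h1
        rw [hv, map_sub, map_add]
        have : (f (n + 1)).1 = (f (n + 1)).1 + ιH (f n).2.2 - ιH (f n).2.2 := by abel
        rw [this, h2]
        abel
    obtain ⟨C, hC⟩ := hbdd ιH ιT hfH H hH _ _ (fun n => (hf1 n).1) (fun n => (hg1 n).1) hh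
    obtain ⟨C', hC'⟩ := hT.isBounded.exists_norm_le
    have := hexp (fun n => (f n).2.1 - (g n).2.1 - ιT (v n)) ⟨C' + C' + C, fun n => ?_⟩ ?_
    · simpa [hv0, sub_eq_zero] using this
    · refine (norm_sub_le _ _).trans (add_le_add ((norm_sub_le _ _).trans
        (add_le_add (hC' _ (hf1 n).2.1) (hC' _ (hg1 n).2.1))) (hC n))
    · intro n
      simp only [map_sub, hf3, hg3, hv, hET, map_add]
      abel
  · intro h0
    have hh : ∀ n, (f n).2.1 = (g n).2.1 + ιT (v n) := by
      intro n
      induction n with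
      | zero => simp [hv0, h0]
      | succ n ih =>
        have h1 := hf3 n
        have h2 := hg3 n
        rw [ih, map_add, h2, hET] at h1
        rw [hv, map_sub, map_add]
        have : (f (n + 1)).2.1 = (f (n + 1)).2.1 + ιT (f n).2.2 - ιT (f n).2.2 := by abel
        rw [this, ← h1]
        abel
    obtain ⟨C, hC⟩ := hbdd ιT ιH hfT T hT _ _ (fun n => (hf1 n).2.1) (fun n => (hg1 n).2.1) hh
    obtain ⟨C', hC'⟩ := seminorm_bounded N hH
    obtain ⟨C₂, hC₂⟩ := seminorm_bounded N (isCompact_closedBall (0 : Pt) C)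
    have hstep : ∀ n, N ((f n).1 - (g n).1 - ιH (v n)) ≤
        c * N ((f (n + 1)).1 - (g (n + 1)).1 - ιH (v (n + 1))) := by
      intro n
      have h1 := hcon _ _ _ _ (hfΓ n) (heq _ _ (v n) (hgΓ n))
      have e1 : (f n).1 - (g n).1 - ιH (v n) = (f n).1 - ((g n).1 + ιH (v n)) := by abel
      have e2 : (f (n + 1)).1 - (g (n + 1)).1 - ιH (v (n + 1)) =
          (f (n + 1)).1 + ιH (f n).2.2 - ((g (n + 1)).1 + ιH (g n).2.2 + ιH (E (v n))) := by
        rw [hv, map_sub, map_add]; abel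
      rw [e1, e2]
      exact h1
    have hbd : ∀ n, N ((f n).1 - (g n).1 - ιH (v n)) ≤ C' + C' + C₂ := by
      intro n
      refine (map_sub_le_add N _ _).trans (add_le_add ((map_sub_le_add N _ _).trans
        (add_le_add (hC' _ (hf1 n).1) (hC' _ (hg1 n).1))) (hC₂ _ ?_))
      simpa using hC n
    have hpow : ∀ n, N ((f 0).1 - (g 0).1 - ιH (v 0)) ≤ c ^ n * (C' + C' + C₂) := by
      have : ∀ n, N ((f 0).1 - (g 0).1 - ιH (v 0)) ≤
          c ^ n * N ((f n).1 - (g n).1 - ιH (v n)) := by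
        intro n
        induction n with
        | zero => simp
        | succ n ih =>
          refine ih.trans ?_
          rw [pow_succ, mul_assoc]
          exact mul_le_mul_of_nonneg_left (hstep n) (pow_nonneg hc0 n)
      exact fun n => (this n).trans (mul_le_mul_of_nonneg_left (hbd n) (pow_nonneg hc0 n))
    have hlim : Filter.Tendsto (fun n : ℕ => c ^ n * (C' + C' + C₂)) Filter.atTop (nhds 0) := by
      simpa using (tendsto_pow_atTop_nhds_zero_of_lt_one hc0 hc1).mul_const (C' + C' + C₂)
    have hz : N ((f 0).1 - (g 0).1 - ιH (v 0)) ≤ 0 := ge_of_tendsto' hlim hpow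
    have := hN _ (le_antisymm hz (apply_nonneg _ _))
    simpa [hv0, sub_eq_zero] using this

/-- The closed unit square. -/
def unitSquare : Set Pt := {z | 0 ≤ z 0 ∧ z 0 ≤ 1 ∧ 0 ≤ z 1 ∧ z 1 ≤ 1}

theorem unitSquare_eq_Icc : unitSquare = Icc 0 1 := by
  ext z
  simp only [unitSquare, mem_ofPred_eq, mem_Icc, Pi.le_def, Fin.forall_fin_two, Pi.zero_apply,
    Pi.one_apply]
  tauto

theorem isCompact_unitSquare : IsCompact unitSquare := unitSquare_eq_Icc ▸ isCompact_Icc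

theorem unitSquare_nonempty : unitSquare.Nonempty := ⟨0, by simp [unitSquare]⟩

theorem diskLike_of_homeo_unitSquare {L : Set Pt} (h : Nonempty (unitSquare ≃ₜ L)) :
    DiskLike L := by
  obtain ⟨h⟩ := h
  let φ := (EuclideanSpace.equiv (Fin 2) ℝ).symm
  let s : Set (EuclideanSpace ℝ (Fin 2)) := φ '' unitSquare
  have hcv : Convex ℝ s := by
    have : Convex ℝ unitSquare := unitSquare_eq_Icc ▸ convex_Icc _ _
    exact this.linear_image φ.toLinearEquiv.toLinearMap
  have hcp : IsCompact s := isCompact_unitSquare.image φ.continuous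
  have hint : (interior s).Nonempty := by
    have h1 : (interior unitSquare).Nonempty := by
      rw [unitSquare_eq_Icc, ← pi_univ_Icc, interior_pi_set finite_univ]
      refine ⟨fun _ => 1 / 2, fun i _ => ?_⟩
      simp only [Pi.zero_apply, Pi.one_apply, interior_Icc, mem_Ioo]
      norm_num
    have h2 : φ '' interior unitSquare = interior s :=
      φ.toHomeomorph.image_interior unitSquare
    rw [← h2]
    exact h1.image _
  obtain ⟨g, -, hg, -⟩ := exists_homeomorph_image_interior_closure_frontier_eq_unitBall hcv hint
    hcp.isBounded
  rw [hcp.isClosed.closure_eq] at hg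
  exact ⟨h.symm.trans ((φ.toHomeomorph.image unitSquare).trans
    ((g.image s).trans (Homeomorph.setCongr hg)))⟩

/-- The matrix `!![0, -B; 1, -A]` as a linear map. -/
def latMap (A B : ℤ) : Pt →ₗ[ℝ] Pt := (!![0, -(B:ℝ); 1, -(A:ℝ)]).mulVecLin

theorem latMap_apply (A B : ℤ) (x : Pt) :
    latMap A B x = ![-(B:ℝ) * x 1, x 0 - A * x 1] := by
  ext i
  fin_cases i <;> simp [latMap, Matrix.mulVec, dotProduct, Fin.sum_univ_two, sub_eq_add_neg]

theorem LatEq.exists_of_mem {A B : ℤ} {L : Set Pt} (h : LatEq A B L) {t : Pt} (ht : t ∈ L) :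
    ∃ i : ℤ, 0 ≤ i ∧ i ≤ B - 1 ∧ ∃ t' ∈ L, latMap A B t = t' + ![(i:ℝ), 0] := by
  have h1 : latMap A B t ∈ ⋃ i ∈ Finset.Icc (0:ℤ) (B-1), (fun x => x + ![(i:ℝ), 0]) '' L := by
    rw [← h]; exact ⟨t, ht, rfl⟩
  simp only [mem_iUnion, Finset.mem_Icc, mem_image] at h1
  obtain ⟨i, ⟨h0, h1⟩, t', ht', he⟩ := h1
  exact ⟨i, h0, h1, t', ht', he.symm⟩

theorem LatEq.exists_preimage {A B : ℤ} {L : Set Pt} (h : LatEq A B L) {i : ℤ} (h0 : 0 ≤ i)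
    (h1 : i ≤ B - 1) {t' : Pt} (ht : t' ∈ L) :
    ∃ t ∈ L, latMap A B t = t' + ![(i:ℝ), 0] := by
  have h1 : t' + ![(i:ℝ), 0] ∈
      ⋃ i ∈ Finset.Icc (0:ℤ) (B-1), (fun x => x + ![(i:ℝ), 0]) '' L := by
    simp only [mem_iUnion, Finset.mem_Icc, mem_image]
    exact ⟨i, ⟨h0, h1⟩, t', ht, rfl⟩
  rw [← h] at h1
  exact h1

theorem recurrence_coeff_le {A B : ℤ} (hAB : |A| ≤ B) (hB : 2 ≤ B) :
    |(A:ℝ)| / B * |(A:ℝ) ^ 2 / B ^ 2 - 2 / B| + |(A:ℝ) ^ 2 / B ^ 2 - 1 / B| / B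
      ≤ 1 - 1 / (B:ℝ) ^ 2 := by
  rcases hB.eq_or_lt with rfl | hB3
  · have := abs_le.1 hAB
    obtain ⟨h1, h2⟩ := this
    interval_cases A <;> norm_num [abs_of_pos, abs_of_neg]
  · have hB' : (3:ℝ) ≤ B := by exact_mod_cast hB3
    have hA : |(A:ℝ)| ≤ B := by exact_mod_cast hAB
    have hb : 1 / (B:ℝ) ≤ 1 / 3 := one_div_le_one_div_of_le (by norm_num) hB'
    have hb0 : 0 < 1 / (B:ℝ) := by positivity
    have hr1 : |(A:ℝ)| / B ≤ 1 := (div_le_one (by linarith)).2 hA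
    have hr0 : 0 ≤ |(A:ℝ)| / B := by positivity
    have hr2 : (A:ℝ) ^ 2 / B ^ 2 = (|(A:ℝ)| / B) ^ 2 := by rw [div_pow, sq_abs]
    rw [hr2]
    have e2 : 2 / (B:ℝ) = 2 * (1 / B) := by ring
    have e3 : 1 / (B:ℝ) ^ 2 = (1 / (B:ℝ)) ^ 2 := by ring
    rw [e2, e3, div_eq_mul_one_div (|_ - _|)]
    generalize 1 / (B:ℝ) = b at *
    generalize |(A:ℝ)| / B = r at *
    have hq : r ^ 2 ≤ 1 := by nlinarith
    have h1 : |r ^ 2 - 2 * b| ≤ 1 - b := by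
      rw [abs_le]; constructor <;> nlinarith
    have h2 : |r ^ 2 - b| ≤ 1 - b := by
      rw [abs_le]; constructor <;> nlinarith
    have h3 : r * |r ^ 2 - 2 * b| ≤ 1 - b := by
      calc _ ≤ 1 * |r ^ 2 - 2 * b| := by gcongr
        _ ≤ _ := by linarith
    nlinarith

theorem latMap_expanding {A B : ℤ} (hAB : |A| ≤ B) (hB : 2 ≤ B) (e : ℕ → Pt)
    (hb : ∃ C, ∀ n, ‖e n‖ ≤ C) (he : ∀ n, e (n + 1) = latMap A B (e n)) : e 0 = 0 := by
  obtain ⟨C, hC⟩ := hb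
  have hB0 : (0:ℝ) < B := by exact_mod_cast (by omega : 0 < B)
  have h0 : ∀ n, e (n + 1) 0 = -(B:ℝ) * e n 1 := fun n => by rw [he, latMap_apply]; simp
  have h1 : ∀ n, e (n + 1) 1 = e n 0 - A * e n 1 := fun n => by rw [he, latMap_apply]; simp
  have hrec : ∀ n, e n 1 = -(A / B) * e (n + 1) 1 - 1 / B * e (n + 2) 1 := fun n => by
    rw [h1 (n + 1), h0]; field_simp; ring
  set c := 1 - 1 / (B:ℝ) ^ 2 with hc
  have hc0 : 0 ≤ c := by
    have : (1:ℝ) ≤ B := by exact_mod_cast (by omega : 1 ≤ B)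
    rw [hc, sub_nonneg, div_le_one (by positivity)]
    nlinarith
  have hc1 : c < 1 := by
    rw [hc]; have : 0 < 1 / (B:ℝ) ^ 2 := by positivity
    linarith
  have hrec3 : ∀ n, e n 1 = -(A / B * (A ^ 2 / B ^ 2 - 2 / B)) * e (n + 3) 1 -
      ((A ^ 2 / B ^ 2 - 1 / B) / B) * e (n + 4) 1 := fun n => by
    rw [hrec n, hrec (n + 1), hrec (n + 2)]; field_simp; ring
  have hstep : ∀ k n, |e n 1| ≤ c ^ k * C := by
    intro k
    induction k with
    | zero => intro n; simpa using (norm_le_pi_norm (e n) 1).trans (hC n)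
    | succ k ih =>
      intro n
      have hk := (abs_nonneg _).trans (ih 0)
      have hco := recurrence_coeff_le hAB hB
      rw [hrec3 n]
      refine (abs_sub _ _).trans ?_
      rw [abs_mul, abs_mul, abs_neg, abs_mul, abs_div, abs_div, abs_of_pos hB0]
      calc _ ≤ |(A:ℝ)| / B * |(A:ℝ) ^ 2 / B ^ 2 - 2 / B| * (c ^ k * C) +
            |(A:ℝ) ^ 2 / B ^ 2 - 1 / B| / B * (c ^ k * C) := by
            gcongr
            · exact ih _
            · exact ih _
        _ = (|(A:ℝ)| / B * |(A:ℝ) ^ 2 / B ^ 2 - 2 / B| +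
            |(A:ℝ) ^ 2 / B ^ 2 - 1 / B| / B) * (c ^ k * C) := by ring
        _ ≤ c * (c ^ k * C) := by gcongr
        _ = _ := by ring
  have hz : ∀ n, e n 1 = 0 := by
    intro n
    have hlim : Filter.Tendsto (fun k : ℕ => c ^ k * C) Filter.atTop (nhds 0) := by
      simpa using (tendsto_pow_atTop_nhds_zero_of_lt_one hc0 hc1).mul_const C
    have := ge_of_tendsto' hlim fun k => hstep k n
    exact abs_eq_zero.1 (le_antisymm this (abs_nonneg _))
  ext i
  fin_cases i
  · have := h1 0
    simp only [hz] at this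
    simp; linarith
  · simpa using hz 0

/-- The additive map `ℤ² → ℝ²` with prescribed values on the standard basis. -/
def latticeMap (u v : Pt) : Z2 →+ Pt where
  toFun w := (w.1 : ℝ) • u + (w.2 : ℝ) • v
  map_zero' := by simp
  map_add' w w' := by simp only [Prod.fst_add, Prod.snd_add, Int.cast_add, add_smul]; abel

theorem latticeMap_apply (u v : Pt) (w : Z2) :
    latticeMap u v w = ![w.1 * u 0 + w.2 * v 0, w.1 * u 1 + w.2 * v 1] := by
  ext i
  fin_cases i <;> simp [latticeMap]

theorem latticeMap_finite {u v : Pt} (h : u 0 * v 1 - u 1 * v 0 ≠ 0) (C : ℝ) :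
    {w : Z2 | ‖latticeMap u v w‖ ≤ C}.Finite := by
  set δ := u 0 * v 1 - u 1 * v 0
  let K := (|u 0| + |u 1| + |v 0| + |v 1|) * C / |δ|
  have hδ : 0 < |δ| := abs_pos.2 h
  refine ((finite_Icc (-⌈K⌉) ⌈K⌉).prod (finite_Icc (-⌈K⌉) ⌈K⌉)).subset ?_
  rintro w hw
  have hw0 := (norm_le_pi_norm (latticeMap u v w) 0).trans hw
  have hw1 := (norm_le_pi_norm (latticeMap u v w) 1).trans hw
  rw [latticeMap_apply] at hw0 hw1
  simp only [Matrix.cons_val_zero, Matrix.cons_val_one, Real.norm_eq_abs] at hw0 hw1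
  have hC : 0 ≤ C := (abs_nonneg _).trans hw0
  set X := w.1 * u 0 + w.2 * v 0
  set Y := w.1 * u 1 + w.2 * v 1
  have e1 : (w.1:ℝ) * δ = v 1 * X - v 0 * Y := by simp only [X, Y, δ]; ring
  have e2 : (w.2:ℝ) * δ = u 0 * Y - u 1 * X := by simp only [X, Y, δ]; ring
  have b1 : |(w.1:ℝ)| ≤ K := by
    rw [le_div_iff₀ hδ, ← abs_mul, e1]
    refine (abs_sub _ _).trans ?_
    rw [abs_mul, abs_mul]
    have := mul_le_mul_of_nonneg_left hw0 (abs_nonneg (v 1))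
    have := mul_le_mul_of_nonneg_left hw1 (abs_nonneg (v 0))
    have := mul_nonneg (abs_nonneg (u 0)) hC
    have := mul_nonneg (abs_nonneg (u 1)) hC
    linarith
  have b2 : |(w.2:ℝ)| ≤ K := by
    rw [le_div_iff₀ hδ, ← abs_mul, e2]
    refine (abs_sub _ _).trans ?_
    rw [abs_mul, abs_mul]
    have := mul_le_mul_of_nonneg_left hw1 (abs_nonneg (u 0))
    have := mul_le_mul_of_nonneg_left hw0 (abs_nonneg (u 1))
    have := mul_nonneg (abs_nonneg (v 0)) hC
    have := mul_nonneg (abs_nonneg (v 1)) hC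
    linarith
  have key : ∀ p : ℤ, |(p:ℝ)| ≤ K → p ∈ Icc (-⌈K⌉) ⌈K⌉ := by
    intro p hp
    rw [abs_le] at hp
    have := Int.le_ceil K
    constructor
    · have : ((-⌈K⌉ : ℤ) : ℝ) ≤ p := by push_cast; linarith
      exact_mod_cast this
    · have : (p:ℝ) ≤ (⌈K⌉ : ℤ) := by linarith
      exact_mod_cast this
  exact ⟨key _ b1, key _ b2⟩

/-- The substitution `e₂ ↦ ε (e₁ + a e₂)`, `e₁ ↦ -ε B e₂` on `ℤ²`. -/
def substMap (a B ε : ℤ) : Z2 →+ Z2 where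
  toFun v := (ε * v.2, ε * (a * v.2 - B * v.1))
  map_zero' := by simp
  map_add' v w := by ext <;> simp <;> ring

theorem latMap_latticeMap {A B a ε : ℤ} (hε : ε * ε = 1) (hA : A = -(ε * a)) (v : Z2) :
    latMap A B (latticeMap ![-(a:ℝ), ε] ![1, 0] v) =
      latticeMap ![-(a:ℝ), ε] ![1, 0] (substMap a B ε v) := by
  have h : (ε:ℝ) * ε = 1 := by exact_mod_cast hε
  have h2 : (A:ℝ) = -(ε * a) := by exact_mod_cast hA
  rw [latMap_apply, latticeMap_apply, latticeMap_apply]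
  simp only [substMap, AddMonoidHom.coe_mk, ZeroHom.coe_mk, Matrix.cons_val_zero,
    Matrix.cons_val_one]
  push_cast
  ext i
  fin_cases i <;> simp [h2]
  · ring
  · linear_combination (v.1 * a - v.2 : ℝ) * h

theorem center_sub_mem_unitSquare {w : Pt} (hw : w ∈ unitSquare) : 1 - w ∈ unitSquare := by
  obtain ⟨h1, h2, h3, h4⟩ := hw
  simp only [unitSquare, mem_ofPred_eq, Pi.sub_apply, Pi.one_apply]
  exact ⟨by linarith, by linarith, by linarith, by linarith⟩

/-- `L` is the lattice tile of `latMap A B`, where `A = -ε a` with a sign `ε`. -/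
structure IsTile (A B a ε : ℤ) (L : Set Pt) : Prop where
  sign : ε = 1 ∨ ε = -1
  eq_neg : A = -(ε * a)
  abs_le : |A| ≤ B
  two_le : 2 ≤ B
  nonempty : L.Nonempty
  isCompact : IsCompact L
  latEq : LatEq A B L

/-- A contracting injective relation between the unit square with digits stacked along `e₂` and
the unit square, equivariant with respect to the (unsigned) substitution, makes the lattice tile
a disk. -/
theorem diskLike_of_relation {A B a ε : ℤ} {L : Set Pt} (hT : IsTile A B a ε L) (e₁ e₂ : Pt) (hdet : e₁ 0 * e₂ 1 - e₁ 1 * e₂ 0 ≠ 0)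
    (Γ : Pt → Pt → Prop) (N : Seminorm ℝ Pt) (hN : ∀ v, N v = 0 → v = 0)
    (c : ℝ) (hc0 : 0 ≤ c) (hc1 : c < 1)
    (heq : ∀ z w (p q : ℤ), Γ z w →
      Γ (z + latticeMap e₁ e₂ (q, a * q - B * p)) (w + latticeMap e₁ e₂ (p, q)))
    (hcon : ∀ z w z' w', Γ z w → Γ z' w' → N (w - w') ≤ c * N (z - z'))
    (hinj : ∀ z z' w, Γ z w → Γ z' w → z = z')
    (hSH : ∀ h ∈ unitSquare, ∀ d : ℤ, 0 ≤ d → d ≤ B - 1 →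
      ∃ w ∈ unitSquare, Γ (h + latticeMap e₁ e₂ (0, d)) w)
    (hHS : ∀ w ∈ unitSquare, ∃ h ∈ unitSquare, ∃ d : ℤ, 0 ≤ d ∧ d ≤ B - 1 ∧
      Γ (h + latticeMap e₁ e₂ (0, d)) w) :
    DiskLike L := by
  classical
  obtain ⟨hε, hA, hAB, hB, hLne, hLc, hL⟩ := hT
  have hεε : ε * ε = 1 := by rcases hε with rfl | rfl <;> rfl
  refine diskLike_of_homeo_unitSquare ?_
  let Γ' : Pt → Pt → Prop := fun z w => Γ z (if ε = 1 then w else 1 - w)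
  have hdig : ∀ d : ℤ, latticeMap ![-(a:ℝ), ε] ![1, 0] (0, d) = ![(d:ℝ), 0] := by
    intro d
    rw [latticeMap_apply]; simp
  refine homeo_of_contracting_relation (substMap a B ε)
    ((Finset.Icc 0 (B - 1)).image fun d => ((0, d) : Z2)) (latticeMap e₁ e₂)
    (latticeMap ![-(a:ℝ), ε] ![1, 0]) (latMap A B) (latMap_latticeMap hεε hA)
    (latMap_expanding hAB hB) (latticeMap_finite hdet) (latticeMap_finite ?_)
    isCompact_unitSquare unitSquare_nonempty hLc hLne ?_ ?_ Γ' N hN c hc0 hc1 ?_ ?_ ?_ ?_ ?_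
  · rcases hε with rfl | rfl <;> simp
  · intro t ht
    obtain ⟨i, h0, h1, t', ht', he⟩ := hL.exists_of_mem ht
    exact ⟨(0, i), Finset.mem_image_of_mem _ (Finset.mem_Icc.2 ⟨h0, h1⟩), t', ht', by
      rw [he, hdig]⟩
  · intro d hd t' ht'
    obtain ⟨i, hi, rfl⟩ := Finset.mem_image.1 hd
    rw [Finset.mem_Icc] at hi
    obtain ⟨t, ht, he⟩ := hL.exists_preimage hi.1 hi.2 ht'
    exact ⟨t, ht, by rw [he, hdig]⟩
  · rintro z w ⟨p, q⟩ h
    rcases hε with rfl | rfl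
    · have := heq z w p q (by simpa [Γ'] using h)
      simpa [Γ', substMap] using this
    · have h' : Γ z (1 - w) := by simpa [Γ'] using h
      have := heq z (1 - w) (-p) (-q) h'
      have e : (1:Pt) - w + latticeMap e₁ e₂ (-p, -q) = 1 - (w + latticeMap e₁ e₂ (p, q)) := by
        rw [show ((-p, -q) : Z2) = -(p, q) from rfl, map_neg]; abel
      rw [e] at this
      have e2 : ((-q, a * -q - B * -p) : Z2) = substMap a B (-1) (p, q) := by
        simp only [substMap, AddMonoidHom.coe_mk, ZeroHom.coe_mk, Prod.mk.injEq]
        constructor <;> ring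
      rw [e2] at this
      simpa [Γ'] using this
  · intro z w z' w' h h'
    have := hcon _ _ _ _ h h'
    rcases hε with rfl | rfl
    · simpa using this
    · have e : (1:Pt) - w - (1 - w') = w' - w := by abel
      simp only [show ¬ ((-1:ℤ) = 1) by decide, if_false, e] at this
      rwa [map_sub_rev] at this
  · exact fun z z' w h h' => hinj _ _ _ h h'
  · intro h hh d hd
    obtain ⟨i, hi, rfl⟩ := Finset.mem_image.1 hd
    rw [Finset.mem_Icc] at hi
    obtain ⟨w, hw, hΓ⟩ := hSH h hh i hi.1 hi.2
    rcases hε with rfl | rfl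
    · exact ⟨w, hw, by simpa [Γ'] using hΓ⟩
    · exact ⟨1 - w, center_sub_mem_unitSquare hw, by simpa [Γ'] using hΓ⟩
  · intro w hw
    rcases hε with rfl | rfl
    · obtain ⟨h, hh, d, h0, h1, hΓ⟩ := hHS w hw
      exact ⟨h, hh, (0, d), Finset.mem_image_of_mem _ (Finset.mem_Icc.2 ⟨h0, h1⟩), by
        simpa [Γ'] using hΓ⟩
    · obtain ⟨h, hh, d, h0, h1, hΓ⟩ := hHS _ (center_sub_mem_unitSquare hw)
      exact ⟨h, hh, (0, d), Finset.mem_image_of_mem _ (Finset.mem_Icc.2 ⟨h0, h1⟩), by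
        simpa [Γ'] using hΓ⟩

/-- `m` lies between the lower and the upper limit of the floor function at `U`. -/
def FilledFloor (m U : ℝ) : Prop := (⌈U⌉ : ℝ) - 1 ≤ m ∧ m ≤ ⌊U⌋

theorem FilledFloor.mono {m m' U U' : ℝ} (h : FilledFloor m U) (h' : FilledFloor m' U')
    (hU : U < U') : m ≤ m' := by
  have h1 : (⌊U⌋ : ℝ) < ⌈U'⌉ := ((Int.floor_le U).trans_lt hU).trans_le (Int.le_ceil U')
  have h2 : ⌊U⌋ < ⌈U'⌉ := by exact_mod_cast h1
  have h3 : (⌊U⌋ : ℝ) + 1 ≤ ⌈U'⌉ := by exact_mod_cast h2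
  linarith [h.2, h'.1]

theorem FilledFloor.add_int {m U : ℝ} (h : FilledFloor m U) (k : ℤ) :
    FilledFloor (m + k) (U + k) := by
  constructor
  · rw [Int.ceil_add_intCast]; push_cast; linarith [h.1]
  · rw [Int.floor_add_intCast]; push_cast; linarith [h.2]

theorem filledFloor_of_mem {k : ℤ} {U : ℝ} (h0 : k ≤ U) (h1 : U ≤ k + 1) :
    FilledFloor k U := by
  constructor
  · have : ⌈U⌉ ≤ k + 1 := Int.ceil_le.2 (by push_cast; exact h1)
    have : (⌈U⌉ : ℝ) ≤ k + 1 := by exact_mod_cast this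
    linarith
  · exact_mod_cast Int.le_floor.2 h0

theorem filledFloor_int {k : ℤ} {m : ℝ} (h0 : k - 1 ≤ m) (h1 : m ≤ k) : FilledFloor m k := by
  constructor <;> simp <;> linarith

/-- The piecewise affine relation which sends bricks of a running-bond pattern to unit cells. -/
def BrickRel (θ y₁ δ ℓ : ℝ) (z w : Pt) : Prop :=
  ∃ U m n : ℝ, FilledFloor m U ∧ FilledFloor n (U - z 0) ∧
    z 1 = δ * U + y₁ * (m + 1 - z 0) + (ℓ - y₁) * (n + 1) ∧
    w = ![1 - (z 1 - δ * U) / ℓ, (1 - θ) * z 0 + θ * U]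

theorem BrickRel.add_lattice {θ y₁ δ ℓ a B : ℝ} (hℓ : 0 < ℓ) (hδ : a = δ + θ) (hB : B = ℓ + δ)
    {z w : Pt} (h : BrickRel θ y₁ δ ℓ z w) (p q : ℤ) :
    BrickRel θ y₁ δ ℓ (z + ![(q : ℝ), a * q - B * p - θ * q]) (w + ![(p : ℝ), q - θ * p]) := by
  obtain ⟨U, m, n, hm, hn, hy, rfl⟩ := h
  refine ⟨U + ((q - p : ℤ) : ℝ), m + ((q - p : ℤ) : ℝ), n + ((-p : ℤ) : ℝ), hm.add_int _, ?_, ?_, ?_⟩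
  · have := hn.add_int (-p)
    convert this using 1
    simp; ring
  · simp only [Pi.add_apply, hy, Matrix.cons_val_zero, Matrix.cons_val_one]
    push_cast
    rw [hδ, hB]; ring
  · ext i
    fin_cases i
    · simp
      rw [hδ, hB]; field_simp; ring
    · simp; ring

theorem seminorm_affine_le (N : Seminorm ℝ Pt) (P D : Pt) {u v s C : ℝ} (h1 : u ≤ s) (h2 : s ≤ v)
    (hu : N (P + u • D) ≤ C) (hv : N (P + v • D) ≤ C) : N (P + s • D) ≤ C := by
  have hc : ConvexOn ℝ univ fun t : ℝ => N (P + t • D) := by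
    have := N.convexOn.comp_affineMap (AffineMap.lineMap P (P + D))
    simpa [Function.comp_def, AffineMap.lineMap_apply, add_comm] using this
  exact (hc.le_max_of_mem_Icc (mem_univ u) (mem_univ v) ⟨h1, h2⟩).trans (max_le hu hv)

theorem BrickRel.seminorm_le {θ y₁ δ ℓ : ℝ} (hδ : 0 < δ) (hℓ : y₁ < ℓ) (hy₁ : 0 < y₁)
    (N : Seminorm ℝ Pt) {c : ℝ}
    (h₁ : ∀ x y, N ![-(y / ℓ), (1 - θ) * x] ≤ c * N ![x, y])
    (h₂ : ∀ x y, N ![y₁ * x / ℓ, (1 - θ) * x + θ * ((y + y₁ * x) / δ)] ≤ c * N ![x, y])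
    (h₃ : ∀ x y, N ![(δ * x - y) / ℓ, x] ≤ c * N ![x, y])
    {z w z' w' : Pt} (h : BrickRel θ y₁ δ ℓ z w) (h' : BrickRel θ y₁ δ ℓ z' w') :
    N (w - w') ≤ c * N (z - z') := by
  have hℓ0 : 0 < ℓ := hy₁.trans hℓ
  wlog hx : z' 0 ≤ z 0 generalizing z w z' w'
  · rw [map_sub_rev, map_sub_rev N z]
    exact this h' h (le_of_not_ge hx)
  obtain ⟨U, m, n, hm, hn, hy, rfl⟩ := h
  obtain ⟨U', m', n', hm', hn', hy', rfl⟩ := h'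
  set x := z 0 - z' 0 with hxd
  set y := z 1 - z' 1 with hyd
  have hz : z - z' = ![x, y] := by ext i; fin_cases i <;> simp [x, y]
  let P : Pt := ![-(y / ℓ), (1 - θ) * x]
  let D : Pt := ![δ / ℓ, θ]
  have hw : ![1 - (z 1 - δ * U) / ℓ, (1 - θ) * z 0 + θ * U] -
      ![1 - (z' 1 - δ * U') / ℓ, (1 - θ) * z' 0 + θ * U'] = P + (U - U') • D := by
    ext i
    fin_cases i
    · simp [P, D, y]; field_simp; ring
    · simp [P, D, x]; ring
  have p₁ : N (P + (0 : ℝ) • D) ≤ c * N ![x, y] := by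
    rw [zero_smul, add_zero]
    exact h₁ x y
  have p₃ : N (P + x • D) ≤ c * N ![x, y] := by
    convert h₃ x y using 2
    ext i
    fin_cases i
    · simp [P, D]; field_simp; ring
    · simp [P, D]; ring
  have p₂ : N (P + ((y + y₁ * x) / δ) • D) ≤ c * N ![x, y] := by
    convert h₂ x y using 2
    ext i
    fin_cases i
    · simp [P, D]; field_simp; ring
    · simp [P, D]; ring
  rw [hw, hz]
  have hyeq : y = δ * (U - U') + y₁ * (m - m' - x) + (ℓ - y₁) * (n - n') := by
    rw [hyd, hxd, hy, hy']; ring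
  rcases lt_or_ge (U - U') 0 with hU | hU
  · have hm1 : m ≤ m' := hm.mono hm' (by linarith)
    have hn1 : n ≤ n' := hn.mono hn' (by linarith)
    refine seminorm_affine_le N P D (u := (y + y₁ * x) / δ) ?_ hU.le p₂ p₁
    rw [div_le_iff₀ hδ, hyeq]
    nlinarith
  · rcases le_or_gt (U - U') x with hUx | hUx
    · exact seminorm_affine_le N P D hU hUx p₁ p₃
    · have hm1 : m' ≤ m := hm'.mono hm (by linarith)
      have hn1 : n' ≤ n := hn'.mono hn (by linarith)
      refine seminorm_affine_le N P D (v := (y + y₁ * x) / δ) hUx.le ?_ p₃ p₂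
      rw [le_div_iff₀ hδ, hyeq]
      nlinarith

theorem BrickRel.injective {θ y₁ δ ℓ : ℝ} (hθ0 : 0 < θ) (hθ1 : θ < 1) (hℓ : y₁ < ℓ)
    (hy₁ : 0 < y₁) {z z' w : Pt} (h : BrickRel θ y₁ δ ℓ z w) (h' : BrickRel θ y₁ δ ℓ z' w) :
    z = z' := by
  have hℓ0 : 0 < ℓ := hy₁.trans hℓ
  wlog hx : z' 0 ≤ z 0 generalizing z z'
  · exact (this h' h (le_of_not_ge hx)).symm
  obtain ⟨U, m, n, hm, hn, hy, rfl⟩ := h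
  obtain ⟨U', m', n', hm', hn', hy', he⟩ := h'
  have e0 := congrFun he 0
  have e1 := congrFun he 1
  simp only [Matrix.cons_val_zero, Matrix.cons_val_one] at e0 e1
  have e2 : z 1 - z' 1 = δ * (U - U') := by
    have : (z 1 - δ * U) / ℓ = (z' 1 - δ * U') / ℓ := by linarith
    rw [div_left_inj' hℓ0.ne'] at this
    linarith
  rcases lt_or_ge U U' with hU | hU
  · have hm1 : m ≤ m' := hm.mono hm' hU
    have hn1 : n ≤ n' := hn.mono hn' (by linarith)
    have hpos : 0 < z 0 - z' 0 := by
      by_contra hcon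
      have : (1 - θ) * (z 0 - z' 0) = θ * (U' - U) := by linarith
      nlinarith
    have : 0 = y₁ * (m - m' - (z 0 - z' 0)) + (ℓ - y₁) * (n - n') := by
      linear_combination hy - hy' - e2
    nlinarith
  · have hU2 : U = U' := by
      have : (1 - θ) * (z 0 - z' 0) = θ * (U' - U) := by linarith
      nlinarith
    subst hU2
    ext i
    fin_cases i
    · have : (1 - θ) * (z 0 - z' 0) = 0 := by linarith
      rcases mul_eq_zero.1 this with h | h
      · linarith
      · simp; linarith
    · simp; linarith

theorem BrickRel.exists_image {θ y₁ δ ℓ : ℝ} (hθ0 : 0 < θ) (hθ1 : θ < 1) (hδ : 0 < δ)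
    (hℓ : y₁ < ℓ) (hy₁ : 0 < y₁) {z : Pt} (hx0 : 0 ≤ z 0) (hx1 : z 0 ≤ 1) (hy0 : 0 ≤ z 1)
    (hy1 : z 1 ≤ ℓ + δ) : ∃ w ∈ unitSquare, BrickRel θ y₁ δ ℓ z w := by
  have hℓ0 : 0 < ℓ := hy₁.trans hℓ
  have hℓy : 0 < ℓ - y₁ := by linarith
  suffices h : ∃ U m n : ℝ, 0 ≤ U ∧ U ≤ 1 ∧ FilledFloor m U ∧ FilledFloor n (U - z 0) ∧
      z 1 = δ * U + y₁ * (m + 1 - z 0) + (ℓ - y₁) * (n + 1) ∧ 0 ≤ z 1 - δ * U ∧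
      z 1 - δ * U ≤ ℓ by
    obtain ⟨U, m, n, hU0, hU1, hm, hn, hy, h0, h1⟩ := h
    refine ⟨_, ?_, U, m, n, hm, hn, hy, rfl⟩
    have h2 := (div_le_one hℓ0).2 h1
    have h3 := div_nonneg h0 hℓ0.le
    simp only [unitSquare, mem_ofPred_eq, Matrix.cons_val_zero, Matrix.cons_val_one]
    refine ⟨by linarith, by linarith, by nlinarith, by nlinarith⟩
  generalize z 0 = x at *
  generalize z 1 = y at *
  have f0 : ∀ U : ℝ, 0 ≤ U → U ≤ 1 → FilledFloor 0 U := fun U h0 h1 => by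
    simpa using filledFloor_of_mem (k := 0) (U := U) (by simpa) (by simpa)
  have f1 : ∀ U : ℝ, -1 ≤ U → U ≤ 0 → FilledFloor (-1) U := fun U h0 h1 => by
    simpa using filledFloor_of_mem (k := -1) (U := U) (by simpa) (by simpa)
  have f2 : ∀ m : ℝ, -1 ≤ m → m ≤ 0 → FilledFloor m 0 := fun m h0 h1 => by
    simpa using filledFloor_int (k := 0) (m := m) (by simpa) (by simpa)
  have f3 : ∀ m : ℝ, 0 ≤ m → m ≤ 1 → FilledFloor m 1 := fun m h0 h1 => by
    simpa using filledFloor_int (k := 1) (m := m) (by simpa) (by simpa)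
  have hyx : 0 ≤ y₁ * x := by positivity
  have hyx1 : y₁ * x ≤ y₁ := by nlinarith
  have hdx : δ * x ≤ δ := by nlinarith
  rcases le_total y (y₁ * (1 - x)) with h1 | h1
  · refine ⟨0, y / y₁ - 1 + x, -1, le_rfl, zero_le_one, f2 _ ?_ ?_, f1 _ (by linarith)
      (by linarith), ?_, by linarith, by linarith⟩
    · have := div_nonneg hy0 hy₁.le
      linarith
    · rw [mul_comm, ← div_le_iff₀ hy₁] at h1
      linarith
    · field_simp; ring
  rcases le_total y (δ * x + y₁ * (1 - x)) with h2 | h2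
  · have hU0 : 0 ≤ (y - y₁ * (1 - x)) / δ := div_nonneg (by linarith) hδ.le
    have hUx : (y - y₁ * (1 - x)) / δ ≤ x := by rw [div_le_iff₀ hδ]; linarith
    have he : δ * ((y - y₁ * (1 - x)) / δ) = y - y₁ * (1 - x) := by field_simp
    refine ⟨(y - y₁ * (1 - x)) / δ, 0, -1, hU0, by linarith, f0 _ hU0 (by linarith),
      f1 _ (by linarith) (by linarith), ?_, ?_, ?_⟩ <;> rw [he] <;> linarith
  rcases le_total y (ℓ + δ * x - y₁ * x) with h3 | h3
  · have hk : (ℓ - y₁) * ((y - δ * x - y₁ * (1 - x)) / (ℓ - y₁) - 1 + 1) =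
        y - δ * x - y₁ * (1 - x) := by field_simp; ring
    have hk0 : 0 ≤ (y - δ * x - y₁ * (1 - x)) / (ℓ - y₁) := div_nonneg (by linarith) hℓy.le
    have hk1 : (y - δ * x - y₁ * (1 - x)) / (ℓ - y₁) ≤ 1 := by
      rw [div_le_one hℓy]; linarith
    refine ⟨x, 0, (y - δ * x - y₁ * (1 - x)) / (ℓ - y₁) - 1, hx0, hx1, f0 _ hx0 hx1, ?_, ?_, ?_,
      ?_⟩
    · rw [sub_self]; exact f2 _ (by linarith) (by linarith)
    · rw [hk]; ring
    · linarith
    · linarith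
  rcases le_total y (ℓ + δ - y₁ * x) with h4 | h4
  · have hU0 : x ≤ (y - ℓ + y₁ * x) / δ := by rw [le_div_iff₀ hδ]; linarith
    have hU1 : (y - ℓ + y₁ * x) / δ ≤ 1 := by rw [div_le_iff₀ hδ]; linarith
    have he : δ * ((y - ℓ + y₁ * x) / δ) = y - ℓ + y₁ * x := by field_simp
    refine ⟨(y - ℓ + y₁ * x) / δ, 0, 0, by linarith, by linarith, f0 _ (by linarith) hU1,
      f0 _ (by linarith) (by linarith), ?_, ?_, ?_⟩ <;> rw [he] <;> linarith
  · have hm : y₁ * ((y - ℓ - δ) / y₁ + x) = y - ℓ - δ + y₁ * x := by field_simp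
    refine ⟨1, (y - ℓ - δ) / y₁ + x, 0, zero_le_one, le_rfl, f3 _ ?_ ?_, f0 _ (by linarith)
      (by linarith), ?_, by linarith, by linarith⟩
    · have : 0 ≤ y₁ * ((y - ℓ - δ) / y₁ + x) := by rw [hm]; linarith
      exact nonneg_of_mul_nonneg_right this hy₁
    · have : (y - ℓ - δ) / y₁ ≤ 0 := div_nonpos_of_nonpos_of_nonneg (by linarith) hy₁.le
      linarith
    · linarith [hm]

theorem BrickRel.exists_preimage {θ y₁ δ ℓ : ℝ} (hθ0 : 0 < θ) (hθ1 : θ < 1) (hδ : 0 < δ)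
    (hℓ : y₁ < ℓ) (hy₁ : 0 < y₁) {w : Pt} (hw : w ∈ unitSquare) :
    ∃ z : Pt, 0 ≤ z 0 ∧ z 0 ≤ 1 ∧ 0 ≤ z 1 ∧ z 1 ≤ ℓ + δ ∧ BrickRel θ y₁ δ ℓ z w := by
  have hℓ0 : 0 < ℓ := hy₁.trans hℓ
  have hℓy : 0 < ℓ - y₁ := by linarith
  suffices h : ∃ x U m n : ℝ, 0 ≤ x ∧ x ≤ 1 ∧ 0 ≤ U ∧ U ≤ 1 ∧ FilledFloor m U ∧
      FilledFloor n (U - x) ∧ ℓ * (1 - w 0) = y₁ * (m + 1 - x) + (ℓ - y₁) * (n + 1) ∧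
      w 1 = (1 - θ) * x + θ * U by
    obtain ⟨x, U, m, n, hx0, hx1, hU0, hU1, hm, hn, h0, h1⟩ := h
    obtain ⟨w0, w1, w2, w3⟩ := hw
    refine ⟨![x, δ * U + ℓ * (1 - w 0)], hx0, hx1, ?_, ?_, U, m, n, hm, hn, ?_, ?_⟩
    · have := mul_nonneg hℓ0.le (sub_nonneg.2 w1)
      show 0 ≤ δ * U + ℓ * (1 - w 0)
      positivity
    · show δ * U + ℓ * (1 - w 0) ≤ ℓ + δ
      nlinarith
    · simp only [Matrix.cons_val_zero, Matrix.cons_val_one]; linarith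
    · ext i
      fin_cases i
      · simp; field_simp; ring
      · simp [h1]
  obtain ⟨w0, w1, w2, w3⟩ := hw
  generalize hr : 1 - w 0 = r at *
  have hr0 : 0 ≤ r := by linarith
  have hr1 : r ≤ 1 := by linarith
  clear hr w0 w1
  generalize w 1 = v at *
  have f0 : ∀ U : ℝ, 0 ≤ U → U ≤ 1 → FilledFloor 0 U := fun U h0 h1 => by
    simpa using filledFloor_of_mem (k := 0) (U := U) (by simpa) (by simpa)
  have f1 : ∀ U : ℝ, -1 ≤ U → U ≤ 0 → FilledFloor (-1) U := fun U h0 h1 => by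
    simpa using filledFloor_of_mem (k := -1) (U := U) (by simpa) (by simpa)
  have f2 : ∀ m : ℝ, -1 ≤ m → m ≤ 0 → FilledFloor m 0 := fun m h0 h1 => by
    simpa using filledFloor_int (k := 0) (m := m) (by simpa) (by simpa)
  have f3 : ∀ m : ℝ, 0 ≤ m → m ≤ 1 → FilledFloor m 1 := fun m h0 h1 => by
    simpa using filledFloor_int (k := 1) (m := m) (by simpa) (by simpa)
  have hθ : 0 < 1 - θ := by linarith
  have hyr : y₁ * (ℓ * r / y₁) = ℓ * r := by field_simp
  have hyr' : y₁ * (ℓ * (1 - r) / y₁) = ℓ * (1 - r) := by field_simp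
  have hq : 0 ≤ ℓ * r / y₁ := by positivity
  have hq' : 0 ≤ ℓ * (1 - r) / y₁ := div_nonneg (mul_nonneg hℓ0.le (by linarith)) hy₁.le
  rcases le_total (ℓ * r) (y₁ * (1 - v)) with h1 | h1
  · have hqv : ℓ * r / y₁ ≤ 1 - v := by rw [div_le_iff₀ hy₁]; linarith
    generalize ℓ * r / y₁ = q at *
    rcases le_total v ((1 - θ) * (1 - q)) with h2 | h2
    · have hxq : v / (1 - θ) ≤ 1 - q := by rw [div_le_iff₀ hθ]; linarith
      have hx0 : 0 ≤ v / (1 - θ) := by positivity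
      refine ⟨v / (1 - θ), 0, v / (1 - θ) + q - 1, -1, hx0, by linarith, le_rfl, zero_le_one,
        f2 _ (by linarith) (by linarith), f1 _ (by linarith) (by linarith), ?_, ?_⟩
      · linarith
      · field_simp; ring
    · have hU0 : 0 ≤ (v - (1 - θ) * (1 - q)) / θ := div_nonneg (by linarith) hθ0.le
      have hU1 : (v - (1 - θ) * (1 - q)) / θ ≤ 1 - q := by rw [div_le_iff₀ hθ0]; linarith
      refine ⟨1 - q, (v - (1 - θ) * (1 - q)) / θ, 0, -1, by linarith, by linarith, hU0,
        by linarith, f0 _ hU0 (by linarith), f1 _ (by linarith) (by linarith), by linarith, ?_⟩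
      field_simp; ring
  rcases le_total (ℓ * r) (ℓ - y₁ * v) with h3 | h3
  · have hk : (ℓ - y₁) * ((ℓ * r - y₁ * (1 - v)) / (ℓ - y₁) - 1 + 1) =
        ℓ * r - y₁ * (1 - v) := by field_simp; ring
    have hk0 : 0 ≤ (ℓ * r - y₁ * (1 - v)) / (ℓ - y₁) := div_nonneg (by linarith) hℓy.le
    have hk1 : (ℓ * r - y₁ * (1 - v)) / (ℓ - y₁) ≤ 1 := by rw [div_le_one hℓy]; linarith
    refine ⟨v, v, 0, (ℓ * r - y₁ * (1 - v)) / (ℓ - y₁) - 1, w2, w3, w2, w3, f0 _ w2 w3, ?_, ?_,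
      by ring⟩
    · rw [sub_self]; exact f2 _ (by linarith) (by linarith)
    · linarith
  · have hqv : ℓ * (1 - r) / y₁ ≤ v := by rw [div_le_iff₀ hy₁]; linarith
    generalize ℓ * (1 - r) / y₁ = q at *
    rcases le_total v ((1 - θ) * q + θ) with h2 | h2
    · have hU0 : q ≤ (v - (1 - θ) * q) / θ := by rw [le_div_iff₀ hθ0]; linarith
      have hU1 : (v - (1 - θ) * q) / θ ≤ 1 := by rw [div_le_iff₀ hθ0]; linarith
      refine ⟨q, (v - (1 - θ) * q) / θ, 0, 0, hq', by linarith, by linarith, hU1,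
        f0 _ (by linarith) hU1, f0 _ (by linarith) (by linarith), by linarith, ?_⟩
      field_simp; ring
    · have hxq : q ≤ (v - θ) / (1 - θ) := by rw [le_div_iff₀ hθ]; linarith
      have hx1 : (v - θ) / (1 - θ) ≤ 1 := by rw [div_le_one hθ]; linarith
      refine ⟨(v - θ) / (1 - θ), 1, (v - θ) / (1 - θ) - q, 0, by linarith, hx1, zero_le_one,
        le_rfl, f3 _ (by linarith) (by linarith), f0 _ (by linarith) (by linarith), ?_, ?_⟩
      · linarith
      · field_simp; ring

theorem exists_digit {B : ℤ} (hB : 2 ≤ B) {y : ℝ} (h0 : 0 ≤ y) (h1 : y ≤ B) :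
    ∃ d : ℤ, 0 ≤ d ∧ d ≤ B - 1 ∧ 0 ≤ y - d ∧ y - d ≤ 1 := by
  rcases h1.eq_or_lt with rfl | h1
  · exact ⟨B - 1, by omega, le_rfl, by push_cast; linarith, by push_cast; linarith⟩
  · refine ⟨⌊y⌋, Int.floor_nonneg.2 h0, ?_, by linarith [Int.floor_le y],
      by linarith [Int.lt_floor_add_one y]⟩
    have := Int.floor_lt.2 h1
    omega

theorem diskLike_of_brick {A B a ε : ℤ} {L : Set Pt} (hT : IsTile A B a ε L) {θ y₁ δ ℓ : ℝ} (hθ0 : 0 < θ) (hθ1 : θ < 1) (hδ : 0 < δ)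
    (hℓ : y₁ < ℓ) (hy₁ : 0 < y₁) (hδa : (a : ℝ) = δ + θ) (hBℓ : (B : ℝ) = ℓ + δ)
    (N : Seminorm ℝ Pt) (hN : ∀ v, N v = 0 → v = 0)
    (c : ℝ) (hc0 : 0 ≤ c) (hc1 : c < 1)
    (h₁ : ∀ x y, N ![-(y / ℓ), (1 - θ) * x] ≤ c * N ![x, y])
    (h₂ : ∀ x y, N ![y₁ * x / ℓ, (1 - θ) * x + θ * ((y + y₁ * x) / δ)] ≤ c * N ![x, y])
    (h₃ : ∀ x y, N ![(δ * x - y) / ℓ, x] ≤ c * N ![x, y]) : DiskLike L := by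
  have hmap : ∀ p q : ℤ, latticeMap ![1, -θ] ![0, 1] (p, q) = ![(p : ℝ), q - θ * p] := by
    intro p q
    rw [latticeMap_apply]
    ext i
    fin_cases i <;> simp
    ring
  refine diskLike_of_relation hT ![1, -θ] ![0, 1] (by simp)
    (BrickRel θ y₁ δ ℓ) N hN c hc0 hc1 ?_ ?_ ?_ ?_ ?_
  · intro z w p q h
    rw [hmap, hmap]
    have := h.add_lattice (hy₁.trans hℓ) hδa hBℓ p q
    push_cast
    exact this
  · exact fun z w z' w' h h' => h.seminorm_le hδ hℓ hy₁ N h₁ h₂ h₃ h'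
  · exact fun z z' w h h' => h.injective hθ0 hθ1 hℓ hy₁ h'
  · rintro h ⟨hx0, hx1, hy0, hy1⟩ d hd0 hd1
    have hd0' : (0:ℝ) ≤ d := by exact_mod_cast hd0
    have hd1' : (d:ℝ) + 1 ≤ B := by exact_mod_cast (by omega : d + 1 ≤ B)
    rw [hmap]
    exact BrickRel.exists_image hθ0 hθ1 hδ hℓ hy₁ (by simpa) (by simpa) (by simp; linarith)
      (by simp; linarith)
  · intro w hw
    obtain ⟨z, hx0, hx1, hy0, hy1, hz⟩ := BrickRel.exists_preimage hθ0 hθ1 hδ hℓ hy₁ hw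
    obtain ⟨d, hd0, hd1, h0, h1⟩ := exists_digit hT.two_le hy0 (by linarith)
    refine ⟨![z 0, z 1 - d], ⟨by simpa, by simpa, by simpa using h0, by simpa using h1⟩, d, hd0,
      hd1, ?_⟩
    convert hz using 1
    rw [hmap]
    ext i
    fin_cases i <;> simp

/-- The seminorm `v ↦ |p v₀ + q v₁|`. -/
def linSeminorm (p q : ℝ) : Seminorm ℝ Pt :=
  (p • LinearMap.proj 0 + q • LinearMap.proj 1 : Pt →ₗ[ℝ] ℝ).toSeminorm

theorem linSeminorm_apply (p q : ℝ) (v : Pt) : linSeminorm p q v = |p * v 0 + q * v 1| := by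
  simp [linSeminorm]

theorem abs_comb_le {x v M K : ℝ} (hx : |x| ≤ M) (hv : |v| ≤ K * M) (p q : ℝ) :
    |p * x + q * v| ≤ (|p| + |q| * K) * M := by
  refine (abs_add_le _ _).trans ?_
  rw [abs_mul, abs_mul]
  have := mul_le_mul_of_nonneg_left hx (abs_nonneg p)
  have := mul_le_mul_of_nonneg_left hv (abs_nonneg q)
  linarith

/-- The norm `max |x| (|y - m x| / K)`. -/
def shearSeminorm (m K : ℝ) : Seminorm ℝ Pt := linSeminorm 1 0 ⊔ linSeminorm (-(m / K)) (1 / K)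

theorem shearSeminorm_apply {m K : ℝ} (hK : 0 < K) (v : Pt) :
    shearSeminorm m K v = max |v 0| (|v 1 - m * v 0| / K) := by
  have h : -(m / K) * v 0 + 1 / K * v 1 = (v 1 - m * v 0) / K := by field_simp; ring
  simp only [shearSeminorm, Seminorm.sup_apply, linSeminorm_apply, h]
  rw [abs_div, abs_of_pos hK]
  simp

theorem shearSeminorm_le {m K : ℝ} (hK : 0 < K) {v : Pt} {C : ℝ} :
    shearSeminorm m K v ≤ C ↔ |v 0| ≤ C ∧ |v 1 - m * v 0| ≤ K * C := by
  rw [shearSeminorm_apply hK, max_le_iff, div_le_iff₀ hK, mul_comm C]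

theorem shearSeminorm_eq_zero {m K : ℝ} (hK : 0 < K) {v : Pt} (h : shearSeminorm m K v = 0) :
    v = 0 := by
  obtain ⟨h1, h2⟩ := (shearSeminorm_le hK).1 h.le
  rw [mul_zero] at h2
  have e1 : v 0 = 0 := abs_nonpos_iff.1 h1
  have e2 := abs_nonpos_iff.1 h2
  rw [e1, mul_zero, sub_zero] at e2
  ext i
  fin_cases i <;> simpa

theorem diskLike_of_brick_shear {A B a ε : ℤ} {L : Set Pt} (hT : IsTile A B a ε L) {θ y₁ δ ℓ : ℝ} (hθ0 : 0 < θ) (hθ1 : θ < 1) (hδ : 0 < δ)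
    (hℓ : y₁ < ℓ) (hy₁ : 0 < y₁) (hδa : (a : ℝ) = δ + θ) (hBℓ : (B : ℝ) = ℓ + δ)
    {m K c : ℝ} (hm : 0 ≤ m) (hK : 0 < K) (hc0 : 0 ≤ c) (hc1 : c < 1)
    (h₁ : m + K ≤ c * ℓ) (h₁' : |(1 - θ) * ℓ + m ^ 2| + m * K ≤ K * (c * ℓ))
    (h₂ : y₁ ≤ c * ℓ) (h₂' : 1 - θ + θ * ((m + y₁ + K) / δ) + m * (y₁ / ℓ) ≤ K * c)
    (h₃ : |δ - m| + K ≤ c * ℓ) (h₃' : |ℓ - m * (δ - m)| + m * K ≤ K * (c * ℓ)) :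
    DiskLike L := by
  have hℓ0 : 0 < ℓ := hy₁.trans hℓ
  refine diskLike_of_brick hT hθ0 hθ1 hδ hℓ hy₁ hδa hBℓ (shearSeminorm m K)
    (fun v => shearSeminorm_eq_zero hK) c hc0 hc1 ?_ ?_ ?_
  all_goals
    intro x y
    obtain ⟨M, hM⟩ : ∃ M, shearSeminorm m K ![x, y] = M := ⟨_, rfl⟩
    obtain ⟨hx, hv⟩ := (shearSeminorm_le hK).1 hM.le
    simp only [Matrix.cons_val_zero, Matrix.cons_val_one] at hx hv
    have hM0 : 0 ≤ M := (abs_nonneg _).trans hx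
    have key := abs_comb_le hx hv
    rw [hM, shearSeminorm_le hK]
    simp only [Matrix.cons_val_zero, Matrix.cons_val_one]
  · constructor
    · rw [abs_neg, abs_div, abs_of_pos hℓ0, div_le_iff₀ hℓ0]
      have := key m 1
      rw [abs_one, abs_of_nonneg hm, show m * x + 1 * (y - m * x) = y by ring] at this
      nlinarith
    · have := key ((1 - θ) * ℓ + m ^ 2) m
      rw [show (1 - θ) * x - m * -(y / ℓ) = (((1 - θ) * ℓ + m ^ 2) * x + m * (y - m * x)) / ℓ by
        field_simp; ring, abs_div, abs_of_pos hℓ0, div_le_iff₀ hℓ0]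
      rw [abs_of_nonneg hm] at this
      nlinarith
  · constructor
    · rw [abs_div, abs_of_pos hℓ0, div_le_iff₀ hℓ0, abs_mul, abs_of_pos hy₁]
      nlinarith
    · have := key (m + y₁) 1
      rw [abs_one, abs_of_nonneg (add_nonneg hm hy₁.le),
        show (m + y₁) * x + 1 * (y - m * x) = y + y₁ * x by ring] at this
      have e1 : |(y + y₁ * x) / δ| ≤ (m + y₁ + K) / δ * M := by
        rw [abs_div, abs_of_pos hδ, div_le_iff₀ hδ]
        field_simp
        linarith
      have e2 : |y₁ * x / ℓ| ≤ y₁ / ℓ * M := by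
        rw [abs_div, abs_of_pos hℓ0, div_le_iff₀ hℓ0, abs_mul, abs_of_pos hy₁]
        field_simp
        nlinarith
      have e3 := mul_le_mul_of_nonneg_left e1 hθ0.le
      have e4 := mul_le_mul_of_nonneg_left e2 hm
      have e5 := mul_le_mul_of_nonneg_left hx (sub_nonneg.2 hθ1.le)
      have e6 := mul_le_mul_of_nonneg_right h₂' hM0
      calc |(1 - θ) * x + θ * ((y + y₁ * x) / δ) - m * (y₁ * x / ℓ)|
          ≤ |(1 - θ) * x| + |θ * ((y + y₁ * x) / δ)| + |m * (y₁ * x / ℓ)| :=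
            (abs_sub _ _).trans (by gcongr; exact abs_add_le _ _)
        _ ≤ _ := by
          rw [abs_mul, abs_mul, abs_mul m, abs_of_pos hθ0, abs_of_nonneg hm,
            abs_of_nonneg (sub_nonneg.2 hθ1.le)]
          linarith
  · constructor
    · rw [abs_div, abs_of_pos hℓ0, div_le_iff₀ hℓ0]
      have := key (δ - m) (-1)
      rw [abs_neg, abs_one, show (δ - m) * x + -1 * (y - m * x) = δ * x - y by ring] at this
      nlinarith
    · have := key (ℓ - m * (δ - m)) m
      rw [show x - m * ((δ * x - y) / ℓ) = ((ℓ - m * (δ - m)) * x + m * (y - m * x)) / ℓ by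
        field_simp; ring, abs_div, abs_of_pos hℓ0, div_le_iff₀ hℓ0]
      rw [abs_of_nonneg hm] at this
      nlinarith

/-- The norm given by the maximum of three functionals. -/
def hexSeminorm (p₁ q₁ p₂ q₂ p₃ q₃ : ℝ) : Seminorm ℝ Pt :=
  linSeminorm p₁ q₁ ⊔ linSeminorm p₂ q₂ ⊔ linSeminorm p₃ q₃

theorem hexSeminorm_le {p₁ q₁ p₂ q₂ p₃ q₃ : ℝ} {x y C : ℝ} :
    hexSeminorm p₁ q₁ p₂ q₂ p₃ q₃ ![x, y] ≤ C ↔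
      |p₁ * x + q₁ * y| ≤ C ∧ |p₂ * x + q₂ * y| ≤ C ∧ |p₃ * x + q₃ * y| ≤ C := by
  simp only [hexSeminorm, Seminorm.sup_apply, linSeminorm_apply, max_le_iff, and_assoc,
    Matrix.cons_val_zero, Matrix.cons_val_one]

theorem hexSeminorm_eq_zero {p₁ q₁ p₂ q₂ p₃ q₃ : ℝ} (h : p₁ * q₂ - p₂ * q₁ ≠ 0) {v : Pt}
    (hv : hexSeminorm p₁ q₁ p₂ q₂ p₃ q₃ v = 0) : v = 0 := by
  have hv' : v = ![v 0, v 1] := by ext i; fin_cases i <;> rfl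
  rw [hv'] at hv
  obtain ⟨h1, h2, -⟩ := hexSeminorm_le.1 hv.le
  rw [abs_nonpos_iff] at h1 h2
  ext i
  fin_cases i
  · have : v 0 * (p₁ * q₂ - p₂ * q₁) = 0 := by linear_combination q₂ * h1 - q₁ * h2
    simpa [h] using this
  · have : v 1 * (p₁ * q₂ - p₂ * q₁) = 0 := by linear_combination p₁ * h2 - p₂ * h1
    simpa [h] using this

theorem diskLike_of_two_mul_le {A B a ε : ℤ} {L : Set Pt} (hT : IsTile A B a ε L)
    (ha : 2 ≤ a) (h : 2 * a ≤ B) : DiskLike L := by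
  have ha' : (2:ℝ) ≤ a := by exact_mod_cast ha
  have h' : 2 * (a:ℝ) ≤ B := by exact_mod_cast h
  have hℓ : (0:ℝ) < B - a + 3 / 4 := by linarith
  have hc : (1 - 1 / 4 / (B - a + 3 / 4 : ℝ)) * (B - a + 3 / 4) = B - a + 1 / 2 := by
    rw [sub_mul, div_mul_cancel₀ _ hℓ.ne']; ring
  have hc' : 9 / 10 ≤ 1 - 1 / 4 / (B - a + 3 / 4 : ℝ) := by
    rw [le_sub_comm, div_le_iff₀ hℓ]; linarith
  have hd : (0 + 1 / 10 + 5 / 4) / (a - 3 / 4 : ℝ) ≤ 27 / 25 := by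
    rw [div_le_iff₀ (by linarith)]; linarith
  refine diskLike_of_brick_shear hT (θ := 3 / 4) (y₁ := 1 / 10)
    (δ := a - 3 / 4) (ℓ := B - a + 3 / 4) (m := 0) (K := 5 / 4)
    (c := 1 - 1 / 4 / (B - a + 3 / 4)) (by norm_num) (by norm_num) (by linarith) (by linarith)
    (by norm_num) (by ring) (by ring) le_rfl (by norm_num) (by linarith) ?_ ?_ ?_ ?_ ?_ ?_ ?_
  · have : 0 < 1 / 4 / (B - a + 3 / 4 : ℝ) := by positivity
    linarith
  all_goals try rw [hc]
  · linarith
  · rw [abs_of_nonneg (by linarith)]; linarith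
  · linarith
  · linarith
  · rw [abs_of_nonneg (by linarith)]; linarith
  · rw [abs_of_nonneg (by linarith)]; linarith

theorem diskLike_of_one {A B a ε : ℤ} {L : Set Pt} (hT : IsTile A B a ε L)
    (ha : a = 1) (h : 3 ≤ B) : DiskLike L := by
  have h' : (3:ℝ) ≤ B := by exact_mod_cast h
  refine diskLike_of_brick_shear hT (θ := 1 / 4) (y₁ := 1 / 10)
    (δ := 3 / 4) (ℓ := B - 3 / 4) (m := 0) (K := 5 / 4)
    (c := 97 / 100) (by norm_num) (by norm_num) (by norm_num) (by linarith)
    (by norm_num) (by rw [ha]; norm_num) (by ring) le_rfl (by norm_num) (by norm_num) (by norm_num)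
    (by linarith) ?_ (by linarith) (by norm_num) ?_ ?_
  · rw [abs_of_nonneg (by linarith)]; linarith
  · rw [abs_of_nonneg (by norm_num)]; linarith
  · rw [abs_of_nonneg (by linarith)]; linarith

theorem diskLike_of_two_mul_eq_add_one {A B a ε : ℤ} {L : Set Pt} (hT : IsTile A B a ε L)
    (ha : 3 ≤ a) (h : 2 * a = B + 1) : DiskLike L := by
  have ha' : (3:ℝ) ≤ a := by exact_mod_cast ha
  have h' : (B:ℝ) = 2 * a - 1 := by
    have : 2 * (a:ℝ) = B + 1 := by exact_mod_cast h
    linarith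
  have hℓ : (0:ℝ) < a - 1 / 10 := by linarith
  have hc : (1 - 1 / 20 / (a - 1 / 10 : ℝ)) * (a - 1 / 10) = a - 3 / 20 := by
    rw [sub_mul, div_mul_cancel₀ _ hℓ.ne']; ring
  have hc' : 98 / 100 ≤ 1 - 1 / 20 / (a - 1 / 10 : ℝ) := by
    rw [le_sub_comm, div_le_iff₀ hℓ]; linarith
  have hd : (1 + 1 / 100 + 1) / (a - 9 / 10 : ℝ) ≤ 201 / 210 := by
    rw [div_le_iff₀ (by linarith)]; linarith
  have hd' : 1 / 100 / (a - 1 / 10 : ℝ) ≤ 1 / 290 := by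
    rw [div_le_iff₀ (by linarith)]; linarith
  refine diskLike_of_brick_shear hT (θ := 9 / 10) (y₁ := 1 / 100)
    (δ := a - 9 / 10) (ℓ := a - 1 / 10) (m := 1) (K := 1)
    (c := 1 - 1 / 20 / (a - 1 / 10)) (by norm_num) (by norm_num) (by linarith) (by linarith)
    (by norm_num) (by ring) (by rw [h']; ring) zero_le_one one_pos (by linarith) ?_ ?_ ?_ ?_ ?_ ?_
    ?_
  · have : 0 < 1 / 20 / (a - 1 / 10 : ℝ) := by positivity
    linarith
  all_goals try rw [hc]
  · linarith
  · rw [abs_of_nonneg (by linarith)]; linarith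
  · linarith
  · linarith
  · rw [abs_of_nonneg (by linarith)]; linarith
  · rw [abs_of_nonneg (by linarith)]; linarith

theorem diskLike_of_two_mul_eq_add_two {A B a ε : ℤ} {L : Set Pt} (hT : IsTile A B a ε L)
    (ha : 4 ≤ a) (h : 2 * a = B + 2) : DiskLike L := by
  have ha' : (4:ℝ) ≤ a := by exact_mod_cast ha
  have h' : (B:ℝ) = 2 * a - 2 := by
    have : 2 * (a:ℝ) = B + 2 := by exact_mod_cast h
    linarith
  have hℓ : (0:ℝ) < a - 11 / 10 := by linarith
  have hc : (1 - 1 / 20 / (a - 11 / 10 : ℝ)) * (a - 11 / 10) = a - 23 / 20 := by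
    rw [sub_mul, div_mul_cancel₀ _ hℓ.ne']; ring
  have hc' : 98 / 100 ≤ 1 - 1 / 20 / (a - 11 / 10 : ℝ) := by
    rw [le_sub_comm, div_le_iff₀ hℓ]; linarith
  have hd : (1 + 1 / 100 + 7 / 10) / (a - 9 / 10 : ℝ) ≤ 171 / 310 := by
    rw [div_le_iff₀ (by linarith)]; linarith
  have hd' : 1 / 100 / (a - 11 / 10 : ℝ) ≤ 1 / 290 := by
    rw [div_le_iff₀ (by linarith)]; linarith
  refine diskLike_of_brick_shear hT (θ := 9 / 10) (y₁ := 1 / 100)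
    (δ := a - 9 / 10) (ℓ := a - 11 / 10) (m := 1) (K := 7 / 10)
    (c := 1 - 1 / 20 / (a - 11 / 10)) (by norm_num) (by norm_num) (by linarith) (by linarith)
    (by norm_num) (by ring) (by rw [h']; ring) zero_le_one (by norm_num) (by linarith) ?_ ?_ ?_ ?_
    ?_ ?_ ?_
  · have : 0 < 1 / 20 / (a - 11 / 10 : ℝ) := by positivity
    linarith
  all_goals try rw [hc]
  · linarith
  · rw [abs_of_nonneg (by linarith)]; linarith
  · linarith
  · linarith
  · rw [abs_of_nonneg (by linarith)]; linarith
  · have : |(a - 11 / 10 : ℝ) - 1 * (a - 9 / 10 - 1)| ≤ 8 / 10 := by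
      rw [abs_le]; constructor <;> linarith
    linarith

theorem diskLike_of_zero {A B ε : ℤ} {L : Set Pt} (hT : IsTile A B 0 ε L) : DiskLike L := by
  have hB : (2:ℝ) ≤ B := by exact_mod_cast hT.two_le
  have hB0 : (0:ℝ) < B := by linarith
  have hmap : ∀ p q : ℤ, latticeMap ![1, 0] ![0, 1] (p, q) = ![(p : ℝ), (q : ℝ)] := by
    intro p q
    rw [latticeMap_apply]
    ext i
    fin_cases i <;> simp
  refine diskLike_of_relation hT ![1, 0] ![0, 1] (by simp) (fun z w => w = ![1 - z 1 / B, z 0])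
    (shearSeminorm 0 (3 / 2)) (fun v => shearSeminorm_eq_zero (by norm_num)) (3 / 4) (by norm_num)
    (by norm_num) ?_ ?_ ?_ ?_ ?_
  · rintro z w p q rfl
    rw [hmap, hmap]
    ext i
    fin_cases i
    · simp; field_simp; ring
    · simp
  · rintro z w z' w' rfl rfl
    obtain ⟨M, hM⟩ : ∃ M, shearSeminorm 0 (3 / 2) (z - z') = M := ⟨_, rfl⟩
    obtain ⟨hx, hy⟩ := (shearSeminorm_le (by norm_num)).1 hM.le
    rw [hM, shearSeminorm_le (by norm_num)]
    simp only [Pi.sub_apply, zero_mul, sub_zero, Matrix.cons_val_zero, Matrix.cons_val_one]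
      at hx hy ⊢
    constructor
    · rw [show 1 - z 1 / B - (1 - z' 1 / B) = -((z 1 - z' 1) / B) by ring, abs_neg, abs_div,
        abs_of_pos hB0, div_le_iff₀ hB0]
      nlinarith [(abs_nonneg _).trans hx]
    · linarith [(abs_nonneg _).trans hx]
  · rintro z z' w rfl h
    have h0 := congrFun h 0
    have h1 := congrFun h 1
    simp only [Matrix.cons_val_zero, Matrix.cons_val_one, sub_right_inj,
      div_left_inj' hB0.ne'] at h0 h1
    ext i
    fin_cases i
    · exact h1
    · exact h0
  · rintro h ⟨hx0, hx1, hy0, hy1⟩ d hd0 hd1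
    have hd0' : (0:ℝ) ≤ d := by exact_mod_cast hd0
    have hd1' : (d:ℝ) + 1 ≤ B := by exact_mod_cast (by omega : d + 1 ≤ B)
    rw [hmap]
    refine ⟨_, ?_, rfl⟩
    have h1 : (h 1 + d) / B ≤ 1 := (div_le_one hB0).2 (by linarith)
    have h2 : 0 ≤ (h 1 + d) / B := by positivity
    refine ⟨?_, ?_, ?_, ?_⟩ <;> simp <;> linarith
  · rintro w ⟨hw0, hw1, hw2, hw3⟩
    obtain ⟨d, hd0, hd1, h0, h1⟩ := exists_digit hT.two_le
      (mul_nonneg hB0.le (sub_nonneg.2 hw1)) (by nlinarith)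
    refine ⟨![w 1, B * (1 - w 0) - d], ⟨by simpa, by simpa, by simpa using h0, by simpa using h1⟩,
      d, hd0, hd1, ?_⟩
    rw [hmap]
    ext i
    fin_cases i
    · simp; field_simp; ring
    · simp

theorem diskLike_of_one_two {A ε : ℤ} {L : Set Pt} (hT : IsTile A 2 1 ε L) : DiskLike L := by
  refine diskLike_of_brick hT (θ := 9 / 20) (y₁ := 1 / 20) (δ := 11 / 20) (ℓ := 29 / 20)
    (by norm_num) (by norm_num) (by norm_num) (by norm_num) (by norm_num) (by norm_num)
    (by norm_num) (hexSeminorm 4 (-3) 4 2 2 3) (fun v => hexSeminorm_eq_zero (by norm_num))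
    (95 / 100) (by norm_num) (by norm_num) ?_ ?_ ?_
  all_goals
    intro x y
    obtain ⟨M, hM⟩ : ∃ M, hexSeminorm 4 (-3) 4 2 2 3 ![x, y] = M := ⟨_, rfl⟩
    obtain ⟨h1, h2, h3⟩ := hexSeminorm_le.1 hM.le
    rw [hM, hexSeminorm_le]
    rw [abs_le] at h1 h2 h3
    refine ⟨abs_le.2 ⟨?_, ?_⟩, abs_le.2 ⟨?_, ?_⟩, abs_le.2 ⟨?_, ?_⟩⟩ <;> linarith

theorem diskLike_of_two_three {A ε : ℤ} {L : Set Pt} (hT : IsTile A 3 2 ε L) : DiskLike L := by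
  refine diskLike_of_brick hT (θ := 19 / 20) (y₁ := 1 / 10) (δ := 21 / 20) (ℓ := 39 / 20)
    (by norm_num) (by norm_num) (by norm_num) (by norm_num) (by norm_num) (by norm_num)
    (by norm_num) (hexSeminorm 2 8 13 (-5) 2 8) (fun v => hexSeminorm_eq_zero (by norm_num))
    (95 / 100) (by norm_num) (by norm_num) ?_ ?_ ?_
  all_goals
    intro x y
    obtain ⟨M, hM⟩ : ∃ M, hexSeminorm 2 8 13 (-5) 2 8 ![x, y] = M := ⟨_, rfl⟩
    obtain ⟨h1, h2, h3⟩ := hexSeminorm_le.1 hM.le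
    rw [hM, hexSeminorm_le]
    rw [abs_le] at h1 h2 h3
    refine ⟨abs_le.2 ⟨?_, ?_⟩, abs_le.2 ⟨?_, ?_⟩, abs_le.2 ⟨?_, ?_⟩⟩ <;> linarith

theorem diskLike_of_three_four {A ε : ℤ} {L : Set Pt} (hT : IsTile A 4 3 ε L) : DiskLike L := by
  refine diskLike_of_brick hT (θ := 19 / 20) (y₁ := 1 / 10) (δ := 41 / 20) (ℓ := 39 / 20)
    (by norm_num) (by norm_num) (by norm_num) (by norm_num) (by norm_num) (by norm_num)
    (by norm_num) (hexSeminorm 8 (-5) 6 0 0 5) (fun v => hexSeminorm_eq_zero (by norm_num))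
    (95 / 100) (by norm_num) (by norm_num) ?_ ?_ ?_
  all_goals
    intro x y
    obtain ⟨M, hM⟩ : ∃ M, hexSeminorm 8 (-5) 6 0 0 5 ![x, y] = M := ⟨_, rfl⟩
    obtain ⟨h1, h2, h3⟩ := hexSeminorm_le.1 hM.le
    rw [hM, hexSeminorm_le]
    rw [abs_le] at h1 h2 h3
    refine ⟨abs_le.2 ⟨?_, ?_⟩, abs_le.2 ⟨?_, ?_⟩, abs_le.2 ⟨?_, ?_⟩⟩ <;> linarith

theorem latMap_sq_expanding {A B : ℤ} (hAB : |A| ≤ B) (hB : 2 ≤ B) (e : ℕ → Pt)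
    (hb : ∃ C, ∀ n, ‖e n‖ ≤ C) (he : ∀ n, e (n + 1) = (latMap A B ∘ₗ latMap A B) (e n)) :
    e 0 = 0 := by
  obtain ⟨C, hC⟩ := hb
  let f : ℕ → Pt := fun n => (latMap A B)^[n % 2] (e (n / 2))
  have hc : Continuous (latMap A B) := (latMap A B).continuous_of_finiteDimensional
  obtain ⟨C', hC'⟩ := ((isCompact_closedBall (0 : Pt) C).image hc).isBounded.exists_norm_le
  have := latMap_expanding hAB hB f ⟨max C C', fun n => ?_⟩ fun n => ?_
  · simpa [f] using this
  · rcases Nat.mod_two_eq_zero_or_one n with h | h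
    · simp only [f, h, Function.iterate_zero, id]
      exact (hC _).trans (le_max_left _ _)
    · simp only [f, h, Function.iterate_one]
      exact (hC' _ ⟨_, by simpa using hC _, rfl⟩).trans (le_max_right _ _)
  · rcases Nat.mod_two_eq_zero_or_one n with h | h
    · have h1 : (n + 1) % 2 = 1 := by omega
      have h2 : (n + 1) / 2 = n / 2 := by omega
      simp only [f, h, h1, h2, Function.iterate_zero, Function.iterate_one, id]
    · have h1 : (n + 1) % 2 = 0 := by omega
      have h2 : (n + 1) / 2 = n / 2 + 1 := by omega
      simp only [f, h, h1, h2, Function.iterate_zero, Function.iterate_one, id, he,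
        LinearMap.comp_apply]

theorem diskLike_of_sq_map {A ε : ℤ} {L : Set Pt} (hT : IsTile A 2 2 ε L) (e₁ e₂ : Pt)
    (hdet : e₁ 0 * e₂ 1 - e₁ 1 * e₂ 0 ≠ 0) (ψ : Pt → Pt) (N : Seminorm ℝ Pt)
    (hN : ∀ v, N v = 0 → v = 0) (c : ℝ) (hc0 : 0 ≤ c) (hc1 : c < 1)
    (heq : ∀ z (p q : ℤ), ψ (z + latticeMap e₁ e₂ (2 * q - 2 * p, 2 * q - 4 * p)) =
      ψ z + latticeMap e₁ e₂ (p, q))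
    (hcon : ∀ z z', N (ψ z - ψ z') ≤ c * N (z - z')) (hinj : Function.Injective ψ)
    (hSH : ∀ h ∈ unitSquare, ∀ i j : ℤ, 0 ≤ i → i ≤ 1 → 0 ≤ j → j ≤ 1 →
      ψ (h + latticeMap e₁ e₂ (i, 2 * i + j)) ∈ unitSquare)
    (hHS : ∀ w ∈ unitSquare, ∃ h ∈ unitSquare, ∃ i j : ℤ, 0 ≤ i ∧ i ≤ 1 ∧ 0 ≤ j ∧ j ≤ 1 ∧
      ψ (h + latticeMap e₁ e₂ (i, 2 * i + j)) = w) :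
    DiskLike L := by
  classical
  obtain ⟨hε, hA, hAB, hB, hLne, hLc, hL⟩ := hT
  have hεε : ε * ε = 1 := by rcases hε with rfl | rfl <;> rfl
  refine diskLike_of_homeo_unitSquare ?_
  let D : Finset Z2 := (Finset.Icc 0 1 ×ˢ Finset.Icc 0 1).image
    fun d : ℤ × ℤ => (ε * d.1, 2 * (ε * d.1) + d.2)
  have hD : ∀ i j : ℤ, 0 ≤ i → i ≤ 1 → 0 ≤ j → j ≤ 1 → (ε * i, 2 * (ε * i) + j) ∈ D := by
    intro i j h1 h2 h3 h4
    exact Finset.mem_image.2 ⟨(i, j), by simp [*], rfl⟩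
  have hD' : ∀ d ∈ D, ∃ i j : ℤ, 0 ≤ i ∧ i ≤ 1 ∧ 0 ≤ j ∧ j ≤ 1 ∧
      d = (ε * i, 2 * (ε * i) + j) := by
    intro d hd
    obtain ⟨⟨i, j⟩, hij, rfl⟩ := Finset.mem_image.1 hd
    simp only [Finset.mem_product, Finset.mem_Icc] at hij
    exact ⟨i, j, hij.1.1, hij.1.2, hij.2.1, hij.2.2, rfl⟩
  have hdig : ∀ (t : Pt) (i j : ℤ), latMap A 2 (t + ![(i:ℝ), 0]) + ![(j:ℝ), 0] =
      latMap A 2 t + ![(j:ℝ), 0] +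
        (latticeMap ![-((2:ℤ):ℝ), ε] ![1, 0] (ε * i, 2 * (ε * i))) := by
    intro t i j
    have h2 : (A:ℝ) = -(ε * 2) := by exact_mod_cast hA
    have h : (ε:ℝ) * ε = 1 := by exact_mod_cast hεε
    rw [map_add, latMap_apply A 2 ![(i:ℝ), 0], latticeMap_apply]
    ext k
    fin_cases k
    · simp; ring
    · simp; linear_combination (-(i:ℝ)) * h
  have hdig2 : ∀ i j : ℤ, latticeMap ![-((2:ℤ):ℝ), ε] ![1, 0] (ε * i, 2 * (ε * i) + j) =
      latticeMap ![-((2:ℤ):ℝ), ε] ![1, 0] (ε * i, 2 * (ε * i)) + ![(j:ℝ), 0] := by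
    intro i j
    rw [latticeMap_apply, latticeMap_apply]
    ext k
    fin_cases k
    · simp; ring
    · simp
  let σ : Z2 := if ε = 1 then 0 else (1, 2)
  have hσ : ∀ i j : ℤ, 0 ≤ i → i ≤ 1 → ∃ i' : ℤ, 0 ≤ i' ∧ i' ≤ 1 ∧
      (ε * i, 2 * (ε * i) + j) + σ = (i', 2 * i' + j) := by
    intro i j h0 h1
    rcases hε with rfl | rfl
    · exact ⟨i, h0, h1, by simp [σ]⟩
    · refine ⟨1 - i, by omega, by omega, ?_⟩
      simp only [σ, show ¬ ((-1:ℤ) = 1) by decide, if_false, Prod.mk_add_mk, Prod.mk.injEq]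
      constructor <;> ring
  have hσ' : ∀ i j : ℤ, 0 ≤ i → i ≤ 1 → ∃ i' : ℤ, 0 ≤ i' ∧ i' ≤ 1 ∧
      (ε * i', 2 * (ε * i') + j) + σ = (i, 2 * i + j) := by
    intro i j h0 h1
    rcases hε with rfl | rfl
    · exact ⟨i, h0, h1, by simp [σ]⟩
    · refine ⟨1 - i, by omega, by omega, ?_⟩
      simp only [σ, show ¬ ((-1:ℤ) = 1) by decide, if_false, Prod.mk_add_mk, Prod.mk.injEq]
      constructor <;> ring
  let Γ : Pt → Pt → Prop := fun z w => ψ (z + latticeMap e₁ e₂ σ) = w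
  refine homeo_of_contracting_relation ((substMap 2 2 ε).comp (substMap 2 2 ε))
    D (latticeMap e₁ e₂) (latticeMap ![-((2:ℤ):ℝ), ε] ![1, 0]) (latMap A 2 ∘ₗ latMap A 2)
    (fun v => ?_) (latMap_sq_expanding hAB hB) (latticeMap_finite hdet) (latticeMap_finite ?_)
    isCompact_unitSquare unitSquare_nonempty hLc hLne ?_ ?_ Γ N hN c hc0 hc1 ?_ ?_ ?_ ?_ ?_
  · simp only [LinearMap.comp_apply, latMap_latticeMap hεε hA, AddMonoidHom.comp_apply]
  · rcases hε with rfl | rfl <;> simp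
  · intro t ht
    obtain ⟨i, h0, h1, t', ht', he⟩ := hL.exists_of_mem ht
    obtain ⟨j, h0', h1', t'', ht'', he'⟩ := hL.exists_of_mem ht'
    refine ⟨_, hD i j h0 (by omega) h0' (by omega), t'', ht'', ?_⟩
    have := hdig t' i 0
    rw [LinearMap.comp_apply, he, hdig2]
    simp only [Int.cast_zero] at this
    have hz : (![0, 0] : Pt) = 0 := by ext k; fin_cases k <;> rfl
    rw [hz, add_zero, add_zero] at this
    rw [this, he']
    abel
  · intro d hd t' ht'
    obtain ⟨i, j, h0, h1, h0', h1', rfl⟩ := hD' d hd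
    obtain ⟨t₁, ht₁, he₁⟩ := hL.exists_preimage h0' (by omega) ht'
    obtain ⟨t, ht, he⟩ := hL.exists_preimage h0 (by omega) ht₁
    refine ⟨t, ht, ?_⟩
    have := hdig t₁ i 0
    rw [LinearMap.comp_apply, he, hdig2]
    simp only [Int.cast_zero] at this
    have hz : (![0, 0] : Pt) = 0 := by ext k; fin_cases k <;> rfl
    rw [hz, add_zero, add_zero] at this
    rw [this, he₁]
    abel
  · rintro z w ⟨p, q⟩ rfl
    have := heq (z + latticeMap e₁ e₂ σ) p q
    simp only [Γ, ← this]
    have e : (substMap 2 2 ε).comp (substMap 2 2 ε) (p, q) = (2 * q - 2 * p, 2 * q - 4 * p) := by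
      simp only [substMap, AddMonoidHom.comp_apply, AddMonoidHom.coe_mk, ZeroHom.coe_mk,
        Prod.mk.injEq]
      constructor
      · linear_combination (2 * q - 2 * p) * hεε
      · linear_combination (2 * q - 4 * p) * hεε
    rw [e]
    congr 1
    abel
  · rintro z w z' w' rfl rfl
    simpa using hcon (z + latticeMap e₁ e₂ σ) (z' + latticeMap e₁ e₂ σ)
  · intro z z' w h h'
    exact add_right_cancel (hinj (h.trans h'.symm))
  · intro h hh d hd
    obtain ⟨i, j, h0, h1, h0', h1', rfl⟩ := hD' d hd
    obtain ⟨i', h2, h3, he⟩ := hσ i j h0 h1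
    refine ⟨_, ?_, rfl⟩
    rw [add_assoc, ← map_add, he]
    exact hSH h hh i' j h2 h3 h0' h1'
  · intro w hw
    obtain ⟨h, hh, i, j, h0, h1, h0', h1', rfl⟩ := hHS w hw
    obtain ⟨i', h2, h3, he⟩ := hσ' i j h0 h1
    refine ⟨h, hh, _, hD i' j h2 h3 h0' h1', ?_⟩
    simp only [Γ]
    rw [add_assoc, ← map_add, he]

namespace TwinDragon

/-- The staircase of period `2` and height `1` rising linearly on `[0, 19/20]` and constant on
`[19/20, 2]`. -/
def stair (x : ℝ) : ℝ := ⌊x / 2⌋ + min 1 ((x - 2 * ⌊x / 2⌋) * (20 / 19))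

/-- The staircase rising on `[21/20, 2]`. -/
def stair' (x : ℝ) : ℝ := stair (x - 21 / 20)

/-- The staircase rising on the gap `[19/20, 21/20]`. -/
def stairMid (x : ℝ) : ℝ := 10 * x - 19 / 2 * (stair x + stair' x)

theorem eq_stairs (x : ℝ) : x = 19 / 20 * stair x + stairMid x / 10 + 19 / 20 * stair' x := by
  unfold stairMid; ring

theorem stair_of_le {x : ℝ} (k : ℤ) (h1 : 2 * k ≤ x) (h2 : x ≤ 2 * k + 19 / 20) :
    stair x = k + (x - 2 * k) * (20 / 19) := by
  have : ⌊x / 2⌋ = k := by rw [Int.floor_eq_iff]; constructor <;> linarith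
  rw [stair, this, min_eq_right (by linarith)]

theorem stair_of_ge {x : ℝ} (k : ℤ) (h1 : 2 * k + 19 / 20 ≤ x) (h2 : x ≤ 2 * k + 2) :
    stair x = k + 1 := by
  rcases h2.lt_or_eq with h2 | rfl
  · have : ⌊x / 2⌋ = k := by rw [Int.floor_eq_iff]; constructor <;> linarith
    rw [stair, this, min_eq_left (by linarith)]
  · rw [stair_of_le (k + 1) (by push_cast; linarith) (by push_cast; linarith)]
    push_cast; ring

theorem exists_stairs (x : ℝ) : ∃ (k : ℤ) (a b c : ℝ), 0 ≤ a ∧ a ≤ 1 ∧ 0 ≤ b ∧ b ≤ 1 ∧ 0 ≤ c ∧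
    c ≤ 1 ∧ (2 * k ≤ x ∧ x ≤ 2 * k + 2) ∧ stair x = k + a ∧ stairMid x = k + b ∧
    stair' x = k + c ∧ (b = 0 ∧ c = 0 ∨ a = 1 ∧ c = 0 ∨ a = 1 ∧ b = 1) := by
  have h1 := Int.floor_le (x / 2)
  have h2 := Int.lt_floor_add_one (x / 2)
  set k := ⌊x / 2⌋
  refine ⟨k, stair x - k, stairMid x - k, stair' x - k, ?_⟩
  simp only [stairMid]
  rcases le_total x (2 * k + 19 / 20) with h | h
  · have e1 := stair_of_le k (by linarith) h
    have e2 : stair' x = ((k - 1 : ℤ) : ℝ) + 1 :=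
      stair_of_ge (k - 1) (by push_cast; linarith) (by push_cast; linarith)
    rw [e1, e2]
    push_cast
    refine ⟨by linarith, by linarith, by linarith, by linarith, by linarith, by linarith,
      ⟨by linarith, by linarith⟩, by ring, by ring, by ring, Or.inl ⟨by ring, by ring⟩⟩
  · have e1 := stair_of_ge k h (by linarith)
    rw [e1]
    rcases le_total x (2 * k + 21 / 20) with h' | h'
    · have e2 : stair' x = ((k - 1 : ℤ) : ℝ) + 1 :=
        stair_of_ge (k - 1) (by push_cast; linarith) (by push_cast; linarith)
      rw [e2]
      push_cast
      refine ⟨by linarith, by linarith, by linarith, by linarith, by linarith, by linarith,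
        ⟨by linarith, by linarith⟩, by ring, by ring, by ring, Or.inr (Or.inl ⟨by ring, by ring⟩)⟩
    · have e2 : stair' x = k + (x - 21 / 20 - 2 * k) * (20 / 19) :=
        stair_of_le k (by linarith) (by linarith)
      rw [e2]
      refine ⟨by linarith, by linarith, by linarith, by linarith, by linarith, by linarith,
        ⟨by linarith, by linarith⟩, by ring, by ring, by ring, Or.inr (Or.inr ⟨by ring, by ring⟩)⟩

theorem stairs_order (x : ℝ) :
    stair' x ≤ stairMid x ∧ stairMid x ≤ stair x ∧ stair x ≤ stair' x + 1 := by
  obtain ⟨k, a, b, c, h1, h2, h3, h4, h5, h6, -, e1, e2, e3, h⟩ := exists_stairs x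
  rw [e1, e2, e3]
  rcases h with ⟨rfl, rfl⟩ | ⟨rfl, rfl⟩ | ⟨rfl, rfl⟩ <;> refine ⟨?_, ?_, ?_⟩ <;> linarith

theorem stairs_mono {x x' : ℝ} (hx : x ≤ x') :
    stair x ≤ stair x' ∧ stairMid x ≤ stairMid x' ∧ stair' x ≤ stair' x' := by
  have E := eq_stairs x
  have E' := eq_stairs x'
  obtain ⟨k, a, b, c, h1, h2, h3, h4, h5, h6, h7, e1, e2, e3, h⟩ := exists_stairs x
  obtain ⟨k', a', b', c', h1', h2', h3', h4', h5', h6', h7', e1', e2', e3', h'⟩ :=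
    exists_stairs x'
  rw [e1, e2, e3] at E ⊢
  rw [e1', e2', e3'] at E' ⊢
  rcases lt_trichotomy k k' with hk | rfl | hk
  · have : (k : ℝ) + 1 ≤ k' := by exact_mod_cast hk
    refine ⟨?_, ?_, ?_⟩ <;> linarith
  · rcases h with ⟨rfl, rfl⟩ | ⟨rfl, rfl⟩ | ⟨rfl, rfl⟩ <;>
      rcases h' with ⟨rfl, rfl⟩ | ⟨rfl, rfl⟩ | ⟨rfl, rfl⟩ <;> refine ⟨?_, ?_, ?_⟩ <;> linarith
  · have : (k' : ℝ) + 1 ≤ k := by exact_mod_cast hk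
    refine ⟨?_, ?_, ?_⟩ <;> linarith

theorem stair_add (x : ℝ) (p : ℤ) : stair (x + 2 * p) = stair x + p := by
  have : ⌊(x + 2 * p) / 2⌋ = ⌊x / 2⌋ + p := by
    rw [← Int.floor_add_intCast]; congr 1; ring
  rw [stair, stair, this]
  push_cast
  rw [show x + 2 * (p : ℝ) - 2 * (⌊x / 2⌋ + p) = x - 2 * ⌊x / 2⌋ by ring]
  ring

theorem stair'_add (x : ℝ) (p : ℤ) : stair' (x + 2 * p) = stair' x + p := by
  rw [stair', stair', ← stair_add]; congr 1; ring

theorem stair_reflect (x : ℝ) : stair (19 / 20 - x) = 1 - stair x := by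
  have h1 := Int.floor_le (x / 2)
  have h2 := Int.lt_floor_add_one (x / 2)
  set k := ⌊x / 2⌋
  rcases le_total x (2 * k + 19 / 20) with h | h
  · rw [stair_of_le k (by linarith) h, stair_of_le (-k) (by push_cast; linarith)
      (by push_cast; linarith)]
    push_cast
    ring
  · rw [stair_of_ge k h (by linarith), stair_of_ge (-k - 1) (by push_cast; linarith)
      (by push_cast; linarith)]
    push_cast
    ring

theorem stair'_reflect (x : ℝ) : stair' (61 / 20 - x) = 1 - stair' x := by
  rw [stair', stair', ← stair_reflect]; congr 1; ring

theorem stair_reflect' (x : ℝ) : stair (61 / 20 - x) = 2 - stair (x - 1 / 10) := by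
  have := stair_add (19 / 20 - (x - 1 / 10)) 1
  rw [stair_reflect] at this
  rw [show 61 / 20 - x = 19 / 20 - (x - 1 / 10) + 2 * ((1 : ℤ) : ℝ) by push_cast; ring, this]
  push_cast; ring

/-- First coordinate of the map on the strip `0 ≤ y ≤ 1`. -/
def rowFst (x y : ℝ) : ℝ :=
  (1 - y) * (1 / 20 * (1 - stair x)) +
    y * (1 / 20 + 17 / 38 + stair x / 20 + stairMid x / 190 - 2 / 19 * stair' x)

/-- Second coordinate of the map on the strip `0 ≤ y ≤ 1`. -/
def rowSnd (x y : ℝ) : ℝ :=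
  (1 - y) * (1 - (2 * stairMid x + 19 * stair' x) / 21) + y * (1 - stair' x) -
    y * (1 - y) * (stair x - stair' x) / 10

theorem rowFst_add (x y : ℝ) (p : ℤ) : rowFst (x + 2 * p) y = rowFst x y - p / 20 := by
  simp only [rowFst, stairMid, stair_add, stair'_add]; ring

theorem rowSnd_add (x y : ℝ) (p : ℤ) : rowSnd (x + 2 * p) y = rowSnd x y - p := by
  simp only [rowSnd, stairMid, stair_add, stair'_add]; ring

theorem rowFst_one (x : ℝ) : 1 - rowFst (61 / 20 - x) 1 = rowFst x 1 := by
  simp only [rowFst, stairMid, stair'_reflect]; ring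

theorem rowSnd_one (x : ℝ) : 1 - rowSnd (61 / 20 - x) 1 = rowSnd x 1 := by
  simp only [rowSnd, stairMid, stair'_reflect]; ring

theorem rowFst_zero (x : ℝ) : 1 - rowFst (61 / 20 - x) 0 = rowFst (x - 1 / 10) 0 + 1 := by
  simp only [rowFst, stair_reflect']; ring

theorem rowSnd_zero (x : ℝ) : 1 - rowSnd (61 / 20 - x) 0 = rowSnd (x - 1 / 10) 0 := by
  simp only [rowSnd, stairMid, stair_reflect', stair'_reflect]; ring

theorem abs_rowFst_sub_le {x x' y : ℝ} (hx : x ≤ x') (h0 : 0 ≤ y) (h1 : y ≤ 1) :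
    |rowFst x' y - rowFst x y| ≤ 1 / 9 * (x' - x) := by
  obtain ⟨ha, hb, hc⟩ := stairs_mono hx
  have E := eq_stairs x
  have E' := eq_stairs x'
  simp only [rowFst]
  set a := stair x
  set b := stairMid x
  set c := stair' x
  set a' := stair x'
  set b' := stairMid x'
  set c' := stair' x'
  rw [abs_le]
  constructor <;> nlinarith [mul_nonneg h0 (sub_nonneg.2 ha), mul_nonneg h0 (sub_nonneg.2 hb),
    mul_nonneg h0 (sub_nonneg.2 hc), mul_nonneg (sub_nonneg.2 h1) (sub_nonneg.2 ha),
    mul_nonneg (sub_nonneg.2 h1) (sub_nonneg.2 hb), mul_nonneg (sub_nonneg.2 h1) (sub_nonneg.2 hc)]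

theorem abs_rowSnd_sub_le {x x' y : ℝ} (hx : x ≤ x') (h0 : 0 ≤ y) (h1 : y ≤ 1) :
    |rowSnd x' y - rowSnd x y| ≤ 20 / 19 * (x' - x) := by
  obtain ⟨ha, hb, hc⟩ := stairs_mono hx
  have E := eq_stairs x
  have E' := eq_stairs x'
  simp only [rowSnd]
  set a := stair x
  set b := stairMid x
  set c := stair' x
  set a' := stair x'
  set b' := stairMid x'
  set c' := stair' x'
  have h2 : 0 ≤ y * (1 - y) := mul_nonneg h0 (by linarith)
  rw [abs_le]
  constructor <;> nlinarith [mul_nonneg h0 (sub_nonneg.2 ha), mul_nonneg h0 (sub_nonneg.2 hb),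
    mul_nonneg h0 (sub_nonneg.2 hc), mul_nonneg (sub_nonneg.2 h1) (sub_nonneg.2 ha),
    mul_nonneg (sub_nonneg.2 h1) (sub_nonneg.2 hb), mul_nonneg (sub_nonneg.2 h1) (sub_nonneg.2 hc),
    mul_nonneg h2 (sub_nonneg.2 ha), mul_nonneg h2 (sub_nonneg.2 hc)]

theorem rowFst_sub_bounds {y y' : ℝ} (x : ℝ) (hy : y ≤ y') :
    17 / 38 * (y' - y) ≤ rowFst x y' - rowFst x y ∧
      rowFst x y' - rowFst x y ≤ 21 / 38 * (y' - y) := by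
  obtain ⟨h1, h2, h3⟩ := stairs_order x
  have e : rowFst x y' - rowFst x y = (17 / 38 + (stair x - stair' x) / 10 +
    (stairMid x - stair' x) / 190) * (y' - y) := by simp only [rowFst]; ring
  rw [e]
  constructor <;> refine mul_le_mul_of_nonneg_right ?_ (by linarith) <;> linarith

theorem abs_rowSnd_sub_le' {y y' : ℝ} (x : ℝ) (h0 : 0 ≤ y) (hy : y ≤ y') (hy1 : y' ≤ 1) :
    |rowSnd x y' - rowSnd x y| ≤ 41 / 210 * (y' - y) := by
  obtain ⟨h1, h2, h3⟩ := stairs_order x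
  have e : rowSnd x y' - rowSnd x y = (2 / 21 * (stairMid x - stair' x) -
    (1 - y - y') * (stair x - stair' x) / 10) * (y' - y) := by simp only [rowSnd]; ring
  rw [e, abs_mul, abs_of_nonneg (sub_nonneg.2 hy)]
  refine mul_le_mul_of_nonneg_right ?_ (by linarith)
  have : |(1 - y - y') * (stair x - stair' x)| ≤ 1 * 1 := by
    rw [abs_mul]
    gcongr <;> rw [abs_le] <;> constructor <;> linarith
  rw [abs_le] at this ⊢
  constructor <;> linarith

theorem row_mem {x y : ℝ} (hx0 : 0 ≤ x) (hx2 : x ≤ 2) (h0 : 0 ≤ y) (h1 : y ≤ 1) :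
    (0 ≤ rowFst x y ∧ rowFst x y ≤ 1) ∧ 0 ≤ rowSnd x y ∧ rowSnd x y ≤ 1 := by
  obtain ⟨h2, h3, h4⟩ := stairs_order x
  obtain ⟨h5, h6, h7⟩ := stairs_mono hx0
  obtain ⟨h8, h9, h10⟩ := stairs_mono hx2
  have e1 : stair 0 = 0 := by rw [stair_of_le 0 (by simp) (by norm_num)]; simp
  have e2 : stair 2 = 1 := by rw [stair_of_ge 0 (by norm_num) (by norm_num)]; simp
  have e3 : stair' 0 = 0 := by
    rw [stair', stair_of_ge (-1) (by norm_num) (by norm_num)]; simp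
  have e4 : stair' 2 = 1 := by
    rw [stair', stair_of_le 0 (by norm_num) (by norm_num)]; norm_num
  rw [e1] at h5
  rw [e2] at h8
  rw [e3] at h7
  rw [e4] at h10
  simp only [rowFst, rowSnd]
  set a := stair x
  set b := stairMid x
  set c := stair' x
  have k1 : 0 ≤ 1 - y := by linarith
  have k2 : 0 ≤ y * (1 - y) := mul_nonneg h0 k1
  have k3 : y * (1 - y) ≤ 1 - y := by nlinarith
  refine ⟨⟨?_, ?_⟩, ?_, ?_⟩
  · nlinarith [mul_nonneg k1 (sub_nonneg.2 h8), mul_nonneg h0 h5, mul_nonneg h0 h7, mul_nonneg h0 (sub_nonneg.2 h2), mul_nonneg h0 (sub_nonneg.2 h10)]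
  · nlinarith [mul_nonneg k1 h5, mul_nonneg h0 (sub_nonneg.2 h8), mul_nonneg h0 h7, mul_nonneg h0 (sub_nonneg.2 h3)]
  · nlinarith [mul_nonneg k1 (sub_nonneg.2 h3), mul_nonneg k1 (sub_nonneg.2 h8), mul_nonneg k1 (sub_nonneg.2 h10), mul_nonneg k2 (sub_nonneg.2 h8), mul_nonneg k2 (sub_nonneg.2 h10), mul_nonneg h0 (sub_nonneg.2 h10)]
  · nlinarith [mul_nonneg k1 (sub_nonneg.2 h2), mul_nonneg k1 h7, mul_nonneg h0 h7, mul_nonneg k2 (sub_nonneg.2 (h2.trans h3))]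

theorem coeff_bounds {m q D F β δ : ℝ} (hm0 : 0 ≤ m) (hm1 : m ≤ 1) (hq0 : 0 ≤ q)
    (hqm : q ≤ m * (1 - m)) (hq1 : (1 - 2 * m) * m ≤ q) (hF0 : 0 ≤ F) (hFD : F ≤ D) (hD1 : D ≤ 1)
    (hβ0 : 17 / 38 ≤ β) (hδ : δ = 2 / 21 * F - (1 - 2 * m) * D / 10) :
    0 ≤ q / 10 * β + δ * (2 * m - 1) / 20 ∧
    (0 < D → (m = 1 / 2 → 0 < q) → 0 < q / 10 * β + δ * (2 * m - 1) / 20) ∧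
    0 ≤ β * ((1 - m) * (2 / 21)) + δ * m / 190 ∧
    (0 < F → 0 < β * ((1 - m) * (2 / 21)) + δ * m / 190) ∧
    0 < β * ((1 - m) * (19 / 21) + m - q / 10) - δ * (2 * m / 19) := by
  have hD0 : 0 ≤ D := hF0.trans hFD
  have hmD : |(1 - 2 * m) * D| ≤ 1 * 1 := by
    rw [abs_mul]
    gcongr <;> rw [abs_le] <;> constructor <;> linarith
  rw [abs_le] at hmD
  have hδ0 : -(1 / 10) ≤ δ := by linarith
  have hδ1 : δ ≤ 1 / 5 := by linarith
  have hP : 0 < D → (m = 1 / 2 → 0 < q) → 0 < q / 10 * β + δ * (2 * m - 1) / 20 := by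
    intro hD hm
    rcases lt_trichotomy m (1 / 2) with h | h | h
    · have hm2 : 0 < 1 - 2 * m := by linarith
      have h1 : (1 - 2 * m) * m * (17 / 38) ≤ q * β := by gcongr
      have h2 : δ * (1 - 2 * m) ≤ (2 / 21 * D - (1 - 2 * m) * D / 10) * (1 - 2 * m) := by
        rw [hδ]; gcongr
      have h3 : 0 < 34 / 38 * m - D * (2 / 21 - (1 - 2 * m) / 10) := by
        rcases le_total (2 / 21 - (1 - 2 * m) / 10) 0 with h4 | h4
        · rcases hm0.lt_or_eq with h5 | rfl
          · nlinarith
          · linarith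
        · nlinarith
      have h4 := mul_pos hm2 h3
      linarith
    · have := hm h
      rw [h]
      have : 0 < q * β := mul_pos this (by linarith)
      linarith
    · have : 0 < (2 * m - 1) * D := mul_pos (by linarith) hD
      have : 0 < δ * (2 * m - 1) := mul_pos (by linarith) (by linarith)
      have : 0 ≤ q * β := mul_nonneg hq0 (by linarith)
      linarith
  have hQ : 0 < F → 0 < β * ((1 - m) * (2 / 21)) + δ * m / 190 := by
    intro hF
    rcases le_total m (1 / 2) with h | h
    · have h1 : 17 / 38 * (1 / 2 * (2 / 21)) ≤ β * ((1 - m) * (2 / 21)) := by gcongr; linarith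
      have h2 : -(1 / 10) * m ≤ δ * m := by gcongr
      linarith
    · have h1 : 0 ≤ (2 * m - 1) * D := mul_nonneg (by linarith) hD0
      have h2 : 0 < δ * m := mul_pos (by linarith) (by linarith)
      have : 0 ≤ β * ((1 - m) * (2 / 21)) :=
        mul_nonneg (by linarith) (mul_nonneg (by linarith) (by norm_num))
      linarith
  refine ⟨?_, hP, ?_, hQ, ?_⟩
  · rcases hD0.lt_or_eq with hD | hD
    · rcases eq_or_ne m (1 / 2) with rfl | hm
      · have : 0 ≤ q * β := mul_nonneg hq0 (by linarith)
        linarith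
      · exact (hP hD fun h => absurd h hm).le
    · have : F = 0 := by linarith
      rw [hδ, this, ← hD]
      have : 0 ≤ q * β := mul_nonneg hq0 (by linarith)
      linarith
  · rcases le_total m (1 / 2) with h | h
    · have h1 : 17 / 38 * (1 / 2 * (2 / 21)) ≤ β * ((1 - m) * (2 / 21)) := by gcongr; linarith
      have h2 : -(1 / 10) * m ≤ δ * m := by gcongr
      linarith
    · have h1 : 0 ≤ (2 * m - 1) * D := mul_nonneg (by linarith) hD0
      have h2 : 0 ≤ δ * m := mul_nonneg (by linarith) (by linarith)
      have : 0 ≤ β * ((1 - m) * (2 / 21)) :=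
        mul_nonneg (by linarith) (mul_nonneg (by linarith) (by norm_num))
      linarith
  · have h1 : 17 / 38 * (4 / 5) ≤ β * ((1 - m) * (19 / 21) + m - q / 10) := by
      gcongr
      nlinarith [sq_nonneg (m - 1 / 2)]
    have h2 : δ * (2 * m / 19) ≤ 1 / 5 * (2 * 1 / 19) := by gcongr
    linarith

set_option maxHeartbeats 1000000 in
theorem rowSnd_lt_of_rowFst_eq {x x' y y' : ℝ} (hx : x < x') (hy0 : 0 ≤ y) (hy1 : y ≤ 1)
    (hy0' : 0 ≤ y') (hy1' : y' ≤ 1) (h : rowFst x y = rowFst x' y') :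
    rowSnd x' y' < rowSnd x y := by
  obtain ⟨ha, hb, hc⟩ := stairs_mono hx.le
  obtain ⟨o1, o2, o3⟩ := stairs_order x
  obtain ⟨o1', o2', o3'⟩ := stairs_order x'
  have E := eq_stairs x
  have E' := eq_stairs x'
  simp only [rowFst, rowSnd] at h ⊢
  set a := stair x
  set b := stairMid x
  set c := stair' x
  set a' := stair x'
  set b' := stairMid x'
  set c' := stair' x'
  obtain ⟨m, hm⟩ : ∃ m, m = (y + y') / 2 := ⟨_, rfl⟩
  obtain ⟨q, hq⟩ : ∃ q, q = (y * (1 - y) + y' * (1 - y')) / 2 := ⟨_, rfl⟩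
  obtain ⟨D, hD⟩ : ∃ D, D = (a + a') / 2 - (c + c') / 2 := ⟨_, rfl⟩
  obtain ⟨F, hF⟩ : ∃ F, F = (b + b') / 2 - (c + c') / 2 := ⟨_, rfl⟩
  obtain ⟨β, hβ⟩ : ∃ β, β = 17 / 38 + D / 10 + F / 190 := ⟨_, rfl⟩
  obtain ⟨δ, hδ⟩ : ∃ δ, δ = 2 / 21 * F - (1 - 2 * m) * D / 10 := ⟨_, rfl⟩
  have hm0 : 0 ≤ m := by linarith
  have hm1 : m ≤ 1 := by linarith
  have hF0 : 0 ≤ F := by linarith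
  have hFD : F ≤ D := by linarith
  have hD1 : D ≤ 1 := by linarith
  have hβ0 : 17 / 38 ≤ β := by linarith
  have hβ1 : β ≤ 21 / 38 := by linarith
  have hq0 : 0 ≤ q := by
    rw [hq]
    nlinarith [mul_nonneg hy0 (sub_nonneg.2 hy1), mul_nonneg hy0' (sub_nonneg.2 hy1')]
  have hqm : q ≤ m * (1 - m) := by rw [hq, hm]; nlinarith [sq_nonneg (y - y')]
  have e1 : β * (y' - y) + (2 * m - 1) / 20 * (a' - a) + m / 190 * (b' - b) -
      2 / 19 * m * (c' - c) = 0 := by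
    rw [hβ, hD, hF, hm]; linear_combination -h
  have hqpos : c = c' → m = 1 / 2 → 0 < q := by
    intro hc hm2
    by_contra! hq2
    have h1 : 0 ≤ y * (1 - y) := mul_nonneg hy0 (by linarith)
    have h2 : 0 ≤ y' * (1 - y') := mul_nonneg hy0' (by linarith)
    have h3 : y * (1 - y) = 0 := by linarith
    rw [hm2] at e1
    clear hF hD hβ hδ hq h
    rcases mul_eq_zero.1 h3 with h3 | h3
    · have h4 : y' - y = 1 := by linarith
      rw [h4] at e1
      linarith
    · have h4 : y' - y = -1 := by linarith
      rw [h4] at e1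
      linarith
  have e2 : β * (((1 - y') * (1 - (2 * b' + 19 * c') / 21) + y' * (1 - c') -
      y' * (1 - y') * (a' - c') / 10) - ((1 - y) * (1 - (2 * b + 19 * c) / 21) + y * (1 - c) -
      y * (1 - y) * (a - c) / 10)) = -((q / 10 * β + δ * (2 * m - 1) / 20) * (a' - a) +
      (β * ((1 - m) * (2 / 21)) + δ * m / 190) * (b' - b) +
      (β * ((1 - m) * (19 / 21) + m - q / 10) - δ * (2 * m / 19)) * (c' - c)) := by
    have : ((1 - y') * (1 - (2 * b' + 19 * c') / 21) + y' * (1 - c') -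
      y' * (1 - y') * (a' - c') / 10) - ((1 - y) * (1 - (2 * b + 19 * c) / 21) + y * (1 - c) -
      y * (1 - y) * (a - c) / 10) = δ * (y' - y) - q / 10 * (a' - a) -
        (1 - m) * (2 / 21) * (b' - b) - ((1 - m) * (19 / 21) + m - q / 10) * (c' - c) := by
      rw [hδ, hq, hD, hF, hm]; ring
    rw [this]
    linear_combination δ * e1
  obtain ⟨hP, hP', hQ, hQ', hR⟩ := coeff_bounds hm0 hm1 hq0 hqm
    (by rw [hm, hq]; nlinarith [mul_nonneg hy0 hy0']) hF0 hFD hD1 hβ0 hδ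
  generalize q / 10 * β + δ * (2 * m - 1) / 20 = P at *
  generalize β * ((1 - m) * (2 / 21)) + δ * m / 190 = Q at *
  generalize β * ((1 - m) * (19 / 21) + m - q / 10) - δ * (2 * m / 19) = R at *
  suffices hs : 0 < P * (a' - a) + Q * (b' - b) + R * (c' - c) by
    by_contra! hle
    have := mul_nonneg (show 0 ≤ β by linarith) (sub_nonneg.2 hle)
    rw [e2] at this
    linarith
  have hPa := mul_nonneg hP (sub_nonneg.2 ha)
  have hQb := mul_nonneg hQ (sub_nonneg.2 hb)
  have hRc := mul_nonneg hR.le (sub_nonneg.2 hc)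
  rcases hc.lt_or_eq with hc | hc
  · have := mul_pos hR (sub_pos.2 hc)
    linarith
  rcases ha.lt_or_eq with ha | ha
  · have hD0 : 0 < D := by linarith
    have : 0 < P := hP' hD0 fun hm2 => hqpos hc hm2
    have := mul_pos this (sub_pos.2 ha)
    linarith
  · have hb' : b < b' := by linarith
    have := mul_pos (hQ' (by linarith)) (sub_pos.2 hb')
    linarith

end TwinDragon

theorem exists_int_row (y : ℝ) : ∃ n : ℤ, (n : ℝ) ≤ y ∧ y ≤ n + 1 :=
  ⟨⌊y⌋, Int.floor_le y, (Int.lt_floor_add_one y).le⟩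

/-- A bound on increments over each unit interval between integers is a global bound. -/
theorem sub_le_of_forall_unit_interval {g : ℝ → ℝ} {C : ℝ}
    (h : ∀ (n : ℤ) (y y' : ℝ), n ≤ y → y ≤ y' → y' ≤ n + 1 → g y' - g y ≤ C * (y' - y))
    {y y' : ℝ} (hy : y ≤ y') : g y' - g y ≤ C * (y' - y) := by
  have key : ∀ (m : ℕ) (n : ℤ) (y y' : ℝ), n ≤ y → y ≤ y' → y ≤ n + 1 → y' ≤ n + m + 1 →
      g y' - g y ≤ C * (y' - y) := by
    intro m
    induction m with
    | zero => exact fun n y y' h1 h2 _ h3 => h n y y' h1 h2 (by simpa using h3)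
    | succ m ih =>
      intro n y y' h1 h2 h3 h4
      rcases le_total y' (n + 1) with h5 | h5
      · exact h n y y' h1 h2 h5
      · have e1 := h n y (n + 1) h1 h3 le_rfl
        have e2 := ih (n + 1) (n + 1) y' (by simp) h5 (by simp) (by push_cast at h4 ⊢; linarith)
        linarith
  obtain ⟨n, h1, h2⟩ := exists_int_row y
  obtain ⟨m, hm⟩ := exists_nat_ge (y' - y)
  exact key m n y y' h1 hy h2 (by linarith)

namespace TwinDragon

/-- First coordinate of the map. -/
def fst (x y : ℝ) : ℝ :=
  if y - 2 * ⌊y / 2⌋ ≤ 1 then rowFst (x - ⌊y / 2⌋ / 10) (y - 2 * ⌊y / 2⌋) + ⌊y / 2⌋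
  else 1 - rowFst (61 / 20 - (x - ⌊y / 2⌋ / 10)) (2 - (y - 2 * ⌊y / 2⌋)) + ⌊y / 2⌋

/-- Second coordinate of the map. -/
def snd (x y : ℝ) : ℝ :=
  if y - 2 * ⌊y / 2⌋ ≤ 1 then rowSnd (x - ⌊y / 2⌋ / 10) (y - 2 * ⌊y / 2⌋)
  else 1 - rowSnd (61 / 20 - (x - ⌊y / 2⌋ / 10)) (2 - (y - 2 * ⌊y / 2⌋))

theorem eq_even (k : ℤ) (x : ℝ) {y : ℝ} (h0 : 2 * k ≤ y) (h1 : y ≤ 2 * k + 1) :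
    fst x y = rowFst (x - k / 10) (y - 2 * k) + k ∧ snd x y = rowSnd (x - k / 10) (y - 2 * k) := by
  have : ⌊y / 2⌋ = k := by rw [Int.floor_eq_iff]; constructor <;> linarith
  rw [fst, snd, this, if_pos (by linarith), if_pos (by linarith)]
  exact ⟨rfl, rfl⟩

theorem eq_odd (k : ℤ) (x : ℝ) {y : ℝ} (h0 : 2 * k + 1 ≤ y) (h1 : y ≤ 2 * k + 2) :
    fst x y = 1 - rowFst (61 / 20 - (x - k / 10)) (2 - (y - 2 * k)) + k ∧
      snd x y = 1 - rowSnd (61 / 20 - (x - k / 10)) (2 - (y - 2 * k)) := by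
  rcases h0.eq_or_lt with rfl | h0
  · obtain ⟨e1, e2⟩ := eq_even k x (y := 2 * k + 1) (by linarith) le_rfl
    rw [e1, e2, show (2 : ℝ) * k + 1 - 2 * k = 1 by ring, show (2 : ℝ) - 1 = 1 by norm_num,
      rowFst_one, rowSnd_one]
    exact ⟨rfl, rfl⟩
  rcases h1.eq_or_lt with rfl | h1
  · obtain ⟨e1, e2⟩ := eq_even (k + 1) x (y := 2 * k + 2) (by push_cast; linarith)
      (by push_cast; linarith)
    rw [e1, e2, show (2 : ℝ) - (2 * k + 2 - 2 * k) = 0 by ring, rowFst_zero, rowSnd_zero]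
    push_cast
    rw [show (2 : ℝ) * k + 2 - 2 * (k + 1) = 0 by ring,
      show x - ((k : ℝ) + 1) / 10 = x - k / 10 - 1 / 10 by ring]
    constructor <;> ring
  · have : ⌊y / 2⌋ = k := by rw [Int.floor_eq_iff]; constructor <;> linarith
    rw [fst, snd, this, if_neg (by linarith), if_neg (by linarith)]
    exact ⟨rfl, rfl⟩

/-- Each unit strip is, up to symmetry, the basic strip. -/
theorem exists_row (n : ℤ) :
    (∃ k : ℤ, ∀ x y : ℝ, n ≤ y → y ≤ n + 1 →
      fst x y = rowFst (x - k / 10) (y - n) + k ∧ snd x y = rowSnd (x - k / 10) (y - n)) ∨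
    (∃ k : ℤ, ∀ x y : ℝ, n ≤ y → y ≤ n + 1 →
      fst x y = 1 - rowFst (61 / 20 - (x - k / 10)) (n + 1 - y) + k ∧
      snd x y = 1 - rowSnd (61 / 20 - (x - k / 10)) (n + 1 - y)) := by
  obtain ⟨k, rfl | rfl⟩ := Int.even_or_odd' n
  · left
    refine ⟨k, fun x y h0 h1 => ?_⟩
    push_cast at *
    exact eq_even k x h0 h1
  · right
    refine ⟨k, fun x y h0 h1 => ?_⟩
    push_cast at *
    rw [show 2 * (k : ℝ) + 1 + 1 - y = 2 - (y - 2 * k) by ring]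
    exact eq_odd k x h0 (by linarith)

theorem abs_sub_le_horizontal (x x' y : ℝ) :
    |fst x' y - fst x y| ≤ 1 / 9 * |x' - x| ∧ |snd x' y - snd x y| ≤ 20 / 19 * |x' - x| := by
  wlog hx : x ≤ x' generalizing x x'
  · have := this x' x (le_of_not_ge hx)
    rwa [abs_sub_comm (fst x' y), abs_sub_comm (snd x' y), abs_sub_comm x']
  rw [abs_of_nonneg (sub_nonneg.2 hx)]
  obtain ⟨n, h0, h1⟩ := exists_int_row y
  rcases exists_row n with ⟨k, hk⟩ | ⟨k, hk⟩
  · rw [(hk x y h0 h1).1, (hk x y h0 h1).2, (hk x' y h0 h1).1, (hk x' y h0 h1).2]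
    have e1 := abs_rowFst_sub_le (x := x - k / 10) (x' := x' - k / 10) (y := y - n) (by linarith)
      (by linarith) (by linarith)
    have e2 := abs_rowSnd_sub_le (x := x - k / 10) (x' := x' - k / 10) (y := y - n) (by linarith)
      (by linarith) (by linarith)
    simp only [abs_le] at *
    refine ⟨⟨?_, ?_⟩, ?_, ?_⟩ <;> linarith
  · rw [(hk x y h0 h1).1, (hk x y h0 h1).2, (hk x' y h0 h1).1, (hk x' y h0 h1).2]
    have e1 := abs_rowFst_sub_le (x := 61 / 20 - (x' - k / 10)) (x' := 61 / 20 - (x - k / 10))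
      (y := n + 1 - y) (by linarith) (by linarith) (by linarith)
    have e2 := abs_rowSnd_sub_le (x := 61 / 20 - (x' - k / 10)) (x' := 61 / 20 - (x - k / 10))
      (y := n + 1 - y) (by linarith) (by linarith) (by linarith)
    simp only [abs_le] at *
    refine ⟨⟨?_, ?_⟩, ?_, ?_⟩ <;> linarith

theorem fst_sub_bounds (x : ℝ) {y y' : ℝ} (hy : y ≤ y') :
    17 / 38 * (y' - y) ≤ fst x y' - fst x y ∧ fst x y' - fst x y ≤ 21 / 38 * (y' - y) := by
  have key : ∀ (n : ℤ) (y y' : ℝ), n ≤ y → y ≤ y' → y' ≤ n + 1 →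
      17 / 38 * (y' - y) ≤ fst x y' - fst x y ∧ fst x y' - fst x y ≤ 21 / 38 * (y' - y) := by
    intro n y y' h0 h h1
    rcases exists_row n with ⟨k, hk⟩ | ⟨k, hk⟩
    · rw [(hk x y h0 (h.trans h1)).1, (hk x y' (h0.trans h) h1).1]
      have := rowFst_sub_bounds (y := y - n) (y' := y' - n) (x - k / 10) (by linarith)
      constructor <;> linarith
    · rw [(hk x y h0 (h.trans h1)).1, (hk x y' (h0.trans h) h1).1]
      have := rowFst_sub_bounds (y := n + 1 - y') (y' := n + 1 - y) (61 / 20 - (x - k / 10))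
        (by linarith)
      constructor <;> linarith
  have h1 := sub_le_of_forall_unit_interval (fun n y y' a b c => (key n y y' a b c).2) hy
  have h2 := sub_le_of_forall_unit_interval (g := fun y => - fst x y) (C := -(17 / 38))
    (fun n y y' a b c => by linarith [(key n y y' a b c).1]) hy
  constructor <;> linarith

theorem abs_snd_sub_le (x : ℝ) {y y' : ℝ} (hy : y ≤ y') :
    |snd x y' - snd x y| ≤ 41 / 210 * (y' - y) := by
  have key : ∀ (n : ℤ) (y y' : ℝ), n ≤ y → y ≤ y' → y' ≤ n + 1 →
      |snd x y' - snd x y| ≤ 41 / 210 * (y' - y) := by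
    intro n y y' h0 h h1
    rcases exists_row n with ⟨k, hk⟩ | ⟨k, hk⟩
    · rw [(hk x y h0 (h.trans h1)).2, (hk x y' (h0.trans h) h1).2]
      have := abs_rowSnd_sub_le' (y := y - n) (y' := y' - n) (x - k / 10) (by linarith)
        (by linarith) (by linarith)
      rwa [sub_sub_sub_cancel_right] at this
    · rw [(hk x y h0 (h.trans h1)).2, (hk x y' (h0.trans h) h1).2]
      have := abs_rowSnd_sub_le' (y := n + 1 - y') (y' := n + 1 - y) (61 / 20 - (x - k / 10))
        (by linarith) (by linarith) (by linarith)
      rw [abs_le] at *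
      constructor <;> linarith
  have h1 := sub_le_of_forall_unit_interval
    (fun n y y' a b c => (le_abs_self _).trans (key n y y' a b c)) hy
  have h2 := sub_le_of_forall_unit_interval (g := fun y => - snd x y) (C := 41 / 210)
    (fun n y y' a b c => by linarith [neg_abs_le (snd x y' - snd x y), key n y y' a b c]) hy
  rw [abs_le]
  constructor <;> linarith

theorem abs_sub_le_vertical (x y y' : ℝ) :
    |fst x y' - fst x y| ≤ 21 / 38 * |y' - y| ∧ |snd x y' - snd x y| ≤ 41 / 210 * |y' - y| := by
  wlog hy : y ≤ y' generalizing y y'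
  · have := this y' y (le_of_not_ge hy)
    rwa [abs_sub_comm (fst x y'), abs_sub_comm (snd x y'), abs_sub_comm y']
  rw [abs_of_nonneg (sub_nonneg.2 hy)]
  refine ⟨?_, abs_snd_sub_le x hy⟩
  have := fst_sub_bounds x hy
  rw [abs_le]
  constructor <;> linarith

theorem snd_lt_of_same_row (n : ℤ) {x x' y y' : ℝ} (hx : x < x') (hy0 : n ≤ y) (hy1 : y ≤ n + 1)
    (hy0' : n ≤ y') (hy1' : y' ≤ n + 1) (h : fst x y = fst x' y') : snd x' y' < snd x y := by
  rcases exists_row n with ⟨k, hk⟩ | ⟨k, hk⟩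
  · rw [(hk x y hy0 hy1).1, (hk x' y' hy0' hy1').1] at h
    rw [(hk x y hy0 hy1).2, (hk x' y' hy0' hy1').2]
    exact rowSnd_lt_of_rowFst_eq (by linarith) (by linarith) (by linarith) (by linarith)
      (by linarith) (by linarith)
  · rw [(hk x y hy0 hy1).1, (hk x' y' hy0' hy1').1] at h
    rw [(hk x y hy0 hy1).2, (hk x' y' hy0' hy1').2]
    have := rowSnd_lt_of_rowFst_eq (x := 61 / 20 - (x' - k / 10)) (x' := 61 / 20 - (x - k / 10))
      (y := n + 1 - y') (y' := n + 1 - y) (by linarith) (by linarith) (by linarith) (by linarith)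
      (by linarith) (by linarith)
    linarith

theorem continuous_fst_left (y : ℝ) : Continuous fun x => fst x y :=
  (LipschitzWith.of_dist_le_mul (K := 1 / 9) fun x x' => by
    simpa [Real.dist_eq] using (abs_sub_le_horizontal x' x y).1).continuous

theorem continuous_fst_right (x : ℝ) : Continuous fun y => fst x y :=
  (LipschitzWith.of_dist_le_mul (K := 21 / 38) fun y y' => by
    simpa [Real.dist_eq] using (abs_sub_le_vertical x y' y).1).continuous

theorem fst_injective (x : ℝ) {y y' : ℝ} (h : fst x y = fst x y') : y = y' := by
  rcases le_total y y' with hy | hy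
  · linarith [(fst_sub_bounds x hy).1]
  · linarith [(fst_sub_bounds x hy).1]

theorem eq_or_snd_lt_of_same_row (n : ℤ) {x x' y y' : ℝ} (hx : x ≤ x') (hy0 : n ≤ y)
    (hy1 : y ≤ n + 1) (hy0' : n ≤ y') (hy1' : y' ≤ n + 1) (h : fst x y = fst x' y') :
    (x = x' ∧ y = y') ∨ snd x' y' < snd x y := by
  rcases hx.eq_or_lt with rfl | hx
  · exact Or.inl ⟨rfl, fst_injective x h⟩
  · exact Or.inr (snd_lt_of_same_row n hx hy0 hy1 hy0' hy1' h)

/-- On the level lines of the first coordinate the second one decreases to the right. -/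
theorem eq_or_snd_lt {x x' y y' : ℝ} (hx : x ≤ x') (h : fst x y = fst x' y') :
    (x = x' ∧ y = y') ∨ snd x' y' < snd x y := by
  have trans : ∀ {x x' x'' y y' y'' : ℝ}, (x = x' ∧ y = y') ∨ snd x' y' < snd x y →
      (x' = x'' ∧ y' = y'') ∨ snd x'' y'' < snd x' y' →
      (x = x'' ∧ y = y'') ∨ snd x'' y'' < snd x y := by
    rintro x x' x'' y y' y'' (⟨rfl, rfl⟩ | h) (⟨rfl, rfl⟩ | h')
    · exact Or.inl ⟨rfl, rfl⟩
    · exact Or.inr h'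
    · exact Or.inr h
    · exact Or.inr (h'.trans h)
  have key : ∀ (m : ℕ) (n n' : ℤ) (x x' y y' : ℝ), (n - n').natAbs ≤ m → n ≤ y → y ≤ n + 1 →
      n' ≤ y' → y' ≤ n' + 1 → x ≤ x' → fst x y = fst x' y' →
      (x = x' ∧ y = y') ∨ snd x' y' < snd x y := by
    intro m
    induction m with
    | zero =>
      intro n n' x x' y y' hn h0 h1 h0' h1' hx h
      obtain rfl : n = n' := by omega
      exact eq_or_snd_lt_of_same_row n hx h0 h1 h0' h1' h
    | succ m ih =>
      intro n n' x x' y y' hn h0 h1 h0' h1' hx h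
      rcases lt_trichotomy n n' with hnn | rfl | hnn
      · have hc : ((n + 1 : ℤ) : ℝ) ≤ n' := by exact_mod_cast hnn
        push_cast at hc
        have e1 := (fst_sub_bounds x h1).1
        have e2 := (fst_sub_bounds x' (hc.trans h0')).1
        obtain ⟨z, ⟨hz1, hz2⟩, hz⟩ := intermediate_value_Icc' hx
          (continuous_fst_left (n + 1)).continuousOn
          (show fst x y ∈ Icc (fst x' (n + 1)) (fst x (n + 1)) by constructor <;> linarith)
        exact trans (eq_or_snd_lt_of_same_row n hz1 h0 h1 (by linarith) le_rfl hz.symm)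
          (ih (n + 1) n' z x' (n + 1) y' (by omega) (by push_cast; exact le_rfl)
            (by push_cast; linarith) h0' h1' hz2 (hz.trans h))
      · exact eq_or_snd_lt_of_same_row n hx h0 h1 h0' h1' h
      · have hc : ((n' + 1 : ℤ) : ℝ) ≤ n := by exact_mod_cast hnn
        push_cast at hc
        have e1 := (fst_sub_bounds x h0).1
        have e2 := (fst_sub_bounds x' (h1'.trans hc)).1
        obtain ⟨z, ⟨hz1, hz2⟩, hz⟩ := intermediate_value_Icc hx
          (continuous_fst_left n).continuousOn
          (show fst x y ∈ Icc (fst x n) (fst x' n) by constructor <;> linarith)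
        exact trans (eq_or_snd_lt_of_same_row n hz1 h0 h1 le_rfl (by linarith) hz.symm)
          (ih (n - 1) n' z x' n y' (by omega) (by push_cast; linarith)
            (by push_cast; linarith) h0' h1' hz2 (hz.trans h))
  obtain ⟨n, h0, h1⟩ := exists_int_row y
  obtain ⟨n', h0', h1'⟩ := exists_int_row y'
  exact key _ n n' x x' y y' le_rfl h0 h1 h0' h1' hx h

theorem fst_add (x y : ℝ) (p k : ℤ) :
    fst (x + k / 10 - 2 * p) (y + 2 * k) = fst x y + k + p / 20 ∧
      snd (x + k / 10 - 2 * p) (y + 2 * k) = snd x y + p := by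
  obtain ⟨n, h0, h1⟩ := exists_int_row y
  obtain ⟨j, rfl | rfl⟩ := Int.even_or_odd' n
  · push_cast at h0 h1
    rw [(eq_even j x h0 h1).1, (eq_even j x h0 h1).2]
    have := eq_even (j + k) (x + k / 10 - 2 * p) (y := y + 2 * k) (by push_cast; linarith)
      (by push_cast; linarith)
    rw [this.1, this.2, ]
    push_cast
    rw [show x + (k : ℝ) / 10 - 2 * p - (j + k) / 10 = x - j / 10 + 2 * ((-p : ℤ) : ℝ) by
      push_cast; ring, show y + 2 * (k : ℝ) - 2 * (j + k) = y - 2 * j by ring, rowFst_add,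
      rowSnd_add]
    push_cast
    constructor <;> ring
  · push_cast at h0 h1
    rw [(eq_odd j x h0 (by linarith)).1, (eq_odd j x h0 (by linarith)).2]
    have := eq_odd (j + k) (x + k / 10 - 2 * p) (y := y + 2 * k) (by push_cast; linarith)
      (by push_cast; linarith)
    rw [this.1, this.2]
    push_cast
    rw [show 61 / 20 - (x + (k : ℝ) / 10 - 2 * p - (j + k) / 10) =
      61 / 20 - (x - j / 10) + 2 * (p : ℝ) by ring,
      show y + 2 * (k : ℝ) - 2 * (j + k) = y - 2 * j by ring, rowFst_add, rowSnd_add]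
    constructor <;> ring

theorem exists_fst_eq (p x : ℝ) : ∃ y, fst x y = p := by
  have e1 := (fst_sub_bounds x (y := 0) (y' := 38 / 17 * |p - fst x 0|) (by positivity)).1
  have e2 := (fst_sub_bounds x (y := -(38 / 17 * |p - fst x 0|)) (y' := 0)
    (by simp only [Left.neg_nonpos_iff]; positivity)).1
  have h1 := le_abs_self (p - fst x 0)
  have h2 := neg_abs_le (p - fst x 0)
  obtain ⟨y, -, hy⟩ := intermediate_value_Icc
    (show -(38 / 17 * |p - fst x 0|) ≤ 38 / 17 * |p - fst x 0| by
      have : 0 ≤ |p - fst x 0| := abs_nonneg _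
      linarith) (continuous_fst_right x).continuousOn
    (show p ∈ Icc _ _ by constructor <;> linarith)
  exact ⟨y, hy⟩

theorem surjective (p q : ℝ) : ∃ x y, fst x y = p ∧ snd x y = q := by
  choose Y hY using exists_fst_eq p
  have hlip : ∀ x x', |Y x' - Y x| ≤ 38 / 153 * |x' - x| := by
    intro x x'
    have h1 := (abs_sub_le_horizontal x x' (Y x')).1
    rw [hY] at h1
    have h2 : 17 / 38 * |Y x' - Y x| ≤ |p - fst x (Y x')| := by
      rw [← hY x]
      rcases le_total (Y x) (Y x') with h | h
      · rw [abs_of_nonneg (sub_nonneg.2 h), abs_sub_comm]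
        exact (fst_sub_bounds x h).1.trans (le_abs_self _)
      · rw [abs_of_nonpos (sub_nonpos.2 h)]
        refine le_trans ?_ (le_abs_self _)
        linarith [(fst_sub_bounds x h).1]
    linarith
  have hg : Continuous fun x => snd x (Y x) := by
    refine (LipschitzWith.of_dist_le_mul (K := 2) fun x x' => ?_).continuous
    rw [Real.dist_eq, Real.dist_eq]
    have h1 := hlip x' x
    have h2 := (abs_sub_le_horizontal x' x (Y x)).2
    have h3 := (abs_sub_le_vertical x' (Y x') (Y x)).2
    have h4 := abs_sub_le (snd x (Y x)) (snd x' (Y x)) (snd x' (Y x'))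
    have h5 := abs_nonneg (x - x')
    simp only [NNReal.coe_ofNat]
    linarith
  have hshift : ∀ m : ℤ, snd (m * (401 / 10)) (Y (m * (401 / 10))) = snd 0 (Y 0) - 20 * m := by
    intro m
    have h1 := fst_add 0 (Y 0) (-20 * m) m
    have e : (0:ℝ) + m / 10 - 2 * ((-20 * m : ℤ) : ℝ) = m * (401 / 10) := by push_cast; ring
    rw [e, hY] at h1
    have : Y 0 + 2 * m = Y (m * (401 / 10)) := by
      refine fst_injective (m * (401 / 10)) ?_
      rw [h1.1, hY]
      push_cast
      ring
    rw [← this, h1.2]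
    push_cast
    ring
  obtain ⟨m, hm⟩ := exists_nat_ge |q - snd 0 (Y 0)|
  have h1 := hshift m
  have h2 := hshift (-m)
  rw [abs_le] at hm
  have hm0 : (0:ℝ) ≤ m := Nat.cast_nonneg m
  push_cast at h1 h2
  obtain ⟨x, -, hx⟩ := intermediate_value_Icc'
    (show -(m:ℝ) * (401 / 10) ≤ m * (401 / 10) by linarith) hg.continuousOn
    (show q ∈ Icc _ _ by constructor <;> linarith)
  exact ⟨x, Y x, hY x, hx⟩

end TwinDragon

theorem unitSquare_subset_of_isClosed {C : Set Pt} (hC : IsClosed C)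
    (h : ∀ w : Pt, 0 < w 0 → w 0 < 1 → 0 < w 1 → w 1 < 1 → w ∈ C) : unitSquare ⊆ C := by
  intro w hw
  obtain ⟨h1, h2, h3, h4⟩ := hw
  have hcont : Continuous fun t : ℝ => w + t • ((fun _ => 1 / 2 : Pt) - w) := by fun_prop
  have hmem : (0:ℝ) ∈ closure (Ioo 0 1) := by
    rw [closure_Ioo (by norm_num)]; simp
  have : w + (0:ℝ) • ((fun _ => 1 / 2 : Pt) - w) ∈ closure C := by
    refine map_mem_closure (f := fun t : ℝ => w + t • ((fun _ => 1 / 2 : Pt) - w)) hcont hmem fun t ht => h _ ?_ ?_ ?_ ?_ <;>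
      simp only [Pi.add_apply, Pi.smul_apply, Pi.sub_apply, smul_eq_mul] <;>
      nlinarith [ht.1, ht.2]
  simpa [hC.closure_eq] using this

namespace TwinDragon

/-- The contracting map realizing two steps of the subdivision of the twin dragon. -/
def map (z : Pt) : Pt := ![fst (z 0) (z 1), snd (z 0) (z 1)]

theorem lattice_eq (p q : ℤ) :
    latticeMap ![-(19 / 20), 1] ![1, 0] (p, q) = (![q - 19 / 20 * p, p] : Pt) := by
  rw [latticeMap_apply]
  ext i
  fin_cases i
  · simp; ring
  · simp

theorem map_add_lattice (z : Pt) (p q : ℤ) :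
    map (z + latticeMap ![-(19 / 20), 1] ![1, 0] (2 * q - 2 * p, 2 * q - 4 * p)) =
      map z + latticeMap ![-(19 / 20), 1] ![1, 0] (p, q) := by
  have := fst_add (z 0) (z 1) p (q - p)
  rw [lattice_eq, lattice_eq]
  push_cast at this
  have e1 : z 0 + (2 * (q:ℝ) - 4 * p - 19 / 20 * (2 * q - 2 * p)) = z 0 + (q - p) / 10 - 2 * p := by
    ring
  have e2 : z 1 + (2 * (q:ℝ) - 2 * p) = z 1 + 2 * (q - p) := by ring
  ext i
  fin_cases i
  · simp [map, e1, e2, this]; ring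
  · simp [map, e1, e2, this]

theorem map_contracting (z z' : Pt) :
    shearSeminorm 0 (7 / 5) (map z - map z') ≤ 19 / 20 * shearSeminorm 0 (7 / 5) (z - z') := by
  have h := (shearSeminorm_le (m := 0) (K := 7 / 5) (by norm_num) (v := z - z')).1 le_rfl
  obtain ⟨h1, h2⟩ := h
  rw [shearSeminorm_le (by norm_num)]
  have e1 := abs_sub_le_horizontal (z' 0) (z 0) (z 1)
  have e2 := abs_sub_le_vertical (z' 0) (z' 1) (z 1)
  simp only [Pi.sub_apply, map, Matrix.cons_val_zero, Matrix.cons_val_one, zero_mul, sub_zero]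
    at h1 h2 ⊢
  have t1 := abs_sub_le (fst (z 0) (z 1)) (fst (z' 0) (z 1)) (fst (z' 0) (z' 1))
  have t2 := abs_sub_le (snd (z 0) (z 1)) (snd (z' 0) (z 1)) (snd (z' 0) (z' 1))
  have := apply_nonneg (shearSeminorm 0 (7 / 5)) (z - z')
  constructor <;> linarith

theorem map_injective : Function.Injective map := by
  intro z z' h
  have h1 : fst (z 0) (z 1) = fst (z' 0) (z' 1) := congr_fun h 0
  have h2 : snd (z 0) (z 1) = snd (z' 0) (z' 1) := congr_fun h 1
  have : z 0 = z' 0 ∧ z 1 = z' 1 := by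
    rcases le_total (z 0) (z' 0) with hx | hx
    · exact (eq_or_snd_lt hx h1).resolve_right h2.not_gt
    · have := (eq_or_snd_lt hx h1.symm).resolve_right h2.symm.not_gt
      exact ⟨this.1.symm, this.2.symm⟩
  ext i
  fin_cases i
  · exact this.1
  · exact this.2

theorem continuous_map : Continuous map := by
  have hL : LipschitzWith 10 map := by
    refine LipschitzWith.of_dist_le_mul fun z z' => ?_
    have e1 := abs_sub_le_horizontal (z' 0) (z 0) (z 1)
    have e2 := abs_sub_le_vertical (z' 0) (z' 1) (z 1)
    have t1 := abs_sub_le (fst (z 0) (z 1)) (fst (z' 0) (z 1)) (fst (z' 0) (z' 1))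
    have t2 := abs_sub_le (snd (z 0) (z 1)) (snd (z' 0) (z 1)) (snd (z' 0) (z' 1))
    have d0 := dist_le_pi_dist z z' 0
    have d1 := dist_le_pi_dist z z' 1
    have dn : 0 ≤ dist z z' := dist_nonneg
    rw [Real.dist_eq] at d0 d1
    simp only [NNReal.coe_ofNat]
    rw [dist_pi_le_iff (by positivity)]
    intro i
    fin_cases i
    · change dist (fst (z 0) (z 1)) (fst (z' 0) (z' 1)) ≤ _
      rw [Real.dist_eq]; linarith
    · change dist (snd (z 0) (z 1)) (snd (z' 0) (z' 1)) ≤ _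
      rw [Real.dist_eq]; linarith
  exact hL.continuous

theorem map_mem {h : Pt} (hh : h ∈ unitSquare) {i j : ℤ} (hi0 : 0 ≤ i) (hi1 : i ≤ 1) (hj0 : 0 ≤ j)
    (hj1 : j ≤ 1) :
    map (h + latticeMap ![-(19 / 20), 1] ![1, 0] (i, 2 * i + j)) ∈ unitSquare := by
  obtain ⟨h1, h2, h3, h4⟩ := hh
  have hj0' : (0:ℝ) ≤ j := by exact_mod_cast hj0
  have hj1' : (j:ℝ) ≤ 1 := by exact_mod_cast hj1
  rw [lattice_eq]
  simp only [unitSquare, mem_ofPred_eq, map, Pi.add_apply, Matrix.cons_val_zero,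
    Matrix.cons_val_one]
  obtain rfl | rfl : i = 0 ∨ i = 1 := by omega
  · push_cast
    have e := eq_even 0 (h 0 + (0 + j - 19 / 20 * 0)) (y := h 1 + 0) (by push_cast; linarith)
      (by push_cast; linarith)
    rw [e.1, e.2]
    push_cast
    have := row_mem (x := h 0 + (0 + j - 19 / 20 * 0) - 0 / 10) (y := h 1 + 0 - 2 * 0)
      (by linarith) (by linarith) (by linarith) (by linarith)
    refine ⟨?_, ?_, ?_, ?_⟩ <;> linarith
  · push_cast
    have e := eq_odd 0 (h 0 + (2 + j - 19 / 20 * 1)) (y := h 1 + 1) (by push_cast; linarith)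
      (by push_cast; linarith)
    rw [e.1, e.2]
    push_cast
    have := row_mem (x := 61 / 20 - (h 0 + (2 + j - 19 / 20 * 1) - 0 / 10))
      (y := 2 - (h 1 + 1 - 2 * 0))
      (by linarith) (by linarith) (by linarith) (by linarith)
    refine ⟨?_, ?_, ?_, ?_⟩ <;> linarith

/-- The translates of the double column of unit squares under the sublattice cover the plane. -/
theorem exists_translate (z : Pt) : ∃ h ∈ unitSquare, ∃ i j p q : ℤ, 0 ≤ i ∧ i ≤ 1 ∧ 0 ≤ j ∧
    j ≤ 1 ∧ z = h + latticeMap ![-(19 / 20), 1] ![1, 0] (i, 2 * i + j) +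
      latticeMap ![-(19 / 20), 1] ![1, 0] (2 * q - 2 * p, 2 * q - 4 * p) := by
  set n := ⌊z 1⌋
  have n1 := Int.floor_le (z 1)
  have n2 := Int.lt_floor_add_one (z 1)
  set m := ⌊z 0 + 19 / 20 * n⌋
  have m1 := Int.floor_le (z 0 + 19 / 20 * n)
  have m2 := Int.lt_floor_add_one (z 0 + 19 / 20 * n)
  obtain ⟨i, k, hi0, hi1, hi⟩ : ∃ i k : ℤ, 0 ≤ i ∧ i ≤ 1 ∧ n = i + 2 * k :=
    ⟨n % 2, n / 2, by omega, by omega, by omega⟩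
  obtain ⟨j, l, hj0, hj1, hj⟩ : ∃ j l : ℤ, 0 ≤ j ∧ j ≤ 1 ∧ m = j + 2 * l :=
    ⟨m % 2, m / 2, by omega, by omega, by omega⟩
  refine ⟨![z 0 + 19 / 20 * n - m, z 1 - n], ⟨?_, ?_, ?_, ?_⟩, i, j, k + i - l, 2 * k + i - l, hi0,
    hi1, hj0, hj1, ?_⟩
  · simp; linarith
  · simp; linarith
  · simp; linarith
  · simp; linarith
  · rw [lattice_eq, lattice_eq]
    have hn : (n:ℝ) = i + 2 * k := by exact_mod_cast hi
    have hm : (m:ℝ) = j + 2 * l := by exact_mod_cast hj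
    rw [hn, hm]
    ext r
    fin_cases r
    · simp; ring
    · simp; ring

theorem exists_map_eq {w : Pt} (hw : w ∈ unitSquare) : ∃ h ∈ unitSquare, ∃ i j : ℤ, 0 ≤ i ∧
    i ≤ 1 ∧ 0 ≤ j ∧ j ≤ 1 ∧
    map (h + latticeMap ![-(19 / 20), 1] ![1, 0] (i, 2 * i + j)) = w := by
  let C : Set Pt := ⋃ i ∈ Finset.Icc (0:ℤ) 1, ⋃ j ∈ Finset.Icc (0:ℤ) 1,
    (fun h => map (h + latticeMap ![-(19 / 20), 1] ![1, 0] (i, 2 * i + j))) '' unitSquare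
  have hC : IsClosed C := by
    refine IsCompact.isClosed (Finset.isCompact_biUnion _ fun i _ =>
      Finset.isCompact_biUnion _ fun j _ => isCompact_unitSquare.image ?_)
    exact continuous_map.comp (continuous_id.add continuous_const)
  have hsub : unitSquare ⊆ C := by
    refine unitSquare_subset_of_isClosed hC fun w h1 h2 h3 h4 => ?_
    obtain ⟨x, y, hx, hy⟩ := surjective (w 0) (w 1)
    obtain ⟨h, hh, i, j, p, q, hi0, hi1, hj0, hj1, he⟩ := exists_translate ![x, y]
    have hw : map ![x, y] = w := by
      ext r
      fin_cases r
      · exact hx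
      · exact hy
    obtain ⟨k1, k2, k3, k4⟩ := map_mem hh hi0 hi1 hj0 hj1
    rw [he, map_add_lattice, lattice_eq p q] at hw
    have w0 := congr_fun hw 0
    have w1 := congr_fun hw 1
    simp only [Pi.add_apply, Matrix.cons_val_zero, Matrix.cons_val_one] at w0 w1
    have p1 : (p:ℝ) < 1 := by linarith
    have p2 : (-1:ℝ) < p := by linarith
    obtain rfl : p = 0 := by
      have : p < 1 := by exact_mod_cast p1
      have : -1 < p := by exact_mod_cast p2
      omega
    push_cast at w0
    have q1 : (q:ℝ) < 1 := by linarith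
    have q2 : (-1:ℝ) < q := by linarith
    obtain rfl : q = 0 := by
      have : q < 1 := by exact_mod_cast q1
      have : -1 < q := by exact_mod_cast q2
      omega
    simp only [C, mem_iUnion, Finset.mem_Icc]
    refine ⟨i, ⟨hi0, hi1⟩, j, ⟨hj0, hj1⟩, h, hh, ?_⟩
    rw [← hw]
    ext r
    fin_cases r <;> simp
  have := hsub hw
  simp only [C, mem_iUnion, Finset.mem_Icc] at this
  obtain ⟨i, ⟨hi0, hi1⟩, j, ⟨hj0, hj1⟩, h, hh, he⟩ := this
  exact ⟨h, hh, i, j, hi0, hi1, hj0, hj1, he⟩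

end TwinDragon

theorem diskLike_of_two_two {A ε : ℤ} {L : Set Pt} (hT : IsTile A 2 2 ε L) : DiskLike L :=
  diskLike_of_sq_map hT ![-(19 / 20), 1] ![1, 0] (by simp) TwinDragon.map
    (shearSeminorm 0 (7 / 5)) (fun _ => shearSeminorm_eq_zero (by norm_num)) (19 / 20)
    (by norm_num) (by norm_num) TwinDragon.map_add_lattice TwinDragon.map_contracting
    TwinDragon.map_injective (fun _ hh _ _ => TwinDragon.map_mem hh)
    (fun _ => TwinDragon.exists_map_eq)

theorem exists_isTile {A B : ℤ} (hAB : |A| ≤ B) (hB : 2 ≤ B) {L : Set Pt} (hLne : L.Nonempty)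
    (hLc : IsCompact L) (hL : LatEq A B L) : ∃ ε, IsTile A B |A| ε L := by
  rcases le_total 0 A with h | h
  · exact ⟨-1, Or.inr rfl, by rw [abs_of_nonneg h]; ring, hAB, hB, hLne, hLc, hL⟩
  · exact ⟨1, Or.inl rfl, by rw [abs_of_nonpos h]; ring, hAB, hB, hLne, hLc, hL⟩

theorem diskLike_of_two_mul_lt {A B a ε : ℤ} {L : Set Pt} (hT : IsTile A B a ε L) (ha : 0 ≤ a)
    (h : 2 * a < B + 3) : DiskLike L := by
  have hB := hT.two_le
  rcases ha.eq_or_lt with rfl | ha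
  · exact diskLike_of_zero hT
  rcases eq_or_ne a 1 with rfl | ha1
  · rcases hB.eq_or_lt with rfl | hB
    · exact diskLike_of_one_two hT
    · exact diskLike_of_one hT rfl hB
  rcases le_or_gt (2 * a) B with h1 | h1
  · exact diskLike_of_two_mul_le hT (by omega) h1
  obtain h2 | h2 : 2 * a = B + 1 ∨ 2 * a = B + 2 := by omega
  · rcases le_or_gt 3 a with h3 | h3
    · exact diskLike_of_two_mul_eq_add_one hT h3 h2
    · obtain rfl : a = 2 := by omega
      obtain rfl : B = 3 := by omega
      exact diskLike_of_two_three hT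
  · rcases le_or_gt 4 a with h3 | h3
    · exact diskLike_of_two_mul_eq_add_two hT h3 h2
    · obtain rfl | rfl : a = 2 ∨ a = 3 := by omega
      · obtain rfl : B = 2 := by omega
        exact diskLike_of_two_two hT
      · obtain rfl : B = 4 := by omega
        exact diskLike_of_three_four hT

/-- A nonvanishing continuous function on a contractible, locally path connected space
has a continuous logarithm. -/
theorem exists_continuous_log {X : Type*} [TopologicalSpace X] [ContractibleSpace X]
    [LocallyPathConnectedSpace X] {g : X → ℂ} (hg : Continuous g) (h0 : ∀ x, g x ≠ 0) :
    ∃ l : X → ℂ, Continuous l ∧ ∀ x, Complex.exp (l x) = g x := by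
  have hu : IsSimplyConnected (univ : Set X) :=
    (Homeomorph.Set.univ X).toHomotopyEquiv.simplyConnectedSpace_iff.2 inferInstance
  obtain ⟨f, hf, he⟩ := Complex.exists_continuousOn_eqOn_exp_comp hu isOpen_univ
    hg.continuousOn (by rintro ⟨x, -, hx⟩; exact h0 x hx)
  exact ⟨f, continuousOn_univ.1 hf, fun x => he (mem_univ x)⟩

/-- A continuous function with constant exponential is constant on a preconnected space. -/
theorem eq_of_exp_eq_const {X : Type*} [TopologicalSpace X] [PreconnectedSpace X] {d : X → ℂ}
    (hd : Continuous d) {c : ℂ} (hc : ∀ x, Complex.exp (d x) = c) (x y : X) : d x = d y := by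
  choose n hn using fun x => Complex.exp_eq_exp_iff_exists_int.1 ((hc x).trans (hc y).symm)
  have hpi : (2 * Real.pi : ℝ) ≠ 0 := by positivity
  have hval : ∀ x, ((d x).im - (d y).im) / (2 * Real.pi) = n x := fun x => by
    have h1 : (d x).im = (d y).im + n x * (2 * Real.pi) := by
      conv_lhs => rw [hn x]
      simp
    rw [h1]; field_simp; ring
  have hnc : Continuous n := by
    refine Int.isClosedEmbedding_coe_real.isEmbedding.continuous_iff.2 ?_
    have : (((↑) : ℤ → ℝ) ∘ n) = fun x => ((d x).im - (d y).im) / (2 * Real.pi) :=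
      funext fun x => (hval x).symm
    rw [this]
    exact ((Complex.continuous_im.comp hd).sub continuous_const).div_const _
  have h2 : n x = n y := PreconnectedSpace.constant inferInstance hnc
  have h3 : n y = 0 := by
    have := hval y
    rw [sub_self, zero_div] at this
    exact_mod_cast this.symm
  rw [hn x, h2, h3]; simp

/-- The universal chord theorem for a plane path, extended quasi-periodically: a path with
displacement `2 w` has, up to multiples of the displacement, a chord `w`. -/
theorem exists_chord {Γ : ℝ → ℂ} (hΓ : Continuous Γ) {w : ℂ} (hw : ∀ s, Γ (s + 1) = Γ s + 2 * w) :
    ∃ s t, Γ s - Γ t = w := by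
  by_contra! hne
  obtain ⟨l, hl, he⟩ := exists_continuous_log (X := ℝ × ℝ) (g := fun x => Γ x.1 - Γ x.2 - w)
    (by fun_prop) (fun x => sub_ne_zero.2 (hne x.1 x.2))
  have hdiag : ∀ s t, l (s + 1, t + 1) = l (s, t) := by
    intro s t
    have h1 := eq_of_exp_eq_const (d := fun x : ℝ × ℝ => l (x.1 + 1, x.2 + 1) - l x) (c := 1)
      (by fun_prop) (fun x => by
        rw [Complex.exp_sub, he, he, hw, hw]
        have := sub_ne_zero.2 (hne x.1 x.2)
        rw [div_eq_one_iff_eq this]; ring) (s, t) (0, 0)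
    have hw0 : w ≠ 0 := fun h => hne 0 0 (by simp [h])
    have h2 := eq_of_exp_eq_const (d := fun s : ℝ => l (s, s)) (c := -w)
      (by fun_prop) (fun x => by rw [he]; ring) (0 + 1) 0
    simp only at h1 h2
    rw [h2, sub_self] at h1
    exact sub_eq_zero.1 h1
  have hneg : ∀ x : ℝ × ℝ, Complex.exp (l (x.1, x.2 - 1) - l (x.2, x.1)) = -1 := fun x => by
    rw [Complex.exp_sub, he, he]
    have := hw (x.2 - 1)
    rw [sub_add_cancel] at this
    have h0 := sub_ne_zero.2 (hne x.2 x.1)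
    rw [div_eq_iff h0]
    simp only
    linear_combination this
  have hconst := eq_of_exp_eq_const (d := fun x : ℝ × ℝ => l (x.1, x.2 - 1) - l (x.2, x.1))
    (by fun_prop) hneg (0, 0) (0, 1)
  have h3 := hdiag 0 (0 - 1)
  simp only [sub_self, zero_sub] at hconst
  rw [zero_sub, zero_add, neg_add_cancel] at h3
  have h4 := hneg (0, 0)
  simp only [zero_sub] at h4
  have h5 : l (0, -1) - l (0, 0) = 0 := by
    rw [h3] at hconst
    have h6 : (2:ℂ) * (l (0, -1) - l (0, 0)) = 0 := by linear_combination hconst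
    simpa using h6
  rw [h5, Complex.exp_zero] at h4
  norm_num at h4

/-- The function `z ↦ Φ z - Φ z₀` has no logarithm on the unit circle if `Φ` is injective on
the closed disk and `z₀` is an inner point. -/
theorem not_exists_log_circle {Φ : ℂ → ℂ} (hΦ : Continuous Φ)
    (hinj : InjOn Φ (Metric.closedBall 0 1)) {z₀ : ℂ} (hz : ‖z₀‖ < 1) {l : ℝ → ℂ}
    (hl : Continuous l) (hper : ∀ θ, l (θ + 2 * Real.pi) = l θ)
    (he : ∀ θ : ℝ, Complex.exp (l θ) = Φ (Complex.exp (θ * Complex.I)) - Φ z₀) : False := by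
  let u : ℝ → ℂ := fun θ => Complex.exp (θ * Complex.I)
  have hu : Continuous u := by fun_prop
  have hun : ∀ θ, ‖u θ‖ = 1 := Complex.norm_exp_ofReal_mul_I
  have huπ : ∀ θ, u (θ + Real.pi) = -u θ := fun θ => by
    simp only [u]; push_cast
    rw [add_mul, Complex.exp_add, Complex.exp_pi_mul_I]; ring
  have hu2π : ∀ θ, u (θ + 2 * Real.pi) = u θ := fun θ => by
    rw [two_mul, ← add_assoc, huπ, huπ, neg_neg]
  let q : ℝ → ℝ := fun τ => max 0 (min 1 τ)
  have hq : Continuous q := by fun_prop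
  have hq0 : ∀ τ, 0 ≤ q τ := fun τ => le_max_left _ _
  have hq1 : ∀ τ, q τ ≤ 1 := fun τ => max_le zero_le_one (min_le_left _ _)
  let y : ℝ × ℝ → ℂ := fun x => (1 - q x.2 : ℝ) * z₀ - (q x.2 : ℝ) * u x.1
  have hy : Continuous y := by fun_prop
  have hyn : ∀ x, ‖y x‖ ≤ (1 - q x.2) * ‖z₀‖ + q x.2 := fun x => by
    refine (norm_sub_le _ _).trans ?_
    rw [norm_mul, norm_mul, hun, Complex.norm_real, Complex.norm_real, mul_one,
      Real.norm_of_nonneg (hq0 _), Real.norm_of_nonneg (sub_nonneg.2 (hq1 _))]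
  obtain ⟨L, hL, hLe⟩ := exists_continuous_log (g := fun x : ℝ × ℝ => Φ (u x.1) - Φ (y x))
    (by fun_prop) (fun x => sub_ne_zero.2 fun h => by
      have h1 : u x.1 = y x := hinj (by simp [hun])
        (by
          rw [mem_closedBall_zero_iff]
          refine (hyn x).trans ?_
          nlinarith [hq0 x.2, hq1 x.2]) h
      have h2 : ((1 - q x.2 : ℝ) : ℂ) * z₀ = ((1 + q x.2 : ℝ) : ℂ) * u x.1 := by
        simp only [y] at h1
        push_cast at h1 ⊢
        linear_combination -h1
      have h3 := congrArg norm h2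
      rw [norm_mul, norm_mul, hun, Complex.norm_real, Complex.norm_real, mul_one,
        Real.norm_of_nonneg (sub_nonneg.2 (hq1 _)),
        Real.norm_of_nonneg (add_nonneg zero_le_one (hq0 x.2))] at h3
      nlinarith [hq0 x.2, hq1 x.2, norm_nonneg z₀])
  have hy0 : ∀ θ, y (θ, 0) = z₀ := fun θ => by simp [y, q]
  have hy1 : ∀ θ, y (θ, 1) = -u θ := fun θ => by simp [y, q]
  have hyp : ∀ θ τ, y (θ + 2 * Real.pi, τ) = y (θ, τ) := fun θ τ => by simp only [y, hu2π]
  have hc1 := eq_of_exp_eq_const (d := fun x : ℝ × ℝ => L (x.1 + 2 * Real.pi, x.2) - L x) (c := 1)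
    (by fun_prop) (fun x => by
      rw [Complex.exp_sub, hLe, hLe]
      simp only [hyp, hu2π]
      refine div_self ?_
      rw [← hLe]; exact Complex.exp_ne_zero _)
  have hc2 := eq_of_exp_eq_const (d := fun θ : ℝ => L (θ, 0) - l θ) (c := 1)
    (by fun_prop) (fun x => by
      rw [Complex.exp_sub, hLe, he]
      simp only [hy0]
      refine div_self ?_
      rw [← he]; exact Complex.exp_ne_zero _) (0 + 2 * Real.pi) 0
  have hneg : ∀ θ : ℝ, Complex.exp (L (θ + Real.pi, 1) - L (θ, 1)) = -1 := fun θ => by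
    rw [Complex.exp_sub, hLe, hLe]
    simp only [hy1, huπ, neg_neg]
    rw [← neg_sub (Φ (u θ)) (Φ (-u θ)), neg_div, div_self]
    have := hLe (θ, 1)
    simp only [hy1] at this
    rw [← this]; exact Complex.exp_ne_zero _
  have hc3 := eq_of_exp_eq_const (d := fun θ : ℝ => L (θ + Real.pi, 1) - L (θ, 1))
    (by fun_prop) hneg (0 + Real.pi) 0
  have h1 := hc1 (0, 1) (0, 0)
  simp only [hper] at hc2 h1 hc3
  rw [add_assoc, ← two_mul] at hc3
  have h2 : L (0 + Real.pi, 1) - L (0, 1) = 0 := by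
    have h6 : (2:ℂ) * (L (0 + Real.pi, 1) - L (0, 1)) = 0 := by
      linear_combination -hc3 + h1 + hc2
    simpa using h6
  have h3 := hneg 0
  rw [h2, Complex.exp_zero] at h3
  norm_num at h3

/-- Invariance of domain for the closed disk in the plane. -/
theorem mem_interior_image_closedBall {Φ : ℂ → ℂ} (hΦ : Continuous Φ)
    (hinj : InjOn Φ (Metric.closedBall 0 1)) (hr : ∀ z, Φ z ∈ Φ '' Metric.closedBall 0 1)
    {z₀ : ℂ} (hz : ‖z₀‖ < 1) : Φ z₀ ∈ interior (Φ '' Metric.closedBall 0 1) := by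
  by_contra hni
  obtain ⟨δ, hδ, hsep⟩ : ∃ δ > 0, ∀ z ∈ Metric.sphere (0:ℂ) 1, δ ≤ ‖Φ z - Φ z₀‖ := by
    obtain ⟨z, hz1, hz2⟩ := (isCompact_sphere (0:ℂ) 1).exists_isMinOn
      (NormedSpace.sphere_nonempty.2 zero_le_one) (f := fun z => ‖Φ z - Φ z₀‖)
      (by fun_prop)
    refine ⟨_, norm_pos_iff.2 (sub_ne_zero.2 fun h => ?_), fun z hz => hz2 hz⟩
    have := hinj (Metric.sphere_subset_closedBall hz1) (by simpa using hz.le) h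
    rw [mem_sphere_zero_iff_norm, this] at hz1
    linarith
  obtain ⟨p, hp, hpd⟩ : ∃ p, p ∉ Φ '' Metric.closedBall 0 1 ∧ ‖p - Φ z₀‖ < δ / 2 := by
    by_contra! h
    refine hni (mem_interior_iff_mem_nhds.2 (Metric.mem_nhds_iff.2
      ⟨δ / 2, by positivity, fun p hp => ?_⟩))
    by_contra hp'
    exact (h p hp').not_gt (by simpa [dist_eq_norm] using hp)
  obtain ⟨l, hl, he⟩ := exists_continuous_log (g := fun z => Φ z - p) (by fun_prop)
    (fun z => sub_ne_zero.2 fun h => hp (h ▸ hr z))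
  let u : ℝ → ℂ := fun θ => Complex.exp (θ * Complex.I)
  have hu : Continuous u := by fun_prop
  have hun : ∀ θ, ‖u θ‖ = 1 := Complex.norm_exp_ofReal_mul_I
  have hu2π : ∀ θ, u (θ + 2 * Real.pi) = u θ := fun θ => by
    simp only [u]; push_cast
    rw [add_mul, Complex.exp_add, Complex.exp_two_pi_mul_I, mul_one]
  have hne : ∀ θ, Φ (u θ) - p ≠ 0 := fun θ => by rw [← he]; exact Complex.exp_ne_zero _
  let r : ℝ → ℂ := fun θ => 1 + (p - Φ z₀) / (Φ (u θ) - p)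
  have hrs : ∀ θ, r θ ∈ Complex.slitPlane := fun θ => by
    refine Complex.mem_slitPlane_of_norm_lt_one ?_
    rw [norm_div, div_lt_one (norm_pos_iff.2 (hne θ))]
    have h1 := hsep (u θ) (by simp [hun])
    have h2 := norm_add_le (Φ (u θ) - p) (p - Φ z₀)
    rw [sub_add_sub_cancel] at h2
    linarith
  have hrc : Continuous r := by
    refine continuous_const.add (Continuous.div (by fun_prop) (by fun_prop) hne)
  refine not_exists_log_circle hΦ hinj hz (l := fun θ => l (u θ) + Complex.log (r θ))
    ((hl.comp hu).add (hrc.clog hrs)) (fun θ => by simp only [r, hu2π]) fun θ => ?_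
  rw [Complex.exp_add, he, Complex.exp_log (Complex.slitPlane_ne_zero (hrs θ))]
  simp only [r]
  rw [mul_add, mul_div_cancel₀ _ (hne θ)]
  simp only [u]; ring

/-- A predicate on `ℤ²` that holds at the origin, is symmetric and propagates along the
difference relation of the substitution holds everywhere. -/
theorem forall_of_substitution_step {a B : ℤ} (ha : 1 ≤ a) (haB : a ≤ B) (hB : 3 ≤ B)
    {P : ℤ → ℤ → Prop} (h0 : P 0 0) (hneg : ∀ s t, P s t → P (-s) (-t))
    (hstep : ∀ p s t, |a * s - B * p - t| ≤ B - 1 → P p s → P s t) (s t : ℤ) : P s t := by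
  have hdiv : ∀ n : ℤ, 0 ≤ n → ∃ p, 0 ≤ p ∧ 0 ≤ n - B * p ∧ n - B * p ≤ B - 1 := fun n hn =>
    ⟨n / B, Int.ediv_nonneg hn (by omega), by
      have := Int.emod_nonneg n (show B ≠ 0 by omega)
      have := Int.emod_def n B
      omega, by
      have := Int.emod_lt_of_pos n (show 0 < B by omega)
      have := Int.emod_def n B
      omega⟩
  have hstep' : ∀ p s t, 0 ≤ a * s - t - B * p → a * s - t - B * p ≤ B - 1 → P p s → P s t :=
    fun p s t h1 h2 h => hstep p s t (abs_le.2 ⟨by linarith, by linarith⟩) h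
  have hle : ∀ m : ℕ, ∀ s t : ℤ, 0 ≤ s → s ≤ t → s + t ≤ m → P s t := by
    intro m
    induction m with
    | zero =>
      intro s t h1 h2 h3
      obtain rfl : s = 0 := by push_cast at h3; omega
      obtain rfl : t = 0 := by push_cast at h3; omega
      exact h0
    | succ m ih =>
      intro s t h1 h2 h3
      push_cast at h3
      have has : s ≤ a * s := by nlinarith
      have hBs : a * s ≤ B * s := by nlinarith
      rcases (h1.trans h2).eq_or_lt with rfl | ht
      · obtain rfl : s = 0 := by omega
        exact h0
      rcases le_or_gt t (a * s) with h | h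
      · obtain ⟨p, hp, hp1, hp2⟩ := hdiv (a * s - t) (by linarith)
        have hps : p < s := by nlinarith
        exact hstep' p s t hp1 hp2 (ih p s hp hps.le (by omega))
      · obtain ⟨q, hq, hq1, hq2⟩ := hdiv (t - a * s) (by linarith)
        have haq : q ≤ a * q := by nlinarith
        have hBq : a * q ≤ B * q := by nlinarith
        have hBq3 : 3 * q ≤ B * q := by nlinarith
        obtain ⟨r, hr, hr1, hr2⟩ := hdiv (a * q + s) (by linarith)
        have hBr3 : 3 * r ≤ B * r := by nlinarith
        have har : r ≤ a * r := by nlinarith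
        have hBr : a * r ≤ B * r := by nlinarith
        have hrq : P r q := by
          rcases le_or_gt r q with h5 | h5
          · exact ih r q hr h5 (by linarith)
          · obtain ⟨p, hp, hp1, hp2⟩ := hdiv (a * r - q) (by linarith)
            have hpr : p ≤ r := by nlinarith
            exact hstep' p r q hp1 hp2 (ih p r hp hpr (by linarith))
        have hqs : P q (-s) := hstep' r q (-s) (by linarith) (by linarith) hrq
        have hqs' : P (-q) s := by simpa using hneg _ _ hqs
        exact hstep (-q) s t (abs_le.2 ⟨by linarith, by linarith⟩) hqs'
  have hle' : ∀ s t : ℤ, 0 ≤ s → s ≤ t → P s t := fun s t h1 h2 =>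
    hle (s + t).toNat s t h1 h2 (by omega)
  have hnn : ∀ s t : ℤ, 0 ≤ s → 0 ≤ t → P s t := by
    intro s t h1 h2
    rcases le_or_gt s t with h | h
    · exact hle' s t h1 h
    · obtain ⟨p, hp, hp1, hp2⟩ := hdiv (a * s - t) (by nlinarith)
      have hps : p ≤ s := by nlinarith
      exact hstep' p s t hp1 hp2 (hle' p s hp hps)
  have hn : ∀ s t : ℤ, 0 ≤ s → P s t := by
    intro s t h1
    rcases le_or_gt 0 t with h | h
    · exact hnn s t h1 h
    · obtain ⟨p, hp, hp1, hp2⟩ := hdiv (a * s - t) (by nlinarith)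
      exact hstep' p s t hp1 hp2 (hnn p s hp h1)
  rcases le_or_gt 0 s with h | h
  · exact hn s t h
  · simpa using hneg _ _ (hn (-s) (-t) (by omega))

open MeasureTheory

/-- Sets whose union has the measure of their disjoint union overlap in null sets. -/
theorem aedisjoint_of_sum_le_measure_biUnion {α ι : Type*} [MeasurableSpace α] {μ : Measure α}
    (W : Finset ι) {C : ι → Set α} (hm : ∀ i, MeasurableSet (C i)) (hf : ∀ i, μ (C i) ≠ ⊤)
    (h : ∑ i ∈ W, μ (C i) ≤ μ (⋃ i ∈ W, C i)) {i j : ι} (hi : i ∈ W) (hj : j ∈ W)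
    (hij : i ≠ j) : μ (C i ∩ C j) = 0 := by
  classical
  have hsub : (⋃ k ∈ W, C k) ⊆ (C i \ C j) ∪ ⋃ k ∈ W.erase i, C k := by
    intro x hx
    obtain ⟨k, hk, hxk⟩ := mem_iUnion₂.1 hx
    by_cases hki : k = i
    · subst hki
      by_cases hxj : x ∈ C j
      · exact Or.inr (mem_iUnion₂.2 ⟨j, Finset.mem_erase.2 ⟨hij.symm, hj⟩, hxj⟩)
      · exact Or.inl ⟨hxk, hxj⟩
    · exact Or.inr (mem_iUnion₂.2 ⟨k, Finset.mem_erase.2 ⟨hki, hk⟩, hxk⟩)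
  have h1 : ∑ k ∈ W, μ (C k) ≤ μ (C i \ C j) + ∑ k ∈ W.erase i, μ (C k) :=
    h.trans ((measure_mono hsub).trans ((measure_union_le _ _).trans
      (add_le_add le_rfl (measure_biUnion_finset_le _ _))))
  rw [← Finset.add_sum_erase _ _ hi] at h1
  have h2 : μ (C i) ≤ μ (C i \ C j) :=
    ENNReal.le_of_add_le_add_right (ENNReal.sum_ne_top.2 fun k _ => hf k) h1
  rw [← measure_inter_add_sdiff (C i) (hm j)] at h2
  have h3 : μ (C i \ C j) ≠ ⊤ := measure_ne_top_of_subset sdiff_subset (hf i)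
  have h4 : μ (C i ∩ C j) + μ (C i \ C j) ≤ 0 + μ (C i \ C j) := by rwa [zero_add]
  exact le_antisymm (ENNReal.le_of_add_le_add_right h3 h4) bot_le

namespace IsTile

variable {A B a ε : ℤ} {L : Set Pt}

/-- The translate of a tile by a lattice vector. -/
def translate (a ε : ℤ) (L : Set Pt) (v : Z2) : Set Pt :=
  (fun x => x + latticeMap ![-(a:ℝ), ε] ![1, 0] v) '' L

theorem translate_zero : translate a ε L 0 = L := by simp [translate]

theorem translate_inter (v w : Z2) :
    volume (translate a ε L v ∩ translate a ε L w) = volume (L ∩ translate a ε L (w - v)) := by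
  have h : translate a ε L v ∩ translate a ε L w =
      (fun x => x + latticeMap ![-(a:ℝ), ε] ![1, 0] v) '' (L ∩ translate a ε L (w - v)) := by
    rw [image_inter (add_left_injective _)]
    congr 1
    simp only [translate, image_image]
    refine image_congr fun x _ => ?_
    rw [map_sub]; abel
  rw [h, image_add_right, measure_preimage_add_right]

theorem volume_inter_translate_neg (v : Z2) (h : volume (L ∩ translate a ε L v) = 0) :
    volume (L ∩ translate a ε L (-v)) = 0 := by
  have h1 := translate_inter (a := a) (ε := ε) (L := L) v 0
  rw [zero_sub, translate_zero, inter_comm, h] at h1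
  exact h1.symm

theorem isCompact_translate (hT : IsTile A B a ε L) (v : Z2) : IsCompact (translate a ε L v) :=
  hT.isCompact.image (by fun_prop)

theorem volume_translate (v : Z2) : volume (translate a ε L v) = volume L := by
  rw [translate, image_add_right, measure_preimage_add_right]

theorem image_latMap_translate (hT : IsTile A B a ε L) (v : Z2) :
    latMap A B '' translate a ε L v =
      ⋃ i ∈ Finset.Icc (0:ℤ) (B - 1), translate a ε L (substMap a B ε v + (0, i)) := by
  have hεε : ε * ε = 1 := by rcases hT.sign with h | h <;> rw [h] <;> rfl
  have hdig : ∀ d : ℤ, latticeMap ![-(a:ℝ), ε] ![1, 0] (0, d) = ![(d:ℝ), 0] := by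
    intro d
    rw [latticeMap_apply]; simp
  have h := latMap_latticeMap hεε hT.eq_neg v (B := B)
  ext x
  simp only [translate, image_image, mem_iUnion, mem_image, map_add, h, hdig, exists_prop,
    Finset.mem_Icc]
  constructor
  · rintro ⟨t, ht, rfl⟩
    obtain ⟨i, h0, h1, t', ht', he⟩ := hT.latEq.exists_of_mem ht
    exact ⟨i, ⟨h0, h1⟩, t', ht', by rw [he]; abel⟩
  · rintro ⟨i, ⟨h0, h1⟩, t', ht', rfl⟩
    obtain ⟨t, ht, he⟩ := hT.latEq.exists_preimage h0 h1 ht'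
    exact ⟨t, ht, by rw [he]; abel⟩

theorem volume_image_latMap (hB : 2 ≤ B) (X : Set Pt) :
    volume (latMap A B '' X) = ENNReal.ofReal B * volume X := by
  have hdet : LinearMap.det (latMap A B) = B := by
    rw [latMap, ← Matrix.toLin'_apply', LinearMap.det_toLin', Matrix.det_fin_two_of]; ring
  have hB' : (0:ℝ) ≤ B := by exact_mod_cast (by omega : 0 ≤ B)
  rw [Measure.addHaar_image_linearMap, hdet, abs_of_nonneg hB']

/-- Overlaps of lattice translates of a tile propagate to null overlaps. -/
theorem volume_inter_translate_substMap (hT : IsTile A B a ε L) {v : Z2}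
    (hv : v = 0 ∨ volume (L ∩ translate a ε L v) = 0) {k : ℤ} (hk : |k| ≤ B - 1)
    (hne : substMap a B ε v + (0, k) ≠ 0) :
    volume (L ∩ translate a ε L (substMap a B ε v + (0, k))) = 0 := by
  classical
  set W : Finset Z2 := {0, v}
  set D : Finset ℤ := Finset.Icc 0 (B - 1)
  have hm : ∀ u, MeasurableSet (translate a ε L u) := fun u =>
    (hT.isCompact_translate u).measurableSet
  have hf : ∀ u, volume (translate a ε L u) ≠ ⊤ := fun u =>
    (hT.isCompact_translate u).measure_ne_top
  have hunion : volume (⋃ u ∈ W, translate a ε L u) = ∑ u ∈ W, volume (translate a ε L u) := by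
    rcases eq_or_ne v 0 with rfl | h0
    · simp [W]
    · rw [Finset.sum_pair h0.symm]
      simp only [W, Finset.mem_insert, Finset.mem_singleton, iUnion_iUnion_eq_or_left,
        iUnion_iUnion_eq_left]
      refine measure_union₀ (hm v).nullMeasurableSet ?_
      rw [translate_zero]
      exact hv.resolve_left h0
  have himage : latMap A B '' (⋃ u ∈ W, translate a ε L u) =
      ⋃ x ∈ W ×ˢ D, translate a ε L (substMap a B ε x.1 + (0, x.2)) := by
    rw [image_iUnion₂]
    simp only [hT.image_latMap_translate]
    ext x
    simp only [mem_iUnion, Finset.mem_product, exists_prop, Prod.exists]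
    constructor
    · rintro ⟨p, q, hu, i, hi, h⟩; exact ⟨p, q, i, ⟨hu, hi⟩, h⟩
    · rintro ⟨p, q, i, ⟨hu, hi⟩, h⟩; exact ⟨p, q, hu, i, hi, h⟩
  have hsum : ∑ x ∈ W ×ˢ D, volume (translate a ε L (substMap a B ε x.1 + (0, x.2))) ≤
      volume (⋃ x ∈ W ×ˢ D, translate a ε L (substMap a B ε x.1 + (0, x.2))) := by
    rw [← himage, volume_image_latMap hT.two_le, hunion]
    simp only [volume_translate, Finset.sum_const, Finset.card_product, nsmul_eq_mul]
    have hD : (D.card : ENNReal) = ENNReal.ofReal B := by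
      rw [Int.card_Icc, ← ENNReal.ofReal_natCast]
      congr 1
      have : ((B - 1 + 1 - 0).toNat : ℤ) = B := by have := hT.two_le; omega
      exact_mod_cast this
    rw [Nat.cast_mul, hD]
    exact le_of_eq (by ring)
  have hkk := _root_.abs_le.1 hk
  obtain ⟨i, j, hi, hj, hij⟩ : ∃ i j, i ∈ D ∧ j ∈ D ∧ j - i = k := by
    rcases le_or_gt 0 k with h | h
    · exact ⟨0, k, by simp only [D, Finset.mem_Icc]; omega, by
        simp only [D, Finset.mem_Icc]; omega, by omega⟩
    · exact ⟨-k, 0, by simp only [D, Finset.mem_Icc]; omega, by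
        simp only [D, Finset.mem_Icc]; omega, by omega⟩
  have hnull := aedisjoint_of_sum_le_measure_biUnion (W ×ˢ D)
    (C := fun x : Z2 × ℤ => translate a ε L (substMap a B ε x.1 + (0, x.2)))
    (fun _ => hm _) (fun _ => hf _) hsum (i := (0, i)) (j := (v, j))
    (Finset.mem_product.2 ⟨by simp [W], hi⟩) (Finset.mem_product.2 ⟨by simp [W], hj⟩)
    (fun h => hne (by
      rw [Prod.mk.injEq] at h
      rw [← h.1, ← hij, h.2]; simp))
  rw [translate_inter] at hnull
  convert hnull using 4
  rw [map_zero, ← hij]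
  ext <;> simp; ring

/-- Distinct lattice translates of a tile overlap in null sets. -/
theorem volume_inter_translate (hT : IsTile A B a ε L) (ha : 1 ≤ a) (haB : a ≤ B) (hB : 3 ≤ B)
    {v : Z2} (hv : v ≠ 0) : volume (L ∩ translate a ε L v) = 0 := by
  have key := forall_of_substitution_step ha haB hB
    (P := fun s t => ((s, t) : Z2) = 0 ∨ volume (L ∩ translate a ε L (s, t)) = 0)
    (Or.inl rfl) (fun s t h => ?_) (fun p s t hk h => ?_) v.1 v.2
  · exact key.resolve_left hv
  · rcases h with h | h
    · exact Or.inl (by simpa using h)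
    · refine Or.inr ?_
      rw [← Prod.neg_mk]
      exact volume_inter_translate_neg _ h
  · by_cases h0 : ((s, t) : Z2) = 0
    · exact Or.inl h0
    refine Or.inr ?_
    rcases hT.sign with rfl | rfl
    · have e : substMap a B 1 (p, s) + (0, t - (a * s - B * p)) = (s, t) := by
        ext <;> simp [substMap]
      rw [← e]
      refine hT.volume_inter_translate_substMap h ?_ (by rwa [e])
      rwa [← abs_neg, neg_sub]
    · have e : substMap a B (-1) (p, s) + (0, a * s - B * p - t) = -(s, t) := by
        ext <;> simp [substMap]; ring
      rw [← neg_neg (s, t), ← e]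
      refine volume_inter_translate_neg _ (hT.volume_inter_translate_substMap h hk ?_)
      rw [e]; simpa using h0

end IsTile

open Filter Topology in
/-- A compact set in which every point has, up to sign, a preimage under the expanding map
contains the origin. -/
theorem zero_mem_of_exists_preimage {A B : ℤ} (hAB : |A| ≤ B) (hB : 2 ≤ B) {S : Set Pt}
    (hS : IsCompact S) (hne : S.Nonempty)
    (h : ∀ u ∈ S, ∃ v ∈ S, latMap A B v = u ∨ latMap A B v = -u) : (0 : Pt) ∈ S := by
  have hS' : IsCompact (S ∪ -S) := hS.union hS.neg
  have h' : ∀ u ∈ S ∪ -S, ∃ v ∈ S ∪ -S, latMap A B v = u := by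
    rintro u (hu | hu)
    · obtain ⟨v, hv, e | e⟩ := h u hu
      · exact ⟨v, Or.inl hv, e⟩
      · exact ⟨-v, Or.inr (by simpa using hv), by rw [map_neg, e, neg_neg]⟩
    · obtain ⟨v, hv, e | e⟩ := h (-u) hu
      · exact ⟨-v, Or.inr (by simpa using hv), by rw [map_neg, e, neg_neg]⟩
      · exact ⟨v, Or.inl hv, by rw [e, neg_neg]⟩
  choose! f hf hfe using h'
  obtain ⟨u₀, hu₀⟩ := hne
  let u : ℕ → Pt := fun n => f^[n] u₀
  have hu : ∀ n, u n ∈ S ∪ -S := fun n => by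
    induction n with
    | zero => exact Or.inl hu₀
    | succ n ih => simp only [u, Function.iterate_succ_apply']; exact hf _ ih
  have hstep : ∀ n, latMap A B (u (n + 1)) = u n := fun n => by
    simp only [u, Function.iterate_succ_apply']; exact hfe _ (hu n)
  have hiter : ∀ j n, (latMap A B)^[j] (u (n + j)) = u n := by
    intro j
    induction j with
    | zero => simp
    | succ j ih => intro n; rw [Function.iterate_succ_apply, ← add_assoc, hstep, ih]
  obtain ⟨x, hx, ψ, hψ, hlim⟩ := hS'.tendsto_subseq hu
  have hMc : Continuous (latMap A B) := (latMap A B).continuous_of_finiteDimensional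
  have hmem : ∀ j, (latMap A B)^[j] x ∈ S ∪ -S := fun j => by
    refine hS'.isClosed.mem_of_tendsto (((hMc.iterate j).tendsto x).comp hlim) ?_
    filter_upwards [eventually_ge_atTop j] with k hk
    obtain ⟨n, hn⟩ := Nat.exists_eq_add_of_le' (hk.trans (hψ.id_le k))
    simp only [Function.comp_apply] at hn ⊢
    rw [hn, hiter]
    exact hu n
  obtain ⟨C, hC⟩ := hS'.isBounded.exists_norm_le
  have h0 := latMap_expanding hAB hB (fun j => (latMap A B)^[j] x) ⟨C, fun n => hC _ (hmem n)⟩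
    (fun n => Function.iterate_succ_apply' _ _ _)
  simp only [Function.iterate_zero, id_eq] at h0
  rw [h0] at hx
  simpa using hx

/-- A plane disk is the injective image of the closed unit disk of `ℂ` under a continuous map
of the whole plane. -/
theorem DiskLike.exists_parametrization {L : Set Pt} (h : DiskLike L) :
    ∃ Ψ : ℂ → Pt, Continuous Ψ ∧ InjOn Ψ (Metric.closedBall 0 1) ∧ (∀ z, Ψ z ∈ L) ∧
      Ψ '' Metric.closedBall 0 1 = L := by
  obtain ⟨h⟩ := h
  let j := Complex.orthonormalBasisOneI.repr
  let r : ℂ → ℂ := fun z => ((max 1 ‖z‖)⁻¹ : ℝ) • z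
  have hpos : ∀ z : ℂ, 0 < max 1 ‖z‖ := fun z => zero_lt_one.trans_le (le_max_left _ _)
  have hr : Continuous r :=
    (Continuous.inv₀ (by fun_prop) fun z => (hpos z).ne').smul continuous_id
  have hrn : ∀ z, ‖r z‖ ≤ 1 := fun z => by
    rw [norm_smul, norm_inv, Real.norm_of_nonneg (hpos z).le, inv_mul_le_one₀ (hpos z)]
    exact le_max_right _ _
  have hrid : ∀ z, ‖z‖ ≤ 1 → r z = z := fun z hz => by simp [r, max_eq_left hz]
  let ρ : ℂ → Metric.closedBall (0 : EuclideanSpace ℝ (Fin 2)) 1 := fun z =>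
    ⟨j (r z), by rw [mem_closedBall_zero_iff, LinearIsometryEquiv.norm_map]; exact hrn z⟩
  have hρ : Continuous ρ := (j.continuous.comp hr).subtype_mk _
  refine ⟨fun z => h.symm (ρ z), continuous_subtype_val.comp (h.symm.continuous.comp hρ),
    fun z hz z' hz' e => ?_, fun z => (h.symm (ρ z)).2, subset_antisymm ?_ fun x hx => ?_⟩
  · have h1 := congrArg Subtype.val (h.symm.injective (Subtype.ext e))
    have h2 := j.injective h1
    rwa [hrid z (by simpa using hz), hrid z' (by simpa using hz')] at h2
  · rintro _ ⟨z, -, rfl⟩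
    exact (h.symm (ρ z)).2
  · have hn : ‖j.symm (h ⟨x, hx⟩)‖ ≤ 1 := by
      rw [LinearIsometryEquiv.norm_map]; exact mem_closedBall_zero_iff.1 (h ⟨x, hx⟩).2
    refine ⟨j.symm (h ⟨x, hx⟩), by simpa using hn, ?_⟩
    have e : ρ (j.symm (h ⟨x, hx⟩)) = h ⟨x, hx⟩ := by
      refine Subtype.ext ?_
      simp only [ρ]
      rw [hrid _ hn, LinearIsometryEquiv.apply_symm_apply]
    simp only [e, Homeomorph.symm_apply_apply]

namespace IsTile

variable {A B a ε : ℤ} {L : Set Pt}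

/-- For large `a`, a tile contains two points with difference twice a lattice vector. -/
theorem exists_sub_eq (hT : IsTile A B a ε L) (ha : B + 3 ≤ 2 * a) (haB : a ≤ B) :
    ∃ x ∈ L, ∃ y ∈ L, y - x = (2:ℝ) • latticeMap ![-(a:ℝ), ε] ![1, 0] (1, 1) := by
  set w := latticeMap ![-(a:ℝ), ε] ![1, 0] (1, 1) with hw
  have hεε : ε * ε = 1 := by rcases hT.sign with h | h <;> rw [h] <;> rfl
  have hMw : latMap A B w = (ε:ℝ) • (w - ![((B + 1 - a : ℤ) : ℝ), 0]) := by
    rw [hw, latMap_latticeMap hεε hT.eq_neg, latticeMap_apply, latticeMap_apply]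
    ext i
    fin_cases i <;> simp [substMap]; ring
  have hdig : ![((2 * (B + 1 - a) : ℤ) : ℝ), 0] = (2:ℝ) • ![((B + 1 - a : ℤ) : ℝ), 0] := by
    ext i
    fin_cases i <;> simp
  have h00 : ![((0 : ℤ) : ℝ), 0] = (0 : Pt) := by
    ext i
    fin_cases i <;> simp
  have h0 := zero_mem_of_exists_preimage hT.abs_le hT.two_le
    (S := (fun x : Pt × Pt => x.2 - x.1 - (2:ℝ) • w) '' L ×ˢ L)
    ((hT.isCompact.prod hT.isCompact).image (by fun_prop)) ((hT.nonempty.prod hT.nonempty).image _)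
    (by
      rintro _ ⟨⟨x, y⟩, ⟨hx, hy⟩, rfl⟩
      rcases hT.sign with h | h
      · obtain ⟨x', hx', ex⟩ := hT.latEq.exists_preimage (i := 2 * (B + 1 - a)) (by omega)
          (by omega) hx
        obtain ⟨y', hy', ey⟩ := hT.latEq.exists_preimage (i := 0) le_rfl (by omega) hy
        refine ⟨_, ⟨(x', y'), ⟨hx', hy'⟩, rfl⟩, Or.inl ?_⟩
        simp only [map_sub, map_smul, ex, ey, hMw, hdig, h00, h]
        push_cast
        module
      · obtain ⟨y', hy', ey⟩ := hT.latEq.exists_preimage (i := 2 * (B + 1 - a)) (by omega)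
          (by omega) hx
        obtain ⟨x', hx', ex⟩ := hT.latEq.exists_preimage (i := 0) le_rfl (by omega) hy
        refine ⟨_, ⟨(x', y'), ⟨hx', hy'⟩, rfl⟩, Or.inr ?_⟩
        simp only [map_sub, map_smul, ex, ey, hMw, hdig, h00, h]
        push_cast
        module)
  obtain ⟨⟨x, y⟩, ⟨hx, hy⟩, e⟩ := h0
  exact ⟨x, hx, y, hy, sub_eq_zero.1 e⟩

/-- A tile which is the closure of its interior does not meet the interior of a translate. -/
theorem sub_ne_of_mem_interior (hT : IsTile A B a ε L) (ha : 1 ≤ a) (haB : a ≤ B) (hB : 3 ≤ B)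
    (hcl : L ⊆ closure (interior L)) {p q : Pt} (hp : p ∈ interior L) (hq : q ∈ L) {v : Z2}
    (hv : v ≠ 0) : p - q ≠ latticeMap ![-(a:ℝ), ε] ![1, 0] v := by
  intro hpq
  set τ := latticeMap ![-(a:ℝ), ε] ![1, 0] v with hτ
  have hU : IsOpen ((fun x => x + τ) ⁻¹' interior L) :=
    isOpen_interior.preimage (by fun_prop)
  have hqU : q ∈ (fun x => x + τ) ⁻¹' interior L := by
    rw [mem_preimage, ← hpq, add_sub_cancel]; exact hp
  have hne := mem_closure_iff.1 (hcl hq) _ hU hqU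
  have hpos := (hU.inter isOpen_interior).measure_pos volume hne
  refine hpos.not_ge ((measure_mono ?_).trans
    (hT.volume_inter_translate ha haB hB (neg_ne_zero.2 hv)).le)
  rintro x ⟨hx1, hx2⟩
  refine ⟨interior_subset hx2, x + τ, interior_subset hx1, ?_⟩
  simp only [map_neg, ← hτ]
  abel

/-- For large `a`, a tile is not a disk. -/
theorem not_diskLike (hT : IsTile A B a ε L) (ha : B + 3 ≤ 2 * a) (haB : a ≤ B) :
    ¬ DiskLike L := by
  intro hd
  have hB := hT.two_le
  obtain ⟨Ψ, hΨ, hinj, hΨL, himg⟩ := hd.exists_parametrization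
  obtain ⟨κ⟩ : Nonempty (Pt ≃L[ℝ] ℂ) := ⟨Complex.basisOneI.equivFunL.symm⟩
  have hint : ∀ z, ‖z‖ < 1 → Ψ z ∈ interior L := fun z hz => by
    have hk : (fun z => κ (Ψ z)) '' Metric.closedBall 0 1 = κ '' L := by
      rw [← himg, image_image]
    have := mem_interior_image_closedBall (Φ := fun z => κ (Ψ z)) (κ.continuous.comp hΨ)
      (fun z hz z' hz' e => hinj hz hz' (κ.injective e))
      (fun z => hk ▸ mem_image_of_mem _ (hΨL z)) hz
    rw [hk, ← κ.coe_toHomeomorph, ← κ.toHomeomorph.image_interior] at this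
    obtain ⟨x, hx, e⟩ := this
    rwa [← κ.injective e]
  have hcl : L ⊆ closure (interior L) := by
    nth_rw 1 [← himg, ← closure_ball (0:ℂ) one_ne_zero]
    refine (image_closure_subset_closure_image hΨ).trans (closure_mono ?_)
    rintro _ ⟨z, hz, rfl⟩
    exact hint z (by simpa using hz)
  obtain ⟨x, hx, y, hy, hxy⟩ := hT.exists_sub_eq ha haB
  set w := latticeMap ![-(a:ℝ), ε] ![1, 0] (1, 1) with hw
  have hmw : ∀ m : ℤ, (m:ℝ) • w = latticeMap ![-(a:ℝ), ε] ![1, 0] (m, m) := fun m => by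
    rw [hw, latticeMap_apply, latticeMap_apply]
    ext i
    fin_cases i <;> simp; ring
  have hε : (ε:ℝ) ≠ 0 := by rcases hT.sign with h | h <;> rw [h] <;> norm_num
  have hw0 : w ≠ 0 := fun h => hε (by
    have := congrFun h 1
    rw [hw, latticeMap_apply] at this
    simpa using this)
  rw [← himg] at hx hy
  obtain ⟨z₀, hz₀, rfl⟩ := hx
  obtain ⟨z₁, hz₁, rfl⟩ := hy
  have hz01 : z₀ ≠ z₁ := by
    rintro rfl
    rw [sub_self] at hxy
    simpa [hw0] using hxy.symm
  let σ : ℝ → ℂ := fun s => (1 - s) • z₀ + s • z₁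
  have hσ : ∀ s, 0 < s → s < 1 → ‖σ s‖ < 1 := fun s h0 h1 => by
    have := strictConvex_closedBall ℝ (0:ℂ) 1 hz₀ hz₁ hz01 (sub_pos.2 h1) h0 (by ring)
    rw [interior_closedBall _ one_ne_zero] at this
    exact mem_ball_zero_iff.1 this
  have hσ0 : σ 0 = z₀ := by simp [σ]
  have hσ1 : σ 1 = z₁ := by simp [σ]
  have hfr : Continuous fun s : ℝ => κ (Ψ (σ (Int.fract s))) - Int.fract s * (2 * κ w) := by
    refine ContinuousOn.comp_fract'' (f := fun s : ℝ => κ (Ψ (σ s)) - s * (2 * κ w))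
      (Continuous.continuousOn (by fun_prop)) ?_
    have := congrArg κ hxy
    rw [map_sub, map_smul] at this
    simp only [hσ0, hσ1, Complex.real_smul] at this ⊢
    push_cast at this ⊢
    linear_combination -this
  obtain ⟨s, t, hst⟩ := exists_chord
    (Γ := fun s : ℝ => κ (Ψ (σ (Int.fract s))) - Int.fract s * (2 * κ w) + s * (2 * κ w))
    (w := κ w) (by fun_prop) (fun s => by simp only [Int.fract_add_one]; push_cast; ring)
  have hst' : Ψ (σ (Int.fract s)) - Ψ (σ (Int.fract t)) =
      latticeMap ![-(a:ℝ), ε] ![1, 0] (1 - 2 * (⌊s⌋ - ⌊t⌋), 1 - 2 * (⌊s⌋ - ⌊t⌋)) := by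
    rw [← hmw]
    refine κ.injective ?_
    rw [map_sub, map_smul, Complex.real_smul]
    have h1 : (s:ℂ) = ⌊s⌋ + (Int.fract s : ℝ) := by exact_mod_cast (Int.floor_add_fract s).symm
    have h2 : (t:ℂ) = ⌊t⌋ + (Int.fract t : ℝ) := by exact_mod_cast (Int.floor_add_fract t).symm
    push_cast
    linear_combination hst - 2 * κ w * h1 + 2 * κ w * h2
  set m := 1 - 2 * (⌊s⌋ - ⌊t⌋) with hm
  have hm0 : ((m, m) : Z2) ≠ 0 := fun h => by
    have := congrArg Prod.fst h
    simp only [Prod.fst_zero] at this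
    omega
  rcases (Int.fract_nonneg s).eq_or_lt with h0 | h0
  · rcases (Int.fract_nonneg t).eq_or_lt with h1 | h1
    · rw [← h0, ← h1, sub_self, ← hmw] at hst'
      rcases smul_eq_zero.1 hst'.symm with h | h
      · have : m = 0 := by exact_mod_cast h
        omega
      · exact hw0 h
    · refine hT.sub_ne_of_mem_interior (by omega) haB (by omega) hcl
        (hint _ (hσ _ h1 (Int.fract_lt_one t))) (hΨL (σ (Int.fract s))) (neg_ne_zero.2 hm0) ?_
      rw [map_neg, ← hst', neg_sub]
  · exact hT.sub_ne_of_mem_interior (by omega) haB (by omega) hcl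
      (hint _ (hσ _ h0 (Int.fract_lt_one s))) (hΨL (σ (Int.fract t))) hm0 hst'

end IsTile

theorem stmt_4 (A B : ℤ) (hAB : |A| ≤ B) (hB : 2 ≤ B)
    (L : Set Pt) (hLne : L.Nonempty) (hLc : IsCompact L) (hL : LatEq A B L) :
    DiskLike L ↔ 2 * |A| < B + 3 := by
  obtain ⟨ε, hT⟩ := exists_isTile hAB hB hLne hLc hL
  refine ⟨fun h => ?_, diskLike_of_two_mul_lt hT (abs_nonneg A)⟩
  by_contra! hlt
  exact hT.not_diskLike hlt hAB h
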